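/- Let D be a bounded strictly pseudoconvex domain in ℂⁿ with boundary of class C². Then for all sufficiently large N there exists a complete proper holomorphic embedding F : D → 𝔹_N of D into the open unit ball of ℂ^N. -/

import Mathlib

open Metric Set Filter Function
open scoped ENNReal Topology

noncomputable section

/-- `ℂⁿ` with the Euclidean (Hermitian) metric. -/
abbrev CSp (n : ℕ) := EuclideanSpace ℂ (Fin n)

/-- `D` is a bounded strictly pseudoconvex domain in `ℂⁿ` with boundary of class `C²`:
`D` is open, connected, bounded, and admits a `C²` defining function `ρ` which is strictly
plurisubharmonic in a neighbourhood of the boundary (the Levi form, expressed through the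
real Hessian `H` as `H(v,v) + H(iv,iv)`, is positive on nonzero vectors) and has
nonvanishing differential on the boundary. -/
def IsStrictlyPseudoconvexC2Domain {n : ℕ} (D : Set (CSp n)) : Prop :=
  IsOpen D ∧ IsConnected D ∧ Bornology.IsBounded D ∧
    ∃ (U : Set (CSp n)) (ρ : CSp n → ℝ), IsOpen U ∧ frontier D ⊆ U ∧
      ContDiff ℝ 2 ρ ∧ D = {z | ρ z < 0} ∧
      (∀ z ∈ frontier D, fderiv ℝ ρ z ≠ 0) ∧
      ∀ z ∈ U, ∀ v : CSp n, v ≠ 0 →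
        0 < fderiv ℝ (fderiv ℝ ρ) z v v
            + fderiv ℝ (fderiv ℝ ρ) z (Complex.I • v) (Complex.I • v)

/-- A divergent path in `D`: a continuous path `γ : [0,1) → D` which eventually leaves
every compact subset of `D`. -/
def IsDivergentPath {n : ℕ} (D : Set (CSp n)) (γ : ℝ → CSp n) : Prop :=
  ContinuousOn γ (Set.Ico 0 1) ∧ (∀ t ∈ Set.Ico (0:ℝ) 1, γ t ∈ D) ∧
    ∀ K : Set (CSp n), K ⊆ D → IsCompact K →
      ∃ t₀ ∈ Set.Ico (0:ℝ) 1, ∀ t ∈ Set.Ico t₀ 1, γ t ∉ K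

/-- The map `F` is complete on `D`: the metric `F*ds²` obtained by pulling back the
Euclidean metric of the target along `F` is complete on `D`; equivalently, every divergent
path in `D` has infinite length in the induced metric, i.e. its `F`-image has infinite
Euclidean length. -/
def IsCompleteMapOn {n N : ℕ} (F : CSp n → EuclideanSpace ℂ (Fin N)) (D : Set (CSp n)) :
    Prop :=
  ∀ γ : ℝ → CSp n, IsDivergentPath D γ → eVariationOn (F ∘ γ) (Set.Ico 0 1) = ⊤

open MeasureTheory

/-- coordinate vector -/
def ee {n : ℕ} (j : Fin n) : CSp n := EuclideanSpace.single j (1:ℂ)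

/-- first order operator `(∂_{e_j} + s ∂_{i e_j})/2`. -/
def dw {n : ℕ} (s : ℂ) (j : Fin n) (f : CSp n → ℂ) (x : CSp n) : ℂ :=
  (fderiv ℝ f x (ee j) + s * fderiv ℝ f x (Complex.I • ee j)) / 2

lemma dw_mul {n : ℕ} (s : ℂ) (j : Fin n) {f g : CSp n → ℂ} {x : CSp n}
    (hf : DifferentiableAt ℝ f x) (hg : DifferentiableAt ℝ g x) :
    dw s j (fun y => f y * g y) x = dw s j f x * g x + f x * dw s j g x := by
  unfold dw
  rw [fderiv_fun_mul hf hg]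
  simp
  ring

lemma dw_add {n : ℕ} (s : ℂ) (j : Fin n) {f g : CSp n → ℂ} {x : CSp n}
    (hf : DifferentiableAt ℝ f x) (hg : DifferentiableAt ℝ g x) :
    dw s j (fun y => f y + g y) x = dw s j f x + dw s j g x := by
  unfold dw
  rw [fderiv_fun_add hf hg]
  simp
  ring

lemma dw_sub {n : ℕ} (s : ℂ) (j : Fin n) {f g : CSp n → ℂ} {x : CSp n}
    (hf : DifferentiableAt ℝ f x) (hg : DifferentiableAt ℝ g x) :
    dw s j (fun y => f y - g y) x = dw s j f x - dw s j g x := by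
  unfold dw
  rw [fderiv_fun_sub hf hg]
  simp
  ring

lemma dw_congr {n : ℕ} (s : ℂ) (j : Fin n) {f g : CSp n → ℂ} {x : CSp n}
    (h : f =ᶠ[𝓝 x] g) : dw s j f x = dw s j g x := by
  unfold dw
  rw [h.fderiv_eq]

lemma dw_eq_zero {n : ℕ} (s : ℂ) (j : Fin n) {f : CSp n → ℂ} {x : CSp n}
    (h : x ∉ tsupport f) : dw s j f x = 0 := by
  unfold dw
  rw [fderiv_of_notMem_tsupport (𝕜 := ℝ) h]
  simp

lemma fderiv_star_comp {n : ℕ} {f : CSp n → ℂ} {x : CSp n}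
    (hf : DifferentiableAt ℝ f x) (v : CSp n) :
    fderiv ℝ (fun y => star (f y)) x v = star (fderiv ℝ f x v) := by
  have := (Complex.conjCLE.toContinuousLinearMap.hasFDerivAt.comp x hf.hasFDerivAt).fderiv
  have h2 : (fun y => star (f y)) = (Complex.conjCLE.toContinuousLinearMap : ℂ → ℂ) ∘ f := by
    ext y; simp
  rw [h2, this]; simp

lemma dw_star {n : ℕ} (s : ℂ) (j : Fin n) {f : CSp n → ℂ} {x : CSp n}
    (hf : DifferentiableAt ℝ f x) :
    dw s j (fun y => star (f y)) x = star (dw (star s) j f x) := by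
  unfold dw
  rw [fderiv_star_comp hf, fderiv_star_comp hf]
  simp

/-- the class `C^k_c(Ω)` -/
def Tst {n : ℕ} (k : ℕ) (Ω : Set (CSp n)) (f : CSp n → ℂ) : Prop :=
  ContDiff ℝ k f ∧ HasCompactSupport f ∧ tsupport f ⊆ Ω

lemma Tst.contDiff_mul {n k : ℕ} {Ω : Set (CSp n)} (hΩ : IsOpen Ω) {f g : CSp n → ℂ}
    (hf : Tst k Ω f) (hg : ContDiffOn ℝ k g Ω) : Tst k Ω (fun x => f x * g x) := by
  have hs : tsupport (fun x => f x * g x) ⊆ tsupport f := tsupport_mul_subset_left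
  refine ⟨?_, ?_, hs.trans hf.2.2⟩
  · rw [contDiff_iff_contDiffAt]
    intro x
    by_cases hx : x ∈ tsupport f
    · have := hg.contDiffAt (hΩ.mem_nhds (hf.2.2 hx))
      exact hf.1.contDiffAt.mul this
    · have : (fun x => f x * g x) =ᶠ[𝓝 x] fun _ => 0 := by
        filter_upwards [notMem_tsupport_iff_eventuallyEq.1 hx] with y hy
        simp [hy]
      exact contDiffAt_const.congr_of_eventuallyEq this
  · exact hf.2.1.mul_right

lemma Tst.mono {n k : ℕ} {Ω : Set (CSp n)} {f : CSp n → ℂ} (hf : Tst k Ω f) {l : ℕ} (h : l ≤ k) :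
    Tst l Ω f := ⟨hf.1.of_le (by exact_mod_cast h), hf.2.1, hf.2.2⟩

lemma dw_contDiff {n k : ℕ} (s : ℂ) (j : Fin n) {f : CSp n → ℂ} (hf : ContDiff ℝ (k+1 : ℕ) f) :
    ContDiff ℝ k (dw s j f) := by
  have h := hf.fderiv_right (m := k) (by norm_cast)
  unfold dw
  fun_prop

lemma dw_contDiffOn {n k : ℕ} {Ω : Set (CSp n)} (hΩ : IsOpen Ω) (s : ℂ) (j : Fin n)
    {f : CSp n → ℂ} (hf : ContDiffOn ℝ (k+1 : ℕ) f Ω) :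
    ContDiffOn ℝ k (dw s j f) Ω := by
  have h := hf.fderiv_of_isOpen (m := k) hΩ (by norm_cast)
  unfold dw
  fun_prop

lemma tsupport_dw {n : ℕ} (s : ℂ) (j : Fin n) (f : CSp n → ℂ) : tsupport (dw s j f) ⊆ tsupport f := by
  refine closure_minimal ?_ (isClosed_tsupport f)
  intro x hx
  by_contra h
  exact hx (dw_eq_zero s j h)

lemma Tst.dw {n k : ℕ} {Ω : Set (CSp n)} {f : CSp n → ℂ} (hf : Tst (k+1) Ω f) (s : ℂ) (j : Fin n) :
    Tst k Ω (dw s j f) :=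
  ⟨dw_contDiff s j hf.1, hf.2.1.mono' ((subset_tsupport _).trans (tsupport_dw s j f)),
    (tsupport_dw s j f).trans hf.2.2⟩

lemma Tst.starf {n k : ℕ} {Ω : Set (CSp n)} {f : CSp n → ℂ} (hf : Tst k Ω f) :
    Tst k Ω (fun x => star (f x)) := by
  have hs : support (fun x => star (f x)) = support f := by
    ext x; simp
  refine ⟨?_, ?_, ?_⟩
  · exact (Complex.conjCLE.toContinuousLinearMap.contDiff (n := k)).comp hf.1
  · unfold HasCompactSupport tsupport; rw [hs]; exact hf.2.1
  · unfold tsupport; rw [hs]; exact hf.2.2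

lemma Tst.continuous {n k : ℕ} {Ω : Set (CSp n)} {f : CSp n → ℂ} (hf : Tst k Ω f) : Continuous f :=
  hf.1.continuous

lemma Tst.integrable {n k : ℕ} {Ω : Set (CSp n)} {f : CSp n → ℂ} (hf : Tst k Ω f) :
    Integrable f := hf.continuous.integrable_of_hasCompactSupport hf.2.1

lemma integral_fderiv_zero {n : ℕ} {Ω : Set (CSp n)} {f : CSp n → ℂ} (hf : Tst 1 Ω f) (v : CSp n) :
    ∫ x, fderiv ℝ f x v = 0 := by
  have hc : Continuous (fun x => fderiv ℝ f x v) := by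
    have := hf.1.continuous_fderiv (by norm_num)
    fun_prop
  have hi : Integrable (fun x => fderiv ℝ f x v) := by
    apply hc.integrable_of_hasCompactSupport
    exact hf.2.1.fderiv_apply (𝕜 := ℝ) v
  have := integral_smul_fderiv_eq_neg_fderiv_smul_of_integrable (𝕜 := ℝ) (μ := volume)
    (f := fun _ => (1:ℝ)) (g := f) (v := v)
    (by simp) (by simpa using hi) (by simpa using hf.integrable)
    (fun x _ => differentiableAt_const _) (fun x _ => hf.1.differentiable (by norm_num) x)
  simpa using this

lemma integral_dw_zero {n : ℕ} {Ω : Set (CSp n)} {f : CSp n → ℂ} (hf : Tst 1 Ω f) (s : ℂ) (j : Fin n) :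
    ∫ x, dw s j f x = 0 := by
  have hc : ∀ v, Integrable (fun x => fderiv ℝ f x v) := by
    intro v
    apply Continuous.integrable_of_hasCompactSupport
    · have := hf.1.continuous_fderiv (by norm_num)
      fun_prop
    exact hf.2.1.fderiv_apply (𝕜 := ℝ) v
  unfold dw
  rw [integral_div, integral_add (hc _) ((hc _).const_mul s), integral_const_mul,
    integral_fderiv_zero hf, integral_fderiv_zero hf]
  simp

/-- integration by parts -/
lemma ibp {n : ℕ} {Ω : Set (CSp n)} (hΩ : IsOpen Ω) {f g : CSp n → ℂ} (hf : Tst 1 Ω f)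
    (hg : ContDiffOn ℝ 1 g Ω) (s : ℂ) (j : Fin n) :
    ∫ x, f x * dw s j g x = - ∫ x, dw s j f x * g x := by
  have h0 := integral_dw_zero (hf.contDiff_mul hΩ (k := 1) (by exact_mod_cast hg)) s j
  have h1 : ∀ x, dw s j (fun y => f y * g y) x = dw s j f x * g x + f x * dw s j g x := by
    intro x
    by_cases hx : x ∈ tsupport f
    · apply dw_mul
      · exact hf.1.differentiable (by norm_num) x
      · exact (hg.contDiffAt (hΩ.mem_nhds (hf.2.2 hx))).differentiableAt (by norm_num)
    · rw [dw_eq_zero, dw_eq_zero _ _ hx, image_eq_zero_of_notMem_tsupport hx]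
      · simp
      · exact fun h => hx (tsupport_mul_subset_left h)
  simp_rw [h1] at h0
  have hf0 : Tst 0 Ω f := hf.mono (by norm_num)
  have hd0 : Tst 0 Ω (dw s j f) := Tst.dw (k := 0) hf s j
  have hgd : ContDiffOn ℝ ((0:ℕ):WithTop ℕ∞) (dw s j g) Ω := dw_contDiffOn hΩ s j (by exact_mod_cast hg)
  have i1 := (hd0.contDiff_mul hΩ (hg.of_le (by norm_num))).integrable
  have i2 := (hf0.contDiff_mul hΩ hgd).integrable
  rw [integral_add i1 i2] at h0
  linear_combination h0

lemma dw_comm {n : ℕ} (s t : ℂ) (j k : Fin n) {f : CSp n → ℂ} {x : CSp n} (hf : ContDiffAt ℝ 2 f x) :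
    dw s j (dw t k f) x = dw t k (dw s j f) x := by
  have hsym : IsSymmSndFDerivAt ℝ f x := hf.isSymmSndFDerivAt (by simp)
  have hd : DifferentiableAt ℝ (fderiv ℝ f) x :=
    (hf.fderiv_right (m := 1) (by norm_num)).differentiableAt (by norm_num)
  have key : ∀ (t : ℂ) (k : Fin n) (v : CSp n), fderiv ℝ (dw t k f) x v =
      (fderiv ℝ (fderiv ℝ f) x v (ee k) + t * fderiv ℝ (fderiv ℝ f) x v (Complex.I • ee k)) / 2 := by
    intro t k v
    have h1 : ∀ w, HasFDerivAt (fun y => fderiv ℝ f y w) ((fderiv ℝ (fderiv ℝ f) x).flip w) x := by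
      intro w
      have := hd.hasFDerivAt.clm_apply (hasFDerivAt_const w x)
      simpa using this
    have h2 : HasFDerivAt (dw t k f) ((2:ℂ)⁻¹ • ((fderiv ℝ (fderiv ℝ f) x).flip (ee k) +
        t • ((fderiv ℝ (fderiv ℝ f) x).flip (Complex.I • ee k)))) x := by
      have := ((h1 (ee k)).add ((h1 (Complex.I • ee k)).const_smul t)).const_smul ((2:ℂ)⁻¹)
      refine this.congr_of_eventuallyEq (Eventually.of_forall fun y => ?_)
      simp [dw]; ring
    rw [h2.fderiv]
    simp; ring
  unfold dw at *
  rw [key, key, key, key]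
  rw [hsym.eq (ee j) (ee k), hsym.eq (ee j) (Complex.I • ee k), hsym.eq (Complex.I • ee j) (ee k),
    hsym.eq (Complex.I • ee j) (Complex.I • ee k)]
  ring

open MeasureTheory

def dz {n : ℕ} (j : Fin n) (f : CSp n → ℂ) (x : CSp n) : ℂ := dw (-Complex.I) j f x
def dzb {n : ℕ} (j : Fin n) (f : CSp n → ℂ) (x : CSp n) : ℂ := dw Complex.I j f x

/-- complexification of a real function -/
def cx {n : ℕ} (φ : CSp n → ℝ) (x : CSp n) : ℂ := (φ x : ℂ)

lemma star_dz_real {n : ℕ} {φ : CSp n → ℝ} {x : CSp n} (h : DifferentiableAt ℝ φ x) (j : Fin n) :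
    star (dz j (cx φ) x) = dzb j (cx φ) x := by
  have hc : DifferentiableAt ℝ (cx φ) x := Complex.ofRealCLM.differentiableAt.comp x h
  have h2 : (fun y => star (cx φ y)) = cx φ := by ext y; simp [cx]
  have := dw_star Complex.I j hc
  rw [h2] at this
  unfold dz dzb
  rw [this]; simp

def wt {n : ℕ} (φ : CSp n → ℝ) (x : CSp n) : ℂ := (Real.exp (-φ x) : ℂ)

lemma cx_contDiffOn {n k : ℕ} {Ω : Set (CSp n)} {φ : CSp n → ℝ} (h : ContDiffOn ℝ k φ Ω) :
    ContDiffOn ℝ k (cx φ) Ω := Complex.ofRealCLM.contDiff.comp_contDiffOn h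

lemma wt_contDiffOn {n k : ℕ} {Ω : Set (CSp n)} {φ : CSp n → ℝ} (h : ContDiffOn ℝ k φ Ω) :
    ContDiffOn ℝ k (wt φ) Ω :=
  Complex.ofRealCLM.contDiff.comp_contDiffOn (Real.contDiff_exp.comp_contDiffOn h.neg)

lemma dw_wt {n : ℕ} {φ : CSp n → ℝ} {x : CSp n} (h : DifferentiableAt ℝ φ x) (s : ℂ) (j : Fin n) :
    dw s j (wt φ) x = - wt φ x * dw s j (cx φ) x := by
  have h1 : HasFDerivAt (wt φ) (Complex.ofRealCLM.comp (Real.exp (-φ x) • (-fderiv ℝ φ x))) x :=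
    Complex.ofRealCLM.hasFDerivAt.comp x (h.hasFDerivAt.neg.exp)
  have h2 : HasFDerivAt (cx φ) (Complex.ofRealCLM.comp (fderiv ℝ φ x)) x :=
    Complex.ofRealCLM.hasFDerivAt.comp x h.hasFDerivAt
  unfold dw
  rw [h1.fderiv, h2.fderiv]
  simp [wt]; ring

/-- `δ_j a = ∂_j a - a ∂_j φ` -/
def del {n : ℕ} (φ : CSp n → ℝ) (j : Fin n) (a : CSp n → ℂ) (x : CSp n) : ℂ :=
  dz j a x - a x * dz j (cx φ) x

lemma Tst.subf {n k : ℕ} {Ω : Set (CSp n)} {f g : CSp n → ℂ} (hf : Tst k Ω f) (hg : Tst k Ω g) :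
    Tst k Ω (fun x => f x - g x) := by
  refine ⟨hf.1.sub hg.1, hf.2.1.sub hg.2.1, ?_⟩
  refine (closure_mono (support_sub f g)).trans ?_
  rw [closure_union]
  exact union_subset hf.2.2 hg.2.2

lemma Tst.addf {n k : ℕ} {Ω : Set (CSp n)} {f g : CSp n → ℂ} (hf : Tst k Ω f) (hg : Tst k Ω g) :
    Tst k Ω (fun x => f x + g x) := by
  refine ⟨hf.1.add hg.1, hf.2.1.add hg.2.1, ?_⟩
  refine (closure_mono (support_add f g)).trans ?_
  rw [closure_union]
  exact union_subset hf.2.2 hg.2.2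

lemma Tst.zerof {n k : ℕ} {Ω : Set (CSp n)} : Tst k Ω (fun _ => (0:ℂ)) := by
  refine ⟨contDiff_const, HasCompactSupport.zero, ?_⟩
  have : tsupport (fun _ : CSp n => (0:ℂ)) = ∅ := by
    rw [tsupport_eq_empty_iff]; rfl
  rw [this]; exact empty_subset _

lemma Tst.sumf {n k : ℕ} {Ω : Set (CSp n)} {ι : Type*} (s : Finset ι) {f : ι → CSp n → ℂ}
    (hf : ∀ i ∈ s, Tst k Ω (f i)) : Tst k Ω (fun x => ∑ i ∈ s, f i x) := by
  classical
  induction s using Finset.induction_on with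
  | empty => simpa using Tst.zerof
  | insert a s ha ih =>
    simp only [Finset.sum_insert ha]
    exact (hf a (by simp)).addf (ih (fun i hi => hf i (by simp [hi])))

lemma Tst.del {n : ℕ} {Ω : Set (CSp n)} (hΩ : IsOpen Ω) {φ : CSp n → ℝ}
    (hφ : ContDiffOn ℝ 2 φ Ω) {a : CSp n → ℂ} (ha : Tst 2 Ω a) (j : Fin n) :
    Tst 1 Ω (del φ j a) :=
  (Tst.dw (k := 1) ha _ j).subf ((ha.mono (by norm_num)).contDiff_mul hΩ
    (dw_contDiffOn (k := 1) hΩ _ j (cx_contDiffOn (by exact_mod_cast hφ))))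

lemma basic_identity {n : ℕ} {Ω : Set (CSp n)} (hΩ : IsOpen Ω) {φ : CSp n → ℝ}
    (hφ : ContDiffOn ℝ 2 φ Ω) {a b : CSp n → ℂ} (ha : Tst 2 Ω a) (hb : Tst 2 Ω b) (j k : Fin n) :
    ∫ x, (del φ j a x * star (del φ k b x) * wt φ x - dzb k a x * star (dzb j b x) * wt φ x
      - a x * star (b x) * star (dzb j (dz k (cx φ)) x) * wt φ x) = 0 := by
  have hφ' : ContDiffOn ℝ (2:ℕ) φ Ω := by exact_mod_cast hφ
  have hφ1 : ContDiffOn ℝ (1:ℕ) φ Ω := hφ'.of_le (by norm_num)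
  have hφd : ∀ x ∈ Ω, DifferentiableAt ℝ φ x := fun x hx =>
    (hφ'.contDiffAt (hΩ.mem_nhds hx)).differentiableAt (by norm_num)
  have hcd : ∀ x ∈ Ω, DifferentiableAt ℝ (cx φ) x := fun x hx =>
    Complex.ofRealCLM.differentiableAt.comp x (hφd x hx)
  have hw1 : ContDiffOn ℝ (1:ℕ) (wt φ) Ω := wt_contDiffOn hφ1
  have hwd : ∀ x ∈ Ω, DifferentiableAt ℝ (wt φ) x := fun x hx =>
    (hw1.contDiffAt (hΩ.mem_nhds hx)).differentiableAt (by norm_num)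
  have hda : Differentiable ℝ a := ha.1.differentiable (by norm_num)
  have hdb : Differentiable ℝ b := hb.1.differentiable (by norm_num)
  have tdel := Tst.del hΩ hφ hb k
  -- first integration by parts
  have e1 := ibp hΩ (f := fun x => star (del φ k b x)) (g := fun x => a x * wt φ x) tdel.starf
    (((ha.1.of_le (by norm_num)).contDiffOn).mul (by exact_mod_cast hw1)) (-Complex.I) j
  have e2 := ibp hΩ (f := a) (g := fun x => star (dzb j b x) * wt φ x) (ha.mono (by norm_num))
    ((((Tst.dw (k := 1) hb Complex.I j).starf.1.contDiffOn).mul hw1).of_le (by norm_num)) (Complex.I) k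
  have t1 : Tst 0 Ω (fun x => star (del φ k b x) * dw (-Complex.I) j (fun x => a x * wt φ x) x) :=
    (tdel.starf.mono (by norm_num)).contDiff_mul hΩ
      (Tst.dw (k := 0) (((ha.mono (by norm_num)).contDiff_mul hΩ hw1)) _ j).1.contDiffOn
  have t2 : Tst 0 Ω (fun x => dw (-Complex.I) j (fun x => star (del φ k b x)) x * (a x * wt φ x)) :=
    (Tst.dw (k := 0) tdel.starf _ j).contDiff_mul hΩ
      (((ha.mono (l := 0) (by norm_num)).1.contDiffOn).mul (hw1.of_le (by norm_num)))
  have t3 : Tst 0 Ω (fun x => a x * dw (Complex.I) k (fun x => star (dzb j b x) * wt φ x) x) :=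
    (ha.mono (by norm_num)).contDiff_mul hΩ
      (Tst.dw (k := 0) ((Tst.dw (k := 1) hb Complex.I j).starf.contDiff_mul hΩ hw1) _ k).1.contDiffOn
  have t4 : Tst 0 Ω (fun x => dw (Complex.I) k a x * (star (dzb j b x) * wt φ x)) :=
    (Tst.dw (k := 0) (ha.mono (by norm_num)) _ k).contDiff_mul hΩ
      (((Tst.dw (k := 1) hb Complex.I j).starf.mono (l := 0) (by norm_num)).1.contDiffOn.mul
        (hw1.of_le (by norm_num)))
  have key : ∀ x, (del φ j a x * star (del φ k b x) * wt φ x - dzb k a x * star (dzb j b x) * wt φ x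
      - a x * star (b x) * star (dzb j (dz k (cx φ)) x) * wt φ x)
      = (star (del φ k b x) * dw (-Complex.I) j (fun x => a x * wt φ x) x
        + dw (-Complex.I) j (fun x => star (del φ k b x)) x * (a x * wt φ x))
       - (a x * dw (Complex.I) k (fun x => star (dzb j b x) * wt φ x) x
        + dw (Complex.I) k a x * (star (dzb j b x) * wt φ x)) := by
    intro x
    by_cases hxa : x ∈ tsupport a
    · have hx : x ∈ Ω := ha.2.2 hxa
      have hbd : ∀ s j, DifferentiableAt ℝ (dw s j b) x := fun s j =>
        (Tst.dw (k := 1) hb s j).1.differentiable (by norm_num) x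
      have hpd : DifferentiableAt ℝ (dw (-Complex.I) k (cx φ)) x :=
        ((dw_contDiffOn (k := 1) hΩ _ k (cx_contDiffOn hφ')).contDiffAt
          (hΩ.mem_nhds hx)).differentiableAt (by norm_num)
      rw [dw_mul _ _ (hda x) (hwd x hx), dw_wt (hφd x hx)]
      rw [dw_star _ _ (tdel.1.differentiable (by norm_num) x)]
      have hs1 : DifferentiableAt ℝ (fun x => star (dzb j b x)) x :=
        (Tst.dw (k := 1) hb Complex.I j).starf.1.differentiable (by norm_num) x
      rw [dw_mul _ _ hs1 (hwd x hx), dw_wt (hφd x hx)]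
      rw [show (fun x => star (dzb j b x)) = fun x => star (dw Complex.I j b x) from rfl,
        dw_star _ _ (hbd _ _)]
      have e3 : dw (star (-Complex.I)) j (del φ k b) x =
          dw Complex.I j (dw (-Complex.I) k b) x - (dzb j b x * dz k (cx φ) x
            + b x * dzb j (dz k (cx φ)) x) := by
        unfold del
        rw [dw_sub _ _ (by exact hbd _ _) (by exact (hdb x).mul hpd), dw_mul _ _ (hdb x) (by exact hpd)]
        simp [dzb]; rfl
      rw [e3, dw_comm Complex.I (-Complex.I) j k (hb.1.contDiffAt)]
      have e4 : dw Complex.I k (cx φ) x = star (dz k (cx φ) x) := (star_dz_real (hφd x hx) k).symm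
      have e5 : dw (star Complex.I) k (dw Complex.I j b) x = dw (-Complex.I) k (dw Complex.I j b) x := by
        simp
      rw [e4, e5]
      simp only [del, dz, dzb, star_sub, star_mul', star_add]
      ring
    · have z1 : a x = 0 := image_eq_zero_of_notMem_tsupport hxa
      have z2 : ∀ s j, dw s j a x = 0 := fun s j => dw_eq_zero s j hxa
      have z3 : dw (-Complex.I) j (fun x => a x * wt φ x) x = 0 :=
        dw_eq_zero _ _ (fun h => hxa (tsupport_mul_subset_left h))
      simp [del, dz, dzb, z1, z2, z3]
  simp_rw [key]
  rw [integral_sub, integral_add t1.integrable t2.integrable, integral_add t3.integrable t4.integrable,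
    e1, e2]
  · ring
  · exact t1.integrable.add t2.integrable
  · exact t3.integrable.add t4.integrable

open MeasureTheory

/-- smooth radial bump -/
def bmp {n : ℕ} (σ : ℝ) (y : CSp n) : ℝ := Real.smoothTransition (1 - ‖y‖^2/σ^2)

lemma bmp_contDiff {n : ℕ} (σ : ℝ) (k : ℕ) : ContDiff ℝ k (bmp (n := n) σ) := by
  unfold bmp
  have h : ContDiff ℝ (k:ℕ∞) Real.smoothTransition := Real.smoothTransition.contDiff
  refine ContDiff.comp (g := Real.smoothTransition) (by exact_mod_cast h) ?_
  have : ContDiff ℝ k (fun y : CSp n => ‖y‖^2) := contDiff_norm_sq ℝ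
  exact contDiff_const.sub (this.div_const _)

lemma bmp_eq_zero {n : ℕ} {σ : ℝ} (hσ : 0 < σ) {y : CSp n} (hy : σ ≤ ‖y‖) : bmp σ y = 0 := by
  apply Real.smoothTransition.zero_of_nonpos
  rw [sub_nonpos, one_le_div (by positivity)]
  gcongr

lemma bmp_nonneg {n : ℕ} (σ : ℝ) (y : CSp n) : 0 ≤ bmp σ y := Real.smoothTransition.nonneg _

lemma bmp_hcs {n : ℕ} {σ : ℝ} (hσ : 0 < σ) : HasCompactSupport (bmp (n := n) σ) := by
  apply HasCompactSupport.of_support_subset_isCompact (isCompact_closedBall (0 : CSp n) σ)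
  intro y hy
  by_contra h
  exact hy (bmp_eq_zero hσ (by simpa using (not_le.1 (by simpa using h)).le))

lemma bmp_int_pos {n : ℕ} {σ : ℝ} (hσ : 0 < σ) : 0 < ∫ y : CSp n, bmp σ y := by
  refine Continuous.integral_pos_of_hasCompactSupport_nonneg_nonzero (x := 0)
    (bmp_contDiff σ 0).continuous (bmp_hcs hσ) (bmp_nonneg σ) ?_
  simp [bmp]

def kap {n : ℕ} (σ : ℝ) (y : CSp n) : ℝ := bmp σ y / ∫ y : CSp n, bmp σ y

lemma kap_contDiff {n : ℕ} (σ : ℝ) (k : ℕ) : ContDiff ℝ k (kap (n := n) σ) :=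
  (bmp_contDiff σ k).div_const _

lemma kap_eq_zero {n : ℕ} {σ : ℝ} (hσ : 0 < σ) {y : CSp n} (hy : σ ≤ ‖y‖) : kap σ y = 0 := by
  simp [kap, bmp_eq_zero hσ hy]

lemma kap_nonneg {n : ℕ} {σ : ℝ} (hσ : 0 < σ) (y : CSp n) : 0 ≤ kap σ y :=
  div_nonneg (bmp_nonneg _ _) (bmp_int_pos hσ).le

lemma kap_hcs {n : ℕ} {σ : ℝ} (hσ : 0 < σ) : HasCompactSupport (kap (n := n) σ) := by
  unfold kap
  simp_rw [div_eq_mul_inv]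
  exact (bmp_hcs hσ).mul_right

lemma kap_continuous {n : ℕ} (σ : ℝ) : Continuous (kap (n := n) σ) := (kap_contDiff σ 0).continuous

lemma kap_integrable {n : ℕ} {σ : ℝ} (hσ : 0 < σ) : Integrable (kap (n := n) σ) :=
  (kap_continuous σ).integrable_of_hasCompactSupport (kap_hcs hσ)

lemma kap_integral {n : ℕ} {σ : ℝ} (hσ : 0 < σ) : ∫ y : CSp n, kap σ y = 1 := by
  unfold kap
  rw [integral_div, div_self (bmp_int_pos hσ).ne']

lemma kap_norm {n : ℕ} (σ : ℝ) {y z : CSp n} (h : ‖y‖ = ‖z‖) : kap σ y = kap σ z := by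
  simp [kap, bmp, h]

/-- complex kernel -/
def kapc {n : ℕ} (σ : ℝ) (y : CSp n) : ℂ := (kap σ y : ℂ)

lemma kapc_contDiff {n : ℕ} (σ : ℝ) (k : ℕ) : ContDiff ℝ k (kapc (n := n) σ) :=
  Complex.ofRealCLM.contDiff.comp (kap_contDiff σ k)

lemma kapc_hcs {n : ℕ} {σ : ℝ} (hσ : 0 < σ) : HasCompactSupport (kapc (n := n) σ) :=
  (kap_hcs hσ).comp_left (g := fun x : ℝ => (x:ℂ)) (by simp)

lemma kapc_continuous {n : ℕ} (σ : ℝ) : Continuous (kapc (n := n) σ) := (kapc_contDiff σ 0).continuous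

/-- mollification -/
def mol {n : ℕ} (σ : ℝ) (f : CSp n → ℂ) (x : CSp n) : ℂ := ∫ y, f y * kapc σ (x - y)

lemma mol_conv {n : ℕ} (σ : ℝ) (f : CSp n → ℂ) :
    mol σ f = MeasureTheory.convolution f (kapc σ) (ContinuousLinearMap.mul ℝ ℂ) volume := by
  ext x; rfl

lemma mol_swap {n : ℕ} (σ : ℝ) (f : CSp n → ℂ) (x : CSp n) :
    mol σ f x = ∫ y, f (x - y) * kapc σ y := by
  rw [mol_conv, convolution_eq_swap]; rfl

lemma mol_contDiff {n : ℕ} {σ : ℝ} (hσ : 0 < σ) {f : CSp n → ℂ} (hf : LocallyIntegrable f) (k : ℕ) :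
    ContDiff ℝ k (mol σ f) := by
  rw [mol_conv]
  have := HasCompactSupport.contDiff_convolution_right (n := (k:ℕ∞)) (μ := volume) (ContinuousLinearMap.mul ℝ ℂ)
    (kapc_hcs (n := n) hσ) hf (by exact_mod_cast kapc_contDiff σ k)
  exact_mod_cast this

lemma mol_fderiv {n : ℕ} {σ : ℝ} (hσ : 0 < σ) {f : CSp n → ℂ} (hf : LocallyIntegrable f)
    (x v : CSp n) : fderiv ℝ (mol σ f) x v = ∫ y, f y * fderiv ℝ (kapc σ) (x - y) v := by
  have h1 := HasCompactSupport.hasFDerivAt_convolution_right (μ := volume) (ContinuousLinearMap.mul ℝ ℂ)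
    (kapc_hcs (n := n) hσ) hf (by exact_mod_cast kapc_contDiff σ 1) x
  rw [← mol_conv] at h1
  rw [h1.fderiv, convolution_precompR_apply _ hf ((kapc_hcs hσ).fderiv (𝕜 := ℝ))]
  · rfl
  · exact (kapc_contDiff σ 1).continuous_fderiv (by norm_num)

lemma dw_kapc_sub {n : ℕ} (σ : ℝ) (s : ℂ) (j : Fin n) (x y : CSp n) :
    dw s j (fun y => kapc σ (x - y)) y = - dw s j (kapc σ) (x - y) := by
  have h : HasFDerivAt (fun y => kapc σ (x - y)) (-(fderiv ℝ (kapc σ) (x - y))) y := by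
    have h1 : HasFDerivAt (kapc σ) (fderiv ℝ (kapc σ) (x - y)) (x - y) :=
      ((kapc_contDiff σ 1).differentiable (by norm_num) _).hasFDerivAt
    have h2 : HasFDerivAt (fun y : CSp n => x - y) (-(ContinuousLinearMap.id ℝ (CSp n))) y :=
      (hasFDerivAt_id y).const_sub x
    have h3 := h1.comp y h2
    have h4 : (fderiv ℝ (kapc σ) (x - y)).comp (-(ContinuousLinearMap.id ℝ (CSp n)))
      = -(fderiv ℝ (kapc σ) (x - y)) := by ext v; simp
    rw [h4] at h3
    exact h3
  unfold dw
  rw [h.fderiv]; simp; ring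

lemma mol_dw {n : ℕ} {σ : ℝ} (hσ : 0 < σ) {f : CSp n → ℂ} (hf : LocallyIntegrable f)
    (s : ℂ) (j : Fin n) (x : CSp n) :
    dw s j (mol σ f) x = - ∫ y, f y * dw s j (fun y => kapc σ (x - y)) y := by
  have hi : ∀ v, Integrable (fun y => f y * fderiv ℝ (kapc σ) (x - y) v) := by
    intro v
    have hc : Continuous (fun y => fderiv ℝ (kapc σ) (x - y) v) := by
      have := (kapc_contDiff (n := n) σ 1).continuous_fderiv (by norm_num)
      fun_prop
    have hs : HasCompactSupport (fun y => fderiv ℝ (kapc σ) (x - y) v) :=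
      ((kapc_hcs hσ).fderiv_apply (𝕜 := ℝ) v).comp_homeomorph (Homeomorph.subLeft x)
    simpa [mul_comm] using hf.integrable_smul_left_of_hasCompactSupport hc hs
  simp_rw [dw_kapc_sub]
  rw [show dw s j (mol σ f) x = (fderiv ℝ (mol σ f) x (ee j)
    + s * fderiv ℝ (mol σ f) x (Complex.I • ee j)) / 2 from rfl]
  rw [mol_fderiv hσ hf, mol_fderiv hσ hf, ← integral_const_mul, ← integral_add (hi _) ((hi _).const_mul s),
    ← integral_div, ← integral_neg]
  congr 1; ext y
  simp [dw]; ring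

lemma kapc_sub_tst {n : ℕ} {σ : ℝ} (hσ : 0 < σ) (k : ℕ) {Ω : Set (CSp n)} {x : CSp n}
    (h : closedBall x σ ⊆ Ω) : Tst k Ω (fun y => kapc σ (x - y)) := by
  refine ⟨?_, (kapc_hcs hσ).comp_homeomorph (Homeomorph.subLeft x), ?_⟩
  · have := kapc_contDiff (n := n) σ k
    fun_prop
  · refine (closure_minimal ?_ isClosed_closedBall).trans h
    intro y hy
    by_contra h
    apply hy
    have : σ ≤ ‖x - y‖ := by
      rw [mem_closedBall, dist_comm, dist_eq_norm] at h; linarith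
    simp [kapc, kap_eq_zero hσ this]

lemma mol_eq_zero {n : ℕ} {σ : ℝ} (hσ : 0 < σ) {f : CSp n → ℂ} {x : CSp n}
    (h : ∀ y, ‖x - y‖ < σ → f y = 0) : mol σ f x = 0 := by
  unfold mol
  rw [show (fun y => f y * kapc σ (x - y)) = fun _ => 0 from ?_]; simp
  ext y
  by_cases hy : ‖x - y‖ < σ
  · simp [h y hy]
  · simp [kapc, kap_eq_zero hσ (not_lt.1 hy)]

lemma mol_support {n : ℕ} {σ : ℝ} (hσ : 0 < σ) {f : CSp n → ℂ} {S : Set (CSp n)}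
    (h : ∀ y ∉ S, f y = 0) : tsupport (mol σ f) ⊆ cthickening σ S := by
  refine closure_minimal ?_ isClosed_cthickening
  intro x hx
  by_contra hc
  apply hx
  apply mol_eq_zero hσ
  intro y hy
  apply h
  intro hyS
  apply hc
  apply mem_cthickening_of_dist_le x y σ S hyS
  rw [dist_eq_norm]; exact hy.le

open MeasureTheory

/-- the probability measure `kap σ dy` -/
def kmeas (n : ℕ) (σ : ℝ) : Measure (CSp n) := volume.withDensity (fun y => ENNReal.ofReal (kap σ y))

lemma kmeas_prob (n : ℕ) {σ : ℝ} (hσ : 0 < σ) : IsProbabilityMeasure (kmeas n σ) := by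
  constructor
  rw [kmeas, withDensity_apply _ MeasurableSet.univ, setLIntegral_univ,
    ← ofReal_integral_eq_lintegral_ofReal (kap_integrable hσ) (Eventually.of_forall (kap_nonneg hσ)),
    kap_integral hσ]
  simp

lemma lint_kmeas (n : ℕ) {σ : ℝ} {g : CSp n → ℝ≥0∞} (hg : Measurable g) :
    ∫⁻ y, g y ∂(kmeas n σ) = ∫⁻ y, g y * ENNReal.ofReal (kap σ y) := by
  rw [kmeas, lintegral_withDensity_eq_lintegral_mul _ (by
    have := kap_continuous (n := n) σ
    fun_prop) hg]
  congr 1; ext y; simp [mul_comm]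

lemma young_meas {n : ℕ} {σ : ℝ} (hσ : 0 < σ) {f : CSp n → ℂ} (hf : Measurable f) :
    ∫⁻ x, ‖mol σ f x‖ₑ^2 ≤ ∫⁻ x, ‖f x‖ₑ^2 := by
  have := kmeas_prob n hσ
  have key : ∀ x, ‖mol σ f x‖ₑ^2 ≤ ∫⁻ y, ‖f (x - y)‖ₑ^2 ∂(kmeas n σ) := by
    intro x
    have h1 : ‖mol σ f x‖ₑ ≤ ∫⁻ y, ‖f (x - y)‖ₑ ∂(kmeas n σ) := by
      rw [lint_kmeas n (by fun_prop), mol_swap]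
      refine (enorm_integral_le_lintegral_enorm _).trans (le_of_eq ?_)
      congr 1; ext y
      rw [enorm_mul, kapc]
      congr 1
      rw [← ofReal_norm, Complex.norm_real, Real.norm_of_nonneg (kap_nonneg hσ y)]
    have h2 := eLpNorm_le_eLpNorm_of_exponent_le (μ := kmeas n σ) (p := 1) (q := 2) (f := fun y => f (x - y))
      (by norm_num) (by
        have : Measurable (fun y => f (x - y)) := by fun_prop
        exact this.aestronglyMeasurable)
    rw [eLpNorm_one_eq_lintegral_enorm, eLpNorm_eq_lintegral_rpow_enorm_toReal (by norm_num) (by norm_num)] at h2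
    have h3 := h1.trans h2
    calc ‖mol σ f x‖ₑ^2 ≤ ((∫⁻ y, ‖f (x - y)‖ₑ ^ (2:ℝ≥0∞).toReal ∂(kmeas n σ)) ^ (1 / (2:ℝ≥0∞).toReal))^2 := by
          gcongr
      _ = _ := by
          rw [← ENNReal.rpow_natCast, ← ENNReal.rpow_mul]
          simp
  calc ∫⁻ x, ‖mol σ f x‖ₑ^2 ≤ ∫⁻ x, ∫⁻ y, ‖f (x - y)‖ₑ^2 ∂(kmeas n σ) := lintegral_mono key
    _ = ∫⁻ y, (∫⁻ x, ‖f (x - y)‖ₑ^2) ∂(kmeas n σ) := by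
        rw [lintegral_lintegral_swap]
        have : Measurable (fun p : CSp n × CSp n => ‖f (p.1 - p.2)‖ₑ^2) := by fun_prop
        exact this.aemeasurable
    _ = ∫⁻ y, (∫⁻ x, ‖f x‖ₑ^2) ∂(kmeas n σ) := by
        congr 1; ext y
        exact lintegral_sub_right_eq_self (fun x => ‖f x‖ₑ^2) y
    _ = _ := by simp

lemma mol_congr {n : ℕ} {σ : ℝ} {f g : CSp n → ℂ} (h : f =ᵐ[volume] g) (x : CSp n) :
    mol σ f x = mol σ g x := by
  unfold mol
  apply integral_congr_ae
  filter_upwards [h] with y hy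
  rw [hy]

lemma eLpNorm_two_sq {n : ℕ} (f : CSp n → ℂ) (μ : Measure (CSp n)) :
    eLpNorm f 2 μ = (∫⁻ x, ‖f x‖ₑ^2 ∂μ)^(1/2:ℝ) := by
  rw [eLpNorm_eq_lintegral_rpow_enorm_toReal (by norm_num) (by norm_num)]
  simp

lemma young {n : ℕ} {σ : ℝ} (hσ : 0 < σ) {f : CSp n → ℂ} (hf : AEStronglyMeasurable f volume) :
    eLpNorm (mol σ f) 2 volume ≤ eLpNorm f 2 volume := by
  obtain ⟨g, hg, hfg⟩ := hf
  rw [eLpNorm_congr_ae hfg, show mol σ f = mol σ g from funext (mol_congr hfg),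
    eLpNorm_two_sq, eLpNorm_two_sq]
  have := young_meas hσ hg.measurable
  gcongr

lemma mol_integrand {n : ℕ} {σ : ℝ} (hσ : 0 < σ) {f : CSp n → ℂ} (hf : LocallyIntegrable f) (x : CSp n) :
    Integrable (fun y => f y * kapc σ (x - y)) := by
  have hc : Continuous (fun y => kapc σ (x - y)) := by
    have := kapc_continuous (n := n) σ
    fun_prop
  have hs : HasCompactSupport (fun y => kapc σ (x - y)) :=
    (kapc_hcs hσ).comp_homeomorph (Homeomorph.subLeft x)
  simpa [mul_comm] using hf.integrable_smul_left_of_hasCompactSupport hc hs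

lemma mol_sub {n : ℕ} {σ : ℝ} (hσ : 0 < σ) {f g : CSp n → ℂ} (hf : LocallyIntegrable f)
    (hg : LocallyIntegrable g) : mol σ (f - g) = mol σ f - mol σ g := by
  ext x
  simp only [mol, Pi.sub_apply]
  rw [← integral_sub (mol_integrand hσ hf x) (mol_integrand hσ hg x)]
  congr 1; ext y; ring

lemma kapc_integral {n : ℕ} {σ : ℝ} (hσ : 0 < σ) (x : CSp n) : ∫ y, kapc σ (x - y) = 1 := by
  rw [integral_sub_left_eq_self (fun y => kapc σ y)]
  have := integral_ofReal (𝕜 := ℂ) (f := kap (n := n) σ) (μ := volume)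
  rw [kap_integral hσ] at this
  simpa [kapc] using this

lemma mol_dist_le {n : ℕ} {σ : ℝ} (hσ : 0 < σ) {f : CSp n → ℂ} (hf : LocallyIntegrable f) {x : CSp n} {δ : ℝ}
    (h : ∀ y, ‖x - y‖ < σ → ‖f y - f x‖ ≤ δ) : ‖mol σ f x - f x‖ ≤ δ := by
  have e : mol σ f x - f x = ∫ y, (f y - f x) * kapc σ (x - y) := by
    have : f x = ∫ y, f x * kapc σ (x - y) := by
      rw [integral_const_mul, kapc_integral hσ, mul_one]
    conv_lhs => rw [this]
    rw [mol, ← integral_sub (mol_integrand hσ hf x)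
      (mol_integrand hσ (f := fun _ => f x) (continuous_const.locallyIntegrable) x)]
    congr 1; ext y; ring
  rw [e]
  have hk : Integrable (fun y => kap σ (x - y)) := (kap_integrable hσ).comp_sub_left x
  calc ‖∫ y, (f y - f x) * kapc σ (x - y)‖ ≤ ∫ y, δ * kap σ (x - y) := by
        apply norm_integral_le_of_norm_le (hk.const_mul δ)
        refine Eventually.of_forall fun y => ?_
        rw [norm_mul, kapc, Complex.norm_real, Real.norm_of_nonneg (kap_nonneg hσ _)]
        by_cases hy : ‖x - y‖ < σ
        · exact mul_le_mul_of_nonneg_right (h y hy) (kap_nonneg hσ _)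
        · simp [kap_eq_zero hσ (not_lt.1 hy)]
    _ = δ := by
        rw [integral_const_mul, integral_sub_left_eq_self (fun y => kap σ y), kap_integral hσ, mul_one]

lemma memLp_locInt {n : ℕ} {f : CSp n → ℂ} (hf : MemLp f 2 volume) : LocallyIntegrable f :=
  hf.locallyIntegrable (by norm_num)

/-- mollifications converge in `L²` -/
lemma mol_tendsto {n : ℕ} {f : CSp n → ℂ} (hf : MemLp f 2 volume) :
    Tendsto (fun σ => eLpNorm (mol σ f - f) 2 volume) (𝓝[>] 0) (𝓝 0) := by
  rw [ENNReal.tendsto_nhds_zero]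
  intro ε hε
  wlog hεt : ε < ⊤ with H
  · exact Eventually.of_forall fun σ => by
      have : ε = ⊤ := not_lt_top_iff.1 hεt
      rw [this]; exact le_top
  have hε3 : ε / 3 ≠ 0 := by simp [hε.ne']
  obtain ⟨g, hgs, hfg, hgc, hgm⟩ := hf.exists_hasCompactSupport_eLpNorm_sub_le (by norm_num) hε3
  have hlf := memLp_locInt hf
  have hlg := memLp_locInt hgm
  -- compact set
  obtain ⟨R, hR⟩ := hgs.isCompact.isBounded.subset_closedBall (0 : CSp n)
  set B : Set (CSp n) := closedBall 0 (R+1)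
  have hB : volume B < ⊤ := (isCompact_closedBall _ _).measure_lt_top
  obtain ⟨δ, hδ, hδB⟩ : ∃ δ : ℝ, 0 < δ ∧ (volume B)^(1/2:ℝ) * ENNReal.ofReal δ ≤ ε/3 := by
    have ht : Tendsto (fun δ : ℝ => (volume B)^(1/2:ℝ) * ENNReal.ofReal δ) (𝓝[>] 0) (𝓝 ((volume B)^(1/2:ℝ) * ENNReal.ofReal 0)) := by
      apply ENNReal.Tendsto.const_mul
      · exact (ENNReal.continuous_ofReal.tendsto 0).mono_left nhdsWithin_le_nhds
      · right; exact (ENNReal.rpow_lt_top_of_nonneg (by norm_num) hB.ne).ne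
    simp only [ENNReal.ofReal_zero, mul_zero] at ht
    have h1 := (ENNReal.tendsto_nhds_zero.1 ht) (ε/3) (pos_iff_ne_zero.2 hε3)
    obtain ⟨δ, h2, h3⟩ := (h1.and self_mem_nhdsWithin).exists
    exact ⟨δ, h3, h2⟩
  have huc := hgs.uniformContinuous_of_continuous hgc
  rw [Metric.uniformContinuous_iff] at huc
  obtain ⟨r, hr, huc⟩ := huc δ hδ
  have hmem : Ioo (0:ℝ) (min r 1) ∈ 𝓝[>] (0:ℝ) := Ioo_mem_nhdsGT (by positivity)
  filter_upwards [hmem] with σ hσ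
  have hσ0 : 0 < σ := hσ.1
  have hgg : eLpNorm (mol σ g - g) 2 volume ≤ ε/3 := by
    have hpt : ∀ x, ‖(mol σ g - g) x‖ ≤ δ := by
      intro x
      apply mol_dist_le hσ0 hlg
      intro y hy
      rw [← dist_eq_norm]
      apply (huc _).le
      rw [dist_comm, dist_eq_norm]
      exact hy.trans (hσ.2.trans_le (min_le_left _ _))
    have hz : ∀ x ∉ B, (mol σ g - g) x = 0 := by
      intro x hx
      have hx' : R + 1 < ‖x‖ := by simpa [B] using hx
      have g0 : ∀ y, R < ‖y‖ → g y = 0 := by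
        intro y hy
        apply image_eq_zero_of_notMem_tsupport
        intro h
        have := hR h
        simp at this; linarith
      rw [Pi.sub_apply, mol_eq_zero hσ0, g0 x (by linarith), sub_zero]
      intro y hy
      apply g0
      have h1 : ‖x‖ ≤ ‖x - y‖ + ‖y‖ := by simpa using norm_add_le (x - y) y
      have h2 : σ < 1 := hσ.2.trans_le (min_le_right _ _)
      linarith
    have e : mol σ g - g = B.indicator (mol σ g - g) := by
      ext x
      by_cases hx : x ∈ B
      · simp [hx]
      · simp [hx]; simpa using hz x hx
    rw [e, eLpNorm_indicator_eq_eLpNorm_restrict (isClosed_closedBall.measurableSet)]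
    refine (eLpNorm_le_of_ae_bound (C := δ) (Eventually.of_forall hpt)).trans ?_
    simpa using hδB
  have hs : mol σ f - f = (mol σ (f - g)) + ((mol σ g - g) + (g - f)) := by
    rw [mol_sub hσ0 hlf hlg]; abel
  have mm : ∀ {u : CSp n → ℂ}, LocallyIntegrable u → AEStronglyMeasurable (mol σ u) volume := fun hu =>
    (mol_contDiff hσ0 hu 0).continuous.aestronglyMeasurable
  rw [hs]
  have a1 : AEStronglyMeasurable (mol σ (f - g)) volume := mm (hlf.sub hlg)
  have a2 : AEStronglyMeasurable (mol σ g - g) volume := (mm hlg).sub hgc.aestronglyMeasurable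
  have a3 : AEStronglyMeasurable (g - f) volume := hgc.aestronglyMeasurable.sub hf.1
  calc _ ≤ eLpNorm (mol σ (f - g)) 2 volume + (eLpNorm (mol σ g - g) 2 volume + eLpNorm (g - f) 2 volume) :=
        (eLpNorm_add_le a1 (a2.add a3) (by norm_num)).trans (by gcongr; exact eLpNorm_add_le a2 a3 (by norm_num))
    _ ≤ ε/3 + (ε/3 + ε/3) := by
        gcongr
        · exact (young hσ0 (hf.1.sub hgm.1)).trans hfg
        · rw [eLpNorm_sub_comm]; exact hfg
    _ = ε := by
        rw [← add_assoc, ENNReal.add_thirds]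

lemma mol_memLp {n : ℕ} {σ : ℝ} (hσ : 0 < σ) {f : CSp n → ℂ} (hf : MemLp f 2 volume) :
    MemLp (mol σ f) 2 volume :=
  ⟨(mol_contDiff hσ (memLp_locInt hf) 0).continuous.aestronglyMeasurable, (young hσ hf.1).trans_lt hf.2⟩

/-- squares of `L²`-norms converge -/
lemma L2lim {n : ℕ} {μ : Measure (CSp n)} {f : ℕ → CSp n → ℂ} {g : CSp n → ℂ} (hf : ∀ i, MemLp (f i) 2 μ)
    (hg : MemLp g 2 μ) (h : Tendsto (fun i => eLpNorm (f i - g) 2 μ) atTop (𝓝 0)) :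
    Tendsto (fun i => ∫ x, ‖f i x‖^2 ∂μ) atTop (𝓝 (∫ x, ‖g x‖^2 ∂μ)) := by
  have h1 : Tendsto (fun i => (hf i).toLp) atTop (𝓝 hg.toLp) := by
    rw [Lp.tendsto_Lp_iff_tendsto_eLpNorm'']
    exact h
  have h2 := (h1.norm).pow 2
  have e : ∀ {u : CSp n → ℂ} (hu : MemLp u 2 μ), ‖hu.toLp‖^2 = ∫ x, ‖u x‖^2 ∂μ := by
    intro u hu
    rw [← real_inner_self_eq_norm_sq]
    rw [MeasureTheory.L2.inner_def]
    apply integral_congr_ae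
    filter_upwards [hu.coeFn_toLp] with x hx
    rw [hx, real_inner_self_eq_norm_sq]
  simpa only [e] using h2

open MeasureTheory

/-- real Hessian -/
abbrev hes {n : ℕ} (φ : CSp n → ℝ) (x : CSp n) : CSp n →L[ℝ] CSp n →L[ℝ] ℝ := fderiv ℝ (fderiv ℝ φ) x

/-- Levi form (up to factor 4) -/
def lev {n : ℕ} (φ : CSp n → ℝ) (x v : CSp n) : ℝ :=
  hes φ x v v + hes φ x (Complex.I • v) (Complex.I • v)

lemma fderiv_cx {n : ℕ} {φ : CSp n → ℝ} {x : CSp n} (h : DifferentiableAt ℝ φ x) (v : CSp n) :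
    fderiv ℝ (cx φ) x v = (fderiv ℝ φ x v : ℂ) := by
  have h2 : HasFDerivAt (cx φ) (Complex.ofRealCLM.comp (fderiv ℝ φ x)) x :=
    Complex.ofRealCLM.hasFDerivAt.comp x h.hasFDerivAt
  rw [h2.fderiv]; simp

lemma dw_cx {n : ℕ} {φ : CSp n → ℝ} {x : CSp n} (h : DifferentiableAt ℝ φ x) (s : ℂ) (j : Fin n) :
    dw s j (cx φ) x = ((fderiv ℝ φ x (ee j) : ℂ) + s * (fderiv ℝ φ x (Complex.I • ee j) : ℂ)) / 2 := by
  rw [dw, fderiv_cx h, fderiv_cx h]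

lemma fderiv_dw_cx {n : ℕ} {φ : CSp n → ℝ} {x : CSp n} (h : ContDiffAt ℝ 2 φ x) (s : ℂ) (k : Fin n)
    (v : CSp n) : fderiv ℝ (dw s k (cx φ)) x v
      = ((hes φ x v (ee k) : ℂ) + s * (hes φ x v (Complex.I • ee k) : ℂ)) / 2 := by
  have hd : DifferentiableAt ℝ (fderiv ℝ φ) x :=
    (h.fderiv_right (m := 1) (by norm_num)).differentiableAt (by norm_num)
  have hev : ∀ᶠ y in 𝓝 x, DifferentiableAt ℝ φ y := by
    filter_upwards [h.eventually (by simp)] with y hy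
    exact hy.differentiableAt (by norm_num)
  have h1 : ∀ w, HasFDerivAt (fun y => (fderiv ℝ φ y w : ℂ))
      (Complex.ofRealCLM.comp ((fderiv ℝ (fderiv ℝ φ) x).flip w)) x := by
    intro w
    have := hd.hasFDerivAt.clm_apply (hasFDerivAt_const w x)
    have h3 : HasFDerivAt (fun y => fderiv ℝ φ y w) ((fderiv ℝ (fderiv ℝ φ) x).flip w) x := by
      simpa using this
    exact Complex.ofRealCLM.hasFDerivAt.comp x h3
  have h2 : HasFDerivAt (dw s k (cx φ)) ((2:ℂ)⁻¹ • ((Complex.ofRealCLM.comp ((fderiv ℝ (fderiv ℝ φ) x).flip (ee k))) +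
      s • (Complex.ofRealCLM.comp ((fderiv ℝ (fderiv ℝ φ) x).flip (Complex.I • ee k))))) x := by
    have := ((h1 (ee k)).add ((h1 (Complex.I • ee k)).const_smul s)).const_smul ((2:ℂ)⁻¹)
    refine this.congr_of_eventuallyEq ?_
    filter_upwards [hev] with y hy
    rw [dw_cx hy]
    simp; ring
  rw [h2.fderiv]
  simp; ring

lemma vec_expand {n : ℕ} (v : CSp n) :
    v = ∑ j, ((v j).re • ee j + (v j).im • (Complex.I • ee j)) := by
  ext i
  simp only [WithLp.ofLp_sum, Finset.sum_apply, WithLp.ofLp_add, Pi.add_apply, WithLp.ofLp_smul, Pi.smul_apply, ee,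
    PiLp.single_apply]
  rw [Finset.sum_eq_single i]
  · simp [Complex.re_add_im]
  · intro b _ hb
    simp [hb.symm]
  · simp

lemma vec_expand_I {n : ℕ} (v : CSp n) :
    Complex.I • v = ∑ j, ((-(v j).im) • ee j + (v j).re • (Complex.I • ee j)) := by
  conv_lhs => rw [vec_expand v, Finset.smul_sum]
  congr 1; ext1 j
  rw [smul_add, smul_comm Complex.I, smul_comm Complex.I, smul_smul Complex.I Complex.I, Complex.I_mul_I]
  simp [add_comm]

lemma lin_sum {n : ℕ} (L : CSp n →L[ℝ] ℝ) (v : CSp n) :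
    ∑ j, v j * (((L (ee j) : ℂ) + (-Complex.I) * (L (Complex.I • ee j) : ℂ)) / 2)
      = ((L v : ℂ) - Complex.I * (L (Complex.I • v) : ℂ)) / 2 := by
  have h1 : L v = ∑ j, ((v j).re * L (ee j) + (v j).im * L (Complex.I • ee j)) := by
    conv_lhs => rw [vec_expand v]
    simp
  have h2 : L (Complex.I • v) = ∑ j, (-(v j).im * L (ee j) + (v j).re * L (Complex.I • ee j)) := by
    conv_lhs => rw [vec_expand_I v]
    simp
  rw [h1, h2]
  push_cast
  rw [Finset.mul_sum, ← Finset.sum_sub_distrib, Finset.sum_div]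
  congr 1; ext1 j
  conv_lhs => rw [← Complex.re_add_im (v j)]
  linear_combination (-((v j).im : ℂ) * L (Complex.I • ee j) / 2) * Complex.I_sq

lemma levi_sum {n : ℕ} {φ : CSp n → ℝ} {x : CSp n} (h : ContDiffAt ℝ 2 φ x) (v : CSp n) :
    (∑ j, ∑ k, v j * star (v k) * star (dzb j (dz k (cx φ)) x)).re = lev φ x v / 4 := by
  set H := hes φ x with hH
  have e1 : ∀ j k, dzb j (dz k (cx φ)) x = ((H (ee j) (ee k) : ℂ) + (H (Complex.I • ee j) (Complex.I • ee k) : ℂ)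
      + Complex.I * ((H (Complex.I • ee j) (ee k) : ℂ) - (H (ee j) (Complex.I • ee k) : ℂ))) / 4 := by
    intro j k
    have : dzb j (dz k (cx φ)) x = (fderiv ℝ (dw (-Complex.I) k (cx φ)) x (ee j)
      + Complex.I * fderiv ℝ (dw (-Complex.I) k (cx φ)) x (Complex.I • ee j)) / 2 := rfl
    rw [this, fderiv_dw_cx h, fderiv_dw_cx h]
    linear_combination (-(H (Complex.I • ee j) (Complex.I • ee k) : ℂ)/4) * Complex.I_sq
  have e2 : H v v = ∑ j, ∑ k, ((v j).re * ((v k).re * H (ee j) (ee k) + (v k).im * H (ee j) (Complex.I • ee k))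
      + (v j).im * ((v k).re * H (Complex.I • ee j) (ee k) + (v k).im * H (Complex.I • ee j) (Complex.I • ee k))) := by
    conv_lhs => rw [vec_expand v]
    simp [Finset.sum_add_distrib, Finset.mul_sum, mul_add]
  have e3 : H (Complex.I • v) (Complex.I • v) = ∑ j, ∑ k, (-(v j).im * (-(v k).im * H (ee j) (ee k) + (v k).re * H (ee j) (Complex.I • ee k))
      + (v j).re * (-(v k).im * H (Complex.I • ee j) (ee k) + (v k).re * H (Complex.I • ee j) (Complex.I • ee k))) := by
    conv_lhs => rw [vec_expand_I v]
    simp [Finset.sum_add_distrib, Finset.mul_sum, mul_add]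
    ring
  rw [lev, ← hH, e2, e3, ← Finset.sum_add_distrib, Complex.re_sum, Finset.sum_div]
  congr 1; ext1 j
  rw [← Finset.sum_add_distrib, Complex.re_sum, Finset.sum_div]
  congr 1; ext1 k
  rw [e1]
  simp
  ring

/-- exhaustion weight -/
structure Wgt {n : ℕ} (Ω : Set (CSp n)) (P : CSp n → ℝ) (C : ℝ) : Prop where
  isOpen : IsOpen Ω
  bdd : Bornology.IsBounded Ω
  one_le : ∀ x ∈ Ω, 1 ≤ P x
  smooth : ContDiffOn ℝ 2 P Ω
  cpt : ∀ c, IsCompact {x | x ∈ Ω ∧ P x ≤ c}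
  grad : ∀ x ∈ Ω, ‖fderiv ℝ P x‖ ≤ C * P x ^ 2
  levi : ∀ x ∈ Ω, ∀ v, ‖v‖^2 ≤ lev P x v
  C_nonneg : 0 ≤ C

def KK (C : ℝ) : ℝ := (32 * C^2 + 2) * 4 / 5

/-- the weight -/
def phi {n : ℕ} (P : CSp n → ℝ) (C : ℝ) (x : CSp n) : ℝ := KK C * P x ^ 5

lemma KK_pos (C : ℝ) : 0 < KK C := by unfold KK; positivity

lemma phi_fderiv {n : ℕ} {P : CSp n → ℝ} (C : ℝ) {x : CSp n} (h : DifferentiableAt ℝ P x) :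
    fderiv ℝ (phi P C) x = (5 * KK C * P x ^ 4) • fderiv ℝ P x := by
  have h2 := ((h.hasFDerivAt.pow 5).const_mul (KK C))
  have : fderiv ℝ (phi P C) x = _ := h2.fderiv
  rw [this]; ext v; simp; ring

lemma lev_phi {n : ℕ} {P : CSp n → ℝ} (C : ℝ) {x : CSp n} (h : ContDiffAt ℝ 2 P x) (hP : 0 ≤ P x) (v : CSp n) :
    5 * KK C * P x ^ 4 * lev P x v ≤ lev (phi P C) x v := by
  have hd : DifferentiableAt ℝ (fderiv ℝ P) x :=
    (h.fderiv_right (m := 1) (by norm_num)).differentiableAt (by norm_num)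
  have hP1 := h.differentiableAt (by norm_num)
  have hev : fderiv ℝ (phi P C) =ᶠ[𝓝 x] fun y => (5 * KK C * P y ^ 4) • fderiv ℝ P y := by
    filter_upwards [h.eventually (by simp)] with y hy
    exact phi_fderiv C (hy.differentiableAt (by norm_num))
  have h1 := ((hP1.hasFDerivAt.pow 4).const_mul (5 * KK C)).smul hd.hasFDerivAt
  have h2 : ∀ w, hes (phi P C) x w w = 5 * KK C * P x ^ 4 * hes P x w w
      + 20 * KK C * P x ^ 3 * (fderiv ℝ P x w)^2 := by
    intro w
    have : hes (phi P C) x = _ := hev.fderiv_eq.trans h1.fderiv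
    rw [this]; simp; ring
  unfold lev
  rw [h2, h2]
  have := KK_pos C
  have : 0 ≤ 20 * KK C * P x ^ 3 * (fderiv ℝ P x v)^2 := by positivity
  have : 0 ≤ 20 * KK C * P x ^ 3 * (fderiv ℝ P x (Complex.I • v))^2 := by positivity
  linarith

lemma int_sq {n : ℕ} {Ω : Set (CSp n)} (hΩ : IsOpen Ω) {f : CSp n → ℂ} (hf : Tst 0 Ω f) {w : CSp n → ℝ}
    (hw : ContinuousOn w Ω) : Integrable (fun x => ‖f x‖^2 * w x) := by
  have h1 : ContDiffOn ℝ ((0:ℕ):WithTop ℕ∞) (cx w) Ω :=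
    contDiffOn_zero.2 (Complex.continuous_ofReal.comp_continuousOn hw)
  have := ((hf.contDiff_mul hΩ (hf.starf.1.contDiffOn)).contDiff_mul hΩ h1).integrable.re
  refine this.congr (Eventually.of_forall fun x => ?_)
  have : f x * star (f x) = ((‖f x‖^2 : ℝ) : ℂ) := by
    rw [Complex.star_def, Complex.mul_conj, Complex.normSq_eq_norm_sq]
  simp only [this, cx]
  rw [← Complex.ofReal_mul]; exact Complex.ofReal_re _

lemma sum_antisym {n : ℕ} (d : Fin n → Fin n → ℂ) :
    -(1/2) * ∑ j, ∑ k, ‖d k j - d j k‖^2 ≤ (∑ j, ∑ k, d k j * star (d j k)).re := by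
  have h1 : ∀ a b : ℂ, ‖a - b‖^2 = ‖a‖^2 + ‖b‖^2 - 2 * (a * star b).re := by
    intro a b
    rw [← Complex.normSq_eq_norm_sq, ← Complex.normSq_eq_norm_sq, ← Complex.normSq_eq_norm_sq, Complex.normSq_sub]
    rfl
  simp_rw [h1, Finset.sum_sub_distrib, Finset.sum_add_distrib, ← Finset.mul_sum, Complex.re_sum]
  have : 0 ≤ ∑ j, ∑ k, ‖d j k‖^2 := by positivity
  have : 0 ≤ ∑ j, ∑ k, ‖d k j‖^2 := by positivity
  linarith

/-- the divergence-type operator `α⁻² ∑ ∂_j(α² f_j)` -/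
def XX {n : ℕ} (P : CSp n → ℝ) (C : ℝ) (f : Fin n → CSp n → ℂ) (x : CSp n) : ℂ :=
  ∑ j, (dz j (f j) x + f j x * ((4 / P x - 5 * KK C * P x ^ 4 : ℝ) * dz j (cx P) x))

lemma Wgt.cda {n : ℕ} {Ω : Set (CSp n)} {P : CSp n → ℝ} {C : ℝ} (h : Wgt Ω P C) {x : CSp n} (hx : x ∈ Ω) :
    ContDiffAt ℝ 2 P x := h.smooth.contDiffAt (h.isOpen.mem_nhds hx)

lemma Wgt.phi_smooth {n : ℕ} {Ω : Set (CSp n)} {P : CSp n → ℝ} {C : ℝ} (h : Wgt Ω P C) :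
    ContDiffOn ℝ 2 (phi P C) Ω := contDiffOn_const.mul (h.smooth.pow 5)

lemma dw_phi {n : ℕ} {P : CSp n → ℝ} (C : ℝ) {x : CSp n} (h : DifferentiableAt ℝ P x) (s : ℂ) (j : Fin n) :
    dw s j (cx (phi P C)) x = ((5 * KK C * P x ^ 4 : ℝ) : ℂ) * dw s j (cx P) x := by
  have h2 : DifferentiableAt ℝ (phi P C) x := (h.pow 5).const_mul _
  rw [dw_cx h2, dw_cx h, phi_fderiv C h]
  simp; ring

lemma XX_tst {n : ℕ} {Ω : Set (CSp n)} {P : CSp n → ℝ} {C : ℝ} (h : Wgt Ω P C)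
    {f : Fin n → CSp n → ℂ} (hf : ∀ j, Tst 2 Ω (f j)) : Tst 1 Ω (XX P C f) := by
  unfold XX
  apply Tst.sumf
  intro j _
  apply (Tst.dw (k := 1) (hf j) _ j).addf
  apply ((hf j).mono (by norm_num)).contDiff_mul h.isOpen
  have hs : ContDiffOn ℝ ((1:ℕ):WithTop ℕ∞) P Ω := h.smooth.of_le (by norm_num)
  refine ContDiffOn.mul ?_ (dw_contDiffOn (k := 1) h.isOpen _ j (cx_contDiffOn h.smooth))
  apply cx_contDiffOn (φ := fun x => 4 / P x - 5 * KK C * P x ^ 4)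
  refine ContDiffOn.sub (ContDiffOn.div contDiffOn_const hs ?_) (contDiffOn_const.mul (hs.pow 4))
  intro x hx
  have := h.one_le x hx
  positivity

lemma norm_dzsum_le {n : ℕ} {P : CSp n → ℝ} {x : CSp n} (h : DifferentiableAt ℝ P x) (v : CSp n) :
    ‖∑ j, v j * dz j (cx P) x‖ ≤ ‖fderiv ℝ P x‖ * ‖v‖ := by
  have := lin_sum (fderiv ℝ P x) v
  unfold dz
  simp_rw [dw_cx h]
  rw [this]
  have h1 := (fderiv ℝ P x).le_opNorm v
  have h2 := (fderiv ℝ P x).le_opNorm (Complex.I • v)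
  rw [norm_smul, Complex.norm_I, one_mul] at h2
  rw [norm_div]
  have h3 : ‖((fderiv ℝ P x v : ℝ) : ℂ) - Complex.I * (fderiv ℝ P x (Complex.I • v) : ℂ)‖ ≤
    ‖fderiv ℝ P x v‖ + ‖fderiv ℝ P x (Complex.I • v)‖ := by
    refine (norm_sub_le _ _).trans ?_
    simp
  have h4 : ‖(2:ℂ)‖ = 2 := by simp
  rw [h4]; linarith

lemma basic_est {n : ℕ} {Ω : Set (CSp n)} {P : CSp n → ℝ} {C : ℝ} (h : Wgt Ω P C)
    {f : Fin n → CSp n → ℂ} (hf : ∀ j, Tst 2 Ω (f j)) :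
    2 * ∑ j, ∫ x, ‖f j x‖^2 * (P x ^ 4 * Real.exp (-phi P C x))
      ≤ 2 * (∫ x, ‖XX P C f x‖^2 * Real.exp (-phi P C x))
        + 1/2 * ∑ j, ∑ k, ∫ x, ‖dzb k (f j) x - dzb j (f k) x‖^2 * Real.exp (-phi P C x) := by
  have hΩ := h.isOpen
  set φ := phi P C with hφ
  have hφs : ContDiffOn ℝ 2 φ Ω := h.phi_smooth
  have hwc : ContinuousOn (fun x => Real.exp (-φ x)) Ω := by
    have := hφs.continuousOn
    fun_prop
  have hPc : ContinuousOn P Ω := h.smooth.continuousOn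
  have hw4 : ContinuousOn (fun x => P x ^ 4 * Real.exp (-φ x)) Ω := by fun_prop
  have i1 : ∀ j, Integrable (fun x => ‖f j x‖^2 * (P x ^ 4 * Real.exp (-φ x))) := fun j =>
    int_sq hΩ ((hf j).mono (by norm_num)) hw4
  have i2 : Integrable (fun x => ‖XX P C f x‖^2 * Real.exp (-φ x)) :=
    int_sq hΩ ((XX_tst h hf).mono (by norm_num)) hwc
  have i3 : ∀ j k, Integrable (fun x => ‖dzb k (f j) x - dzb j (f k) x‖^2 * Real.exp (-φ x)) := fun j k =>
    int_sq hΩ (((Tst.dw (k := 1) (hf j) _ k).subf (Tst.dw (k := 1) (hf k) _ j)).mono (by norm_num)) hwc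
  -- the identity
  set Q : Fin n → Fin n → CSp n → ℂ := fun j k x =>
    (del φ j (f j) x * star (del φ k (f k) x) * wt φ x - dzb k (f j) x * star (dzb j (f k) x) * wt φ x
      - f j x * star (f k x) * star (dzb j (dz k (cx φ)) x) * wt φ x) with hQ
  have hQ0 : ∀ j k, ∫ x, Q j k x = 0 := fun j k => basic_identity hΩ hφs (hf j) (hf k) j k
  have hφ2 : ContDiffOn ℝ (2:ℕ) φ Ω := by exact_mod_cast hφs
  have hQi : ∀ j k, Integrable (Q j k) := by
    intro j k
    have hw0 : ContDiffOn ℝ ((0:ℕ):WithTop ℕ∞) (wt φ) Ω := (wt_contDiffOn hφ2).of_le (by norm_num)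
    have td : ∀ j, Tst 0 Ω (del φ j (f j)) := fun j => (Tst.del hΩ hφs (hf j) j).mono (by norm_num)
    have tb : ∀ i j, Tst 0 Ω (dzb j (f i)) := fun i j => (Tst.dw (k := 1) (hf i) _ j).mono (by norm_num)
    have t0 : ∀ j, Tst 0 Ω (f j) := fun j => (hf j).mono (by norm_num)
    have hdd : ContDiffOn ℝ ((0:ℕ):WithTop ℕ∞) (fun x => star (dzb j (dz k (cx φ)) x)) Ω := by
      have := dw_contDiffOn (k := 0) hΩ Complex.I j (dw_contDiffOn (k := 1) hΩ (-Complex.I) k (cx_contDiffOn hφ2))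
      exact Complex.conjCLE.toContinuousLinearMap.contDiff.comp_contDiffOn this
    exact (((((td j).contDiff_mul hΩ (td k).starf.1.contDiffOn).contDiff_mul hΩ hw0).subf
      (((tb j k).contDiff_mul hΩ (tb k j).starf.1.contDiffOn).contDiff_mul hΩ hw0)).subf
      ((((t0 j).contDiff_mul hΩ (t0 k).starf.1.contDiffOn).contDiff_mul hΩ hdd).contDiff_mul hΩ hw0)).integrable
  have hQs : Integrable (fun x => ∑ j, ∑ k, Q j k x) :=
    integrable_finsetSum _ fun j _ => integrable_finsetSum _ fun k _ => hQi j k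
  have hQint : ∫ x, ∑ j, ∑ k, Q j k x = 0 := by
    rw [integral_finsetSum _ fun j _ => integrable_finsetSum _ fun k _ => hQi j k]
    apply Finset.sum_eq_zero
    intro j _
    rw [integral_finsetSum _ fun k _ => hQi j k]
    exact Finset.sum_eq_zero fun k _ => hQ0 j k
  have hre : ∫ x, (∑ j, ∑ k, Q j k x).re = 0 := by
    have : ∫ x, (∑ j, ∑ k, Q j k x).re = (∫ x, ∑ j, ∑ k, Q j k x).re := integral_re hQs
    rw [this, hQint]; simp
  have key : ∀ x, (∑ j, ∑ k, Q j k x).re ≤ (2 * (‖XX P C f x‖^2 * Real.exp (-φ x))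
      + 1/2 * ∑ j, ∑ k, ‖dzb k (f j) x - dzb j (f k) x‖^2 * Real.exp (-φ x))
      - 2 * ∑ j, ‖f j x‖^2 * (P x ^ 4 * Real.exp (-φ x)) := by
    intro x
    set e := Real.exp (-φ x) with he
    have he0 : 0 < e := Real.exp_pos _
    by_cases hx : x ∈ Ω
    · have hP1 := h.one_le x hx
      have hPd : DifferentiableAt ℝ P x := (h.cda hx).differentiableAt (by norm_num)
      set v : CSp n := WithLp.toLp 2 (fun j => f j x) with hv
      have hvn : ‖v‖^2 = ∑ j, ‖f j x‖^2 := by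
        rw [EuclideanSpace.norm_sq_eq]
      set Δ := ∑ j, del φ j (f j) x with hΔ
      have e1 : (∑ j, ∑ k, Q j k x).re = (‖Δ‖^2 - (∑ j, ∑ k, dzb k (f j) x * star (dzb j (f k) x)).re
          - lev φ x v / 4) * e := by
        have l1 := levi_sum (hφs.contDiffAt (hΩ.mem_nhds hx)) v
        rw [← l1]
        have l2 : ((‖Δ‖^2 : ℝ) : ℂ) = ∑ j, ∑ k, del φ j (f j) x * star (del φ k (f k) x) := by
          have : Δ * star Δ = ((‖Δ‖^2 : ℝ) : ℂ) := by
            rw [Complex.star_def, Complex.mul_conj, Complex.normSq_eq_norm_sq]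
          rw [← this, hΔ, star_sum, Finset.sum_mul_sum]
        have l3 : ∑ j, ∑ k, Q j k x = (((‖Δ‖^2 : ℝ) : ℂ) - (∑ j, ∑ k, dzb k (f j) x * star (dzb j (f k) x))
          - ∑ j, ∑ k, v j * star (v k) * star (dzb j (dz k (cx φ)) x)) * (e : ℂ) := by
          rw [l2, ← Finset.sum_sub_distrib, ← Finset.sum_sub_distrib, Finset.sum_mul]
          congr 1; ext1 j
          rw [← Finset.sum_sub_distrib, ← Finset.sum_sub_distrib, Finset.sum_mul]
          congr 1; ext1 k
          simp only [hQ, wt, hv, he]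
          ring
        rw [l3, Complex.re_mul_ofReal, Complex.sub_re, Complex.sub_re, Complex.ofReal_re]
      have e2 : Δ = XX P C f x - ((4 / P x : ℝ) : ℂ) * ∑ j, v j * dz j (cx P) x := by
        rw [hΔ, XX, Finset.mul_sum, ← Finset.sum_sub_distrib]
        congr 1; ext1 j
        rw [del, show dz j (cx φ) x = _ from dw_phi C hPd _ j]
        simp only [dz, hv]
        push_cast
        ring
      have e3 : ‖((4 / P x : ℝ) : ℂ) * ∑ j, v j * dz j (cx P) x‖ ≤ 4 * C * P x ^ 2 * ‖v‖ := by
        rw [norm_mul, Complex.norm_real, Real.norm_of_nonneg (by positivity)]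
        calc 4 / P x * ‖∑ j, v j * dz j (cx P) x‖ ≤ 4 / P x * (C * P x ^ 2 * ‖v‖) := by
              gcongr
              refine (norm_dzsum_le hPd v).trans ?_
              gcongr
              exact h.grad x hx
          _ ≤ 4 * (C * P x ^ 2 * ‖v‖) := by
              have := h.C_nonneg
              gcongr
              rw [div_le_iff₀ (by positivity)]; linarith
          _ = _ := by ring
      have e4 : ‖Δ‖^2 ≤ 2 * ‖XX P C f x‖^2 + 32 * C^2 * P x ^ 4 * ‖v‖^2 := by
        have a1 : ‖Δ‖ ≤ ‖XX P C f x‖ + 4 * C * P x ^ 2 * ‖v‖ := by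
          rw [e2]; exact (norm_sub_le _ _).trans (by gcongr)
        calc ‖Δ‖^2 ≤ (‖XX P C f x‖ + 4 * C * P x ^ 2 * ‖v‖)^2 := by gcongr
          _ ≤ _ := by nlinarith [sq_nonneg (‖XX P C f x‖ - 4 * C * P x ^ 2 * ‖v‖)]
      have e5 := lev_phi C (h.cda hx) (by linarith) v
      have e6 := h.levi x hx v
      have e7 := sum_antisym (fun k j => dzb k (f j) x)
      have e8 : 5 * KK C * P x ^ 4 * ‖v‖^2 ≤ lev φ x v := by
        refine le_trans ?_ e5
        have := KK_pos C
        gcongr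
      have e9 : 5 * KK C = (32 * C^2 + 2) * 4 := by unfold KK; ring
      rw [e1]
      rw [e9] at e8
      have e10 : (‖Δ‖^2 - (∑ j, ∑ k, dzb k (f j) x * star (dzb j (f k) x)).re - lev φ x v / 4) ≤
        2 * ‖XX P C f x‖^2 + 1/2 * ∑ j, ∑ k, ‖dzb k (f j) x - dzb j (f k) x‖^2 - 2 * (P x ^ 4 * ‖v‖^2) := by
        linarith
      refine (mul_le_mul_of_nonneg_right e10 he0.le).trans (le_of_eq ?_)
      rw [hvn]
      simp only [← Finset.sum_mul, ← mul_assoc]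
      ring
    · have z0 : ∀ j, x ∉ tsupport (f j) := fun j hj => hx ((hf j).2.2 hj)
      have z1 : ∀ j, f j x = 0 := fun j => image_eq_zero_of_notMem_tsupport (z0 j)
      have z2 : ∀ j s k, dw s k (f j) x = 0 := fun j s k => dw_eq_zero s k (z0 j)
      simp [hQ, XX, del, dz, dzb, z1, z2]
  have i2' := i2.const_mul 2
  have i3' : Integrable (fun x => ∑ j, ∑ k, ‖dzb k (f j) x - dzb j (f k) x‖^2 * Real.exp (-φ x)) :=
    integrable_finsetSum _ fun j _ => integrable_finsetSum _ fun k _ => i3 j k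
  have i1' : Integrable (fun x => ∑ j, ‖f j x‖^2 * (P x ^ 4 * Real.exp (-φ x))) :=
    integrable_finsetSum _ fun j _ => i1 j
  have i12 : Integrable (fun x => 2 * (‖XX P C f x‖^2 * Real.exp (-φ x))
      + 1/2 * ∑ j, ∑ k, ‖dzb k (f j) x - dzb j (f k) x‖^2 * Real.exp (-φ x)) := i2'.add (i3'.const_mul (1/2))
  have hm := integral_mono hQs.re (i12.sub (i1'.const_mul 2)) key
  have hre' : ∫ x, RCLike.re (∑ j, ∑ k, Q j k x) = 0 := hre
  rw [hre'] at hm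
  simp only [Pi.sub_apply] at hm
  rw [integral_sub i12 (i1'.const_mul 2), integral_add i2' (i3'.const_mul (1/2)),
    integral_const_mul, integral_const_mul, integral_const_mul, integral_finsetSum _ fun j _ => i1 j,
    integral_finsetSum _ fun j _ => integrable_finsetSum _ fun k _ => i3 j k] at hm
  have : ∀ j, ∫ x, ∑ k, ‖dzb k (f j) x - dzb j (f k) x‖^2 * Real.exp (-φ x)
    = ∑ k, ∫ x, ‖dzb k (f j) x - dzb j (f k) x‖^2 * Real.exp (-φ x) := fun j =>
    integral_finsetSum _ fun k _ => i3 j k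
  simp_rw [this] at hm
  linarith

open MeasureTheory

/-- `L²` convergence of sequences of functions -/
def L2T {n : ℕ} (u : ℕ → CSp n → ℂ) (v : CSp n → ℂ) : Prop :=
  (∀ i, MemLp (u i) 2 volume) ∧ MemLp v 2 volume ∧
    Tendsto (fun i => eLpNorm (u i - v) 2 volume) atTop (𝓝 0)

lemma L2T.add {n : ℕ} {u u' : ℕ → CSp n → ℂ} {v v' : CSp n → ℂ} (h : L2T u v) (h' : L2T u' v') :
    L2T (fun i x => u i x + u' i x) (fun x => v x + v' x) := by
  refine ⟨fun i => (h.1 i).add (h'.1 i), h.2.1.add h'.2.1, ?_⟩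
  have := h.2.2.add h'.2.2
  simp only [add_zero] at this
  refine tendsto_of_tendsto_of_tendsto_of_le_of_le tendsto_const_nhds this (fun i => zero_le) ?_
  intro i
  have e : ((fun x => u i x + u' i x) - (fun x => v x + v' x)) = (u i - v) + (u' i - v') := by
    ext x; simp; ring
  simp only [e]
  exact eLpNorm_add_le ((h.1 i).1.sub h.2.1.1) ((h'.1 i).1.sub h'.2.1.1) (by norm_num)

lemma L2T.zero {n : ℕ} : L2T (n := n) (fun _ _ => 0) (fun _ => 0) := by
  refine ⟨fun i => MemLp.zero, MemLp.zero, ?_⟩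
  have : ((fun _ => 0 : CSp n → ℂ) - (fun _ => 0)) = 0 := by ext x; simp
  simp [this]

lemma L2T.sum {n : ℕ} {ι : Type*} (s : Finset ι) {u : ι → ℕ → CSp n → ℂ} {v : ι → CSp n → ℂ}
    (h : ∀ j ∈ s, L2T (u j) (v j)) : L2T (fun i x => ∑ j ∈ s, u j i x) (fun x => ∑ j ∈ s, v j x) := by
  classical
  induction s using Finset.induction_on with
  | empty => simpa using L2T.zero
  | insert a s ha ih =>
    simp only [Finset.sum_insert ha]
    exact (h a (by simp)).add (ih (fun i hi => h i (by simp [hi])))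

lemma bdd_mul_memLp {n : ℕ} {w u : CSp n → ℂ} (hw : AEStronglyMeasurable w volume) {C : ℝ}
    (hC : ∀ x, ‖w x‖ ≤ C) (hu : MemLp u 2 volume) : MemLp (fun x => w x * u x) 2 volume := by
  refine MemLp.of_le_mul (c := C) hu (hw.mul hu.1) (Eventually.of_forall fun x => ?_)
  rw [norm_mul]
  exact mul_le_mul_of_nonneg_right (hC x) (norm_nonneg _)

lemma L2T.bmul {n : ℕ} {u : ℕ → CSp n → ℂ} {v w : CSp n → ℂ} (h : L2T u v)
    (hw : AEStronglyMeasurable w volume) {C : ℝ} (hC : ∀ x, ‖w x‖ ≤ C) :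
    L2T (fun i x => w x * u i x) (fun x => w x * v x) := by
  refine ⟨fun i => bdd_mul_memLp hw hC (h.1 i), bdd_mul_memLp hw hC h.2.1, ?_⟩
  have h3 : Tendsto (fun i => ENNReal.ofReal C * eLpNorm (u i - v) 2 volume) atTop (𝓝 0) := by
    have := ENNReal.Tendsto.const_mul (a := ENNReal.ofReal C) h.2.2 (Or.inr ENNReal.ofReal_ne_top)
    simpa using this
  refine tendsto_of_tendsto_of_tendsto_of_le_of_le tendsto_const_nhds h3 (fun i => zero_le) ?_
  intro i
  refine eLpNorm_le_mul_eLpNorm_of_ae_le_mul (Eventually.of_forall fun x => ?_) 2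
  simp only [Pi.sub_apply, ← mul_sub, norm_mul]
  exact mul_le_mul_of_nonneg_right (hC x) (norm_nonneg _)

lemma L2T.wmul {n : ℕ} {u : ℕ → CSp n → ℂ} {v w : CSp n → ℂ} {S : Set (CSp n)} (h : L2T u v)
    (hS : IsCompact S) (hw : ContinuousOn w S) (hu : ∀ i, ∀ x ∉ S, u i x = 0) (hv : ∀ x ∉ S, v x = 0) :
    L2T (fun i x => u i x * w x) (fun x => v x * w x) := by
  obtain ⟨C, hC⟩ := hS.exists_bound_of_continuousOn hw
  have hm : AEStronglyMeasurable (S.indicator w) volume :=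
    (aestronglyMeasurable_indicator_iff hS.measurableSet).2 (hw.aestronglyMeasurable hS.measurableSet)
  have hb : ∀ x, ‖S.indicator w x‖ ≤ max C 0 := by
    intro x
    by_cases hx : x ∈ S
    · simp [hx, hC x hx]
    · simp [hx]
  have := h.bmul hm hb
  have e : ∀ (f : CSp n → ℂ), (∀ x ∉ S, f x = 0) → (fun x => S.indicator w x * f x) = fun x => f x * w x := by
    intro f hf
    ext x
    by_cases hx : x ∈ S
    · simp [hx, mul_comm]
    · simp [hx, hf x hx]
  rw [e v hv] at this
  have e2 : (fun i x => S.indicator w x * u i x) = fun i x => u i x * w x := by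
    ext i : 1
    exact e _ (hu i)
  rwa [e2] at this

lemma L2T.lim {n : ℕ} {u : ℕ → CSp n → ℂ} {v : CSp n → ℂ} {S : Set (CSp n)} (h : L2T u v)
    (hS : IsCompact S) {w : CSp n → ℝ} (hw : ContinuousOn w S) (hw0 : ∀ x ∈ S, 0 ≤ w x)
    (hu : ∀ i, ∀ x ∉ S, u i x = 0) (hv : ∀ x ∉ S, v x = 0) :
    Tendsto (fun i => ∫ x, ‖u i x‖^2 * w x) atTop (𝓝 (∫ x, ‖v x‖^2 * w x)) := by
  have hws : ContinuousOn (fun x => ((√(w x) : ℝ) : ℂ)) S := by fun_prop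
  have h1 := h.wmul hS hws hu hv
  have h2 := L2lim h1.1 h1.2.1 h1.2.2
  have e : ∀ (f : CSp n → ℂ), (∀ x ∉ S, f x = 0) →
      ∀ x, ‖f x * ((√(w x) : ℝ) : ℂ)‖^2 = ‖f x‖^2 * w x := by
    intro f hf x
    by_cases hx : x ∈ S
    · rw [norm_mul, mul_pow, Complex.norm_real, Real.norm_of_nonneg (Real.sqrt_nonneg _), Real.sq_sqrt (hw0 x hx)]
    · simp [hf x hx]
  simp_rw [e v hv] at h2
  have e2 : ∀ i x, ‖u i x * ((√(w x) : ℝ) : ℂ)‖^2 = ‖u i x‖^2 * w x := fun i => e _ (hu i)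
  simp_rw [e2] at h2
  exact h2

lemma mol_L2T {n : ℕ} {f : CSp n → ℂ} (hf : MemLp f 2 volume) {s : ℕ → ℝ} (hs : ∀ i, 0 < s i)
    (hs0 : Tendsto s atTop (𝓝 0)) : L2T (fun i => mol (s i) f) f := by
  refine ⟨fun i => mol_memLp (hs i) hf, hf, ?_⟩
  have : Tendsto s atTop (𝓝[>] 0) := tendsto_nhdsWithin_iff.2 ⟨hs0, Eventually.of_forall hs⟩
  exact (mol_tendsto hf).comp this

/-- coefficient in `XX` -/
def XC {n : ℕ} (P : CSp n → ℝ) (C : ℝ) (j : Fin n) (x : CSp n) : ℂ :=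
  (4 / P x - 5 * KK C * P x ^ 4 : ℝ) * dz j (cx P) x

lemma XC_cont {n : ℕ} {Ω : Set (CSp n)} {P : CSp n → ℝ} {C : ℝ} (h : Wgt Ω P C) (j : Fin n) :
    ContinuousOn (XC P C j) Ω := by
  unfold XC
  have h1 : ContinuousOn (dz j (cx P)) Ω :=
    (dw_contDiffOn (k := 1) h.isOpen _ j (cx_contDiffOn h.smooth)).continuousOn
  refine ContinuousOn.mul ?_ h1
  apply Complex.continuous_ofReal.comp_continuousOn
  have hs := h.smooth.continuousOn
  refine ContinuousOn.sub (ContinuousOn.div continuousOn_const hs ?_) (by fun_prop)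
  intro x hx
  have := h.one_le x hx
  positivity

/-- the basic estimate for compactly supported forms with weak derivatives in `L²` -/
lemma weak_est {n : ℕ} {Ω : Set (CSp n)} {P : CSp n → ℝ} {C : ℝ} (h : Wgt Ω P C) {S : Set (CSp n)}
    (hS : IsCompact S) (hSΩ : S ⊆ Ω) {m : Fin n → CSp n → ℂ} {b : CSp n → ℂ} {c : Fin n → Fin n → CSp n → ℂ}
    (hm : ∀ j, MemLp (m j) 2 volume) (hb : MemLp b 2 volume) (hc : ∀ j k, MemLp (c j k) 2 volume)
    (hm0 : ∀ j, ∀ x ∉ S, m j x = 0) (hb0 : ∀ x ∉ S, b x = 0) (hc0 : ∀ j k, ∀ x ∉ S, c j k x = 0)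
    (hwb : ∀ θ, Tst 2 univ θ → ∑ j, ∫ x, m j x * dz j θ x = - ∫ x, b x * θ x)
    (hwc : ∀ θ, Tst 2 univ θ → ∀ j k, (∫ x, m j x * dzb k θ x) - ∫ x, m k x * dzb j θ x = - ∫ x, c j k x * θ x) :
    2 * ∑ j, ∫ x, ‖m j x‖^2 * (P x ^ 4 * Real.exp (-phi P C x))
      ≤ 2 * (∫ x, ‖b x + ∑ j, m j x * XC P C j x‖^2 * Real.exp (-phi P C x))
        + 1/2 * ∑ j, ∑ k, ∫ x, ‖c j k x‖^2 * Real.exp (-phi P C x) := by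
  obtain ⟨σ0, hσ0, hthick⟩ := hS.exists_cthickening_subset_open h.isOpen hSΩ
  set S' := cthickening σ0 S with hS'
  have hS'c : IsCompact S' := hS.cthickening
  have hSS' : S ⊆ S' := self_subset_cthickening S
  set s : ℕ → ℝ := fun i => σ0 / (i + 1) with hs
  have hs1 : ∀ i, 0 < s i := fun i => by positivity
  have hs2 : ∀ i, s i ≤ σ0 := fun i => by
    apply div_le_self hσ0.le; linarith [(Nat.cast_nonneg i : (0:ℝ) ≤ i)]
  have hs3 : Tendsto s atTop (𝓝 0) := by
    have := (tendsto_one_div_add_atTop_nhds_zero_nat (𝕜 := ℝ)).const_mul σ0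
    simpa [hs, div_eq_mul_inv] using this
  have hv : ∀ {f : CSp n → ℂ}, (∀ x ∉ S, f x = 0) → ∀ i, tsupport (mol (s i) f) ⊆ S' := fun hf i =>
    (mol_support (hs1 i) hf).trans (cthickening_mono (hs2 i) S)
  have hv' : ∀ {f : CSp n → ℂ}, (∀ x ∉ S, f x = 0) → ∀ i, ∀ x ∉ S', mol (s i) f x = 0 := fun hf i x hx =>
    image_eq_zero_of_notMem_tsupport fun h => hx (hv hf i h)
  have hz : ∀ {f : CSp n → ℂ}, (∀ x ∉ S, f x = 0) → ∀ x ∉ S', f x = 0 := fun hf x hx => hf x fun h => hx (hSS' h)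
  have hT : ∀ i j, Tst 2 Ω (mol (s i) (m j)) := fun i j =>
    ⟨mol_contDiff (hs1 i) (memLp_locInt (hm j)) 2,
      HasCompactSupport.of_support_subset_isCompact hS'c ((subset_tsupport _).trans (hv (hm0 j) i)),
      (hv (hm0 j) i).trans hthick⟩
  have hest := fun i => basic_est h (f := fun j => mol (s i) (m j)) (fun j => hT i j)
  have hXX : ∀ i, XX P C (fun j => mol (s i) (m j)) = fun x => mol (s i) b x + ∑ j, mol (s i) (m j) x * XC P C j x := by
    intro i
    ext x
    rw [XX, Finset.sum_add_distrib]
    congr 1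
    have := hwb (fun y => kapc (s i) (x - y)) (kapc_sub_tst (hs1 i) 2 (subset_univ _))
    simp only [dz]
    simp_rw [fun j => mol_dw (hs1 i) (memLp_locInt (hm j))]
    rw [Finset.sum_neg_distrib]
    simp only [dz] at this
    rw [this, neg_neg]; rfl
  have hSS : ∀ i j k x, dzb k (mol (s i) (m j)) x - dzb j (mol (s i) (m k)) x = mol (s i) (c j k) x := by
    intro i j k x
    have := hwc (fun y => kapc (s i) (x - y)) (kapc_sub_tst (hs1 i) 2 (subset_univ _)) j k
    simp only [dzb] at this ⊢
    rw [mol_dw (hs1 i) (memLp_locInt (hm j)), mol_dw (hs1 i) (memLp_locInt (hm k)), mol]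
    linear_combination -this
  simp_rw [hSS, hXX] at hest
  have hφc : ContinuousOn (fun x => Real.exp (-phi P C x)) S' := by
    have := h.phi_smooth.continuousOn.mono hthick
    fun_prop
  have hPc : ContinuousOn P S' := h.smooth.continuousOn.mono hthick
  have l1 : ∀ j, Tendsto (fun i => ∫ x, ‖mol (s i) (m j) x‖^2 * (P x ^ 4 * Real.exp (-phi P C x))) atTop
      (𝓝 (∫ x, ‖m j x‖^2 * (P x ^ 4 * Real.exp (-phi P C x)))) := fun j =>
    (mol_L2T (hm j) hs1 hs3).lim hS'c (by fun_prop) (fun x hx => by positivity) (hv' (hm0 j)) (hz (hm0 j))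
  have l3 : ∀ j k, Tendsto (fun i => ∫ x, ‖mol (s i) (c j k) x‖^2 * (Real.exp (-phi P C x))) atTop
      (𝓝 (∫ x, ‖c j k x‖^2 * (Real.exp (-phi P C x)))) := fun j k =>
    (mol_L2T (hc j k) hs1 hs3).lim hS'c (by fun_prop) (fun x hx => by positivity) (hv' (hc0 j k)) (hz (hc0 j k))
  have l2 : Tendsto (fun i => ∫ x, ‖mol (s i) b x + ∑ j, mol (s i) (m j) x * XC P C j x‖^2 * (Real.exp (-phi P C x))) atTop
      (𝓝 (∫ x, ‖b x + ∑ j, m j x * XC P C j x‖^2 * (Real.exp (-phi P C x)))) := by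
    refine L2T.lim (S := S') ?_ hS'c (by fun_prop) (fun x hx => by positivity) ?_ ?_
    · refine (mol_L2T hb hs1 hs3).add (L2T.sum _ fun j _ => ?_)
      exact (mol_L2T (hm j) hs1 hs3).wmul hS'c ((XC_cont h j).mono hthick) (hv' (hm0 j)) (hz (hm0 j))
    · intro i x hx
      simp [hv' hb0 i x hx, fun j => hv' (hm0 j) i x hx]
    · intro x hx
      simp [hz hb0 x hx, fun j => hz (hm0 j) x hx]
  refine le_of_tendsto_of_tendsto' ((tendsto_finsetSum _ fun j _ => l1 j).const_mul 2)
    ((l2.const_mul 2).add ((tendsto_finsetSum _ fun j _ => tendsto_finsetSum _ fun k _ => l3 j k).const_mul (1/2))) hest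

open MeasureTheory

/-- the factor `α = e^{-φ/2} P²` -/
def al {n : ℕ} (P : CSp n → ℝ) (C : ℝ) (x : CSp n) : ℝ := Real.exp (-phi P C x / 2) * P x ^ 2

lemma Wgt.pos {n : ℕ} {Ω : Set (CSp n)} {P : CSp n → ℝ} {C : ℝ} (h : Wgt Ω P C) {x : CSp n} (hx : x ∈ Ω) :
    0 < P x := lt_of_lt_of_le one_pos (h.one_le x hx)

lemma Wgt.al_pos {n : ℕ} {Ω : Set (CSp n)} {P : CSp n → ℝ} {C : ℝ} (h : Wgt Ω P C) {x : CSp n} (hx : x ∈ Ω) :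
    0 < al P C x := by
  have := h.pos hx
  unfold al; positivity

lemma al_sq {n : ℕ} (P : CSp n → ℝ) (C : ℝ) (x : CSp n) : al P C x ^ 2 = Real.exp (-phi P C x) * P x ^ 4 := by
  unfold al
  rw [mul_pow, ← Real.exp_nat_mul]
  congr 1
  · congr 1; push_cast; ring
  · ring

lemma Wgt.al_smooth {n : ℕ} {Ω : Set (CSp n)} {P : CSp n → ℝ} {C : ℝ} (h : Wgt Ω P C) :
    ContDiffOn ℝ 2 (al P C) Ω :=
  (Real.contDiff_exp.comp_contDiffOn (h.phi_smooth.neg.div_const 2)).mul (h.smooth.pow 2)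

lemma Wgt.ai_smooth {n : ℕ} {Ω : Set (CSp n)} {P : CSp n → ℝ} {C : ℝ} (h : Wgt Ω P C) :
    ContDiffOn ℝ 2 (cx fun x => (al P C x)⁻¹) Ω :=
  cx_contDiffOn (k := 2) (h.al_smooth.inv fun x hx => (h.al_pos hx).ne')

lemma dw_inv_al_sq {n : ℕ} {Ω : Set (CSp n)} {P : CSp n → ℝ} {C : ℝ} (h : Wgt Ω P C) {x : CSp n} (hx : x ∈ Ω)
    (j : Fin n) : dz j (cx fun x => (al P C x)⁻¹ ^ 2) x = - (((al P C x)⁻¹ ^ 2 : ℝ) : ℂ) * XC P C j x := by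
  have e : (fun x => (al P C x)⁻¹ ^ 2) = fun x => Real.exp (phi P C x) * (P x ^ 4)⁻¹ := by
    ext x
    rw [inv_pow, al_sq, mul_inv, ← Real.exp_neg, neg_neg]
  have e' : (al P C x)⁻¹ ^ 2 = Real.exp (phi P C x) * (P x ^ 4)⁻¹ := congrFun e x
  rw [e, e']
  have hP := (h.cda hx).differentiableAt (by norm_num)
  have hP0 := (h.pos hx).ne'
  have hphi : DifferentiableAt ℝ (phi P C) x := (hP.pow 5).const_mul _
  have h1 := hphi.hasFDerivAt.exp.mul ((hasDerivAt_inv (pow_ne_zero 4 hP0)).comp_hasFDerivAt x (hP.hasFDerivAt.pow 4))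
  rw [phi_fderiv C hP] at h1
  have hd : DifferentiableAt ℝ (fun x => Real.exp (phi P C x) * (P x ^ 4)⁻¹) x := h1.differentiableAt
  have hf : fderiv ℝ (fun x => Real.exp (phi P C x) * (P x ^ 4)⁻¹) x = _ := h1.fderiv
  unfold dz XC
  rw [dw_cx hd, hf, dz, dw_cx hP]
  have hPc : (P x : ℂ) ≠ 0 := by exact_mod_cast hP0
  simp
  field_simp
  ring

lemma tst_memLp_mul {n : ℕ} {Ω : Set (CSp n)} {k W : CSp n → ℂ} (hk : MemLp k 2 volume) (hW : Tst 0 Ω W) :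
    MemLp (fun x => k x * W x) 2 volume := by
  obtain ⟨M, hM⟩ := hW.2.1.exists_bound_of_continuous hW.continuous
  have := bdd_mul_memLp hW.continuous.aestronglyMeasurable hM hk
  simpa only [mul_comm] using this

lemma tst_memLp {n : ℕ} {Ω : Set (CSp n)} {W : CSp n → ℂ} (hW : Tst 0 Ω W) : MemLp W 2 volume :=
  hW.continuous.memLp_of_hasCompactSupport hW.2.1

lemma tst_int_mul {n : ℕ} {Ω : Set (CSp n)} {k W : CSp n → ℂ} (hk : MemLp k 2 volume) (hW : Tst 0 Ω W) :
    Integrable (fun x => k x * W x) volume := by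
  exact MemLp.integrable_mul (p := 2) (q := 2) hk (tst_memLp hW)

lemma Tst.off {n k : ℕ} {Ω : Set (CSp n)} {W : CSp n → ℂ} (hW : Tst k Ω W) {x : CSp n} (hx : x ∉ Ω) : W x = 0 :=
  image_eq_zero_of_notMem_tsupport fun h => hx (hW.2.2 h)

lemma dw_off {n k : ℕ} {Ω : Set (CSp n)} {W : CSp n → ℂ} (hW : Tst k Ω W) (s : ℂ) (j : Fin n) {x : CSp n} (hx : x ∉ Ω) :
    dw s j W x = 0 := dw_eq_zero s j fun h => hx (hW.2.2 h)

lemma sq_add_le (a b : ℂ) {t : ℝ} (ht : 0 < t) : ‖a + b‖^2 ≤ (1 + t) * ‖a‖^2 + (1 + 1/t) * ‖b‖^2 := by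
  have h1 : ‖a + b‖^2 ≤ (‖a‖ + ‖b‖)^2 := pow_le_pow_left₀ (norm_nonneg _) (norm_add_le a b) 2
  have h2 : 0 ≤ (t * ‖a‖ - ‖b‖)^2 / t := by positivity
  have h3 : (t * ‖a‖ - ‖b‖)^2 / t = t * ‖a‖^2 - 2 * ‖a‖ * ‖b‖ + 1/t * ‖b‖^2 := by field_simp; ring
  nlinarith

lemma sum_sq_le {n : ℕ} (k d : Fin n → ℂ) {D : ℝ} (hd : ∀ j, ‖d j‖ ≤ D) :
    ‖∑ j, k j * d j‖^2 ≤ n * D^2 * ∑ j, ‖k j‖^2 := by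
  have h1 : ‖∑ j, k j * d j‖ ≤ ∑ j, ‖k j‖ * D := by
    refine (norm_sum_le _ _).trans (Finset.sum_le_sum fun j _ => ?_)
    rw [norm_mul]; exact mul_le_mul_of_nonneg_left (hd j) (norm_nonneg _)
  have h2 : ‖∑ j, k j * d j‖^2 ≤ (∑ j, ‖k j‖ * D)^2 := pow_le_pow_left₀ (norm_nonneg _) h1 2
  have h3 := sq_sum_le_card_mul_sum_sq (s := Finset.univ) (f := fun j => ‖k j‖ * D)
  simp only [Finset.card_univ, Fintype.card_fin, mul_pow, ← Finset.sum_mul] at h3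
  rw [← Finset.sum_mul] at h2
  nlinarith

lemma cut_est {n : ℕ} {Ω : Set (CSp n)} {P : CSp n → ℝ} {C : ℝ} (h : Wgt Ω P C)
    {k : Fin n → CSp n → ℂ} {g : CSp n → ℂ} (hk : ∀ j, MemLp (k j) 2 volume) (hg : MemLp g 2 volume)
    (hK : ∀ θ, Tst 2 Ω θ → ∀ i j, ∫ x, (k j x * (((al P C x)⁻¹ : ℝ) * dzb i θ x) - k i x * (((al P C x)⁻¹ : ℝ) * dzb j θ x)) = 0)
    (hT : ∀ θ, Tst 2 Ω θ → ∑ j, ∫ x, k j x * (al P C x * dz j θ x) = ∫ x, g x * (al P C x * P x ^ 2 * θ x))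
    {η : CSp n → ℝ} (hη : Tst 2 Ω (cx η)) (hη1 : ∀ x, |η x| ≤ 1) {D : ℝ}
    (hD : ∀ x ∈ Ω, ∀ j, ‖dz j (cx η) x‖ ≤ D * P x ^ 2 ∧ ‖dzb j (cx η) x‖ ≤ D * P x ^ 2) {t : ℝ} (ht : 0 < t) :
    ∑ j, ∫ x, ‖k j x‖^2 * η x ^ 2 ≤ (1 + t) * (∫ x, ‖g x‖^2) + (2 + 1/t) * n * D^2 * ∑ j, ∫ x, ‖k j x‖^2 := by
  classical
  set a : CSp n → ℂ := cx fun x => (al P C x)⁻¹ with ha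
  have has : ContDiffOn ℝ 2 a Ω := h.ai_smooth
  have has0 : ContDiffOn ℝ (0:ℕ) a Ω := has.of_le (by norm_num)
  have hη0 : Tst 0 Ω (cx η) := hη.mono (by norm_num)
  have hdη : ∀ s j, Tst 0 Ω (dw s j (cx η)) := fun s j => (Tst.dw (k := 1) hη s j).mono (by norm_num)
  have hXCs : ∀ j, ContDiffOn ℝ (0:ℕ) (XC P C j) Ω := fun j => by
    have := XC_cont h j
    exact contDiffOn_zero.2 this
  have hPs : ContDiffOn ℝ (0:ℕ) (fun x => (P x : ℂ)^2) Ω := by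
    have : ContDiffOn ℝ (2:ℕ) (cx P) Ω := cx_contDiffOn h.smooth
    exact (this.pow 2).of_le (by norm_num)
  have E1 : Tst 0 Ω (fun x => cx η x * a x) := hη0.contDiff_mul h.isOpen has0
  have E2 : ∀ s j, Tst 0 Ω (fun x => dw s j (cx η) x * a x) := fun s j => (hdη s j).contDiff_mul h.isOpen has0
  have E3 : ∀ j, Tst 0 Ω (fun x => cx η x * a x * XC P C j x) := fun j => E1.contDiff_mul h.isOpen (hXCs j)
  have E4 : Tst 0 Ω (fun x => cx η x * a x * (P x : ℂ)^2) := E1.contDiff_mul h.isOpen hPs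
  set S := tsupport (cx η) with hS
  have hSc : IsCompact S := hη.2.1
  have z1 : ∀ x ∉ S, cx η x = 0 := fun x hx => image_eq_zero_of_notMem_tsupport hx
  have z2 : ∀ s j, ∀ x ∉ S, dw s j (cx η) x = 0 := fun s j x hx => dw_eq_zero s j hx
  set b : CSp n → ℂ := fun x => - (g x * (cx η x * a x * (P x : ℂ)^2)) + (∑ j, k j x * (dz j (cx η) x * a x)
      - ∑ j, k j x * (cx η x * a x * XC P C j x)) with hb
  have hbm : MemLp b 2 volume := by
    refine (tst_memLp_mul hg E4).neg.add (MemLp.sub ?_ ?_)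
    · exact memLp_finsetSum _ fun j _ => tst_memLp_mul (hk j) (E2 _ j)
    · exact memLp_finsetSum _ fun j _ => tst_memLp_mul (hk j) (E3 j)
  have key := weak_est h hSc hη.2.2 (m := fun j x => k j x * (cx η x * a x)) (b := b)
    (c := fun j i x => k j x * (dzb i (cx η) x * a x) - k i x * (dzb j (cx η) x * a x))
    (fun j => tst_memLp_mul (hk j) E1) hbm
    (fun j i => (tst_memLp_mul (hk j) (E2 _ i)).sub (tst_memLp_mul (hk i) (E2 _ j)))
    (fun j x hx => by simp [z1 x hx])
    (fun x hx => by
      have := fun j => z2 (-Complex.I) j x hx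
      simp [hb, z1 x hx, dz, this])
    (fun j i x hx => by
      have := fun j => z2 (Complex.I) j x hx
      simp [dzb, this])
    (fun θ hθ => by
      have hθ' : Tst 2 Ω (fun x => cx η x * ((cx fun x => (al P C x)⁻¹ ^ 2) x * θ x)) := by
        refine hη.contDiff_mul h.isOpen (ContDiffOn.mul ?_ hθ.1.contDiffOn)
        exact cx_contDiffOn (k := 2) ((h.al_smooth.inv fun x hx => (h.al_pos hx).ne').pow 2)
      have h1 := hT _ hθ'
      have hpt : ∀ j x, k j x * (al P C x * dz j (fun x => cx η x * ((cx fun x => (al P C x)⁻¹ ^ 2) x * θ x)) x)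
          = k j x * (cx η x * a x) * dz j θ x + k j x * (dz j (cx η) x * a x) * θ x
            - k j x * (cx η x * a x * XC P C j x) * θ x := by
        intro j x
        by_cases hx : x ∈ Ω
        · have d1 : DifferentiableAt ℝ (cx η) x := hη.1.differentiable (by norm_num) x
          have d2 : DifferentiableAt ℝ θ x := hθ.1.differentiable (by norm_num) x
          have d3 : DifferentiableAt ℝ (cx fun x => (al P C x)⁻¹ ^ 2) x :=
            ((cx_contDiffOn (k := 2) ((h.al_smooth.inv fun x hx => (h.al_pos hx).ne').pow 2)).contDiffAt
              (h.isOpen.mem_nhds hx)).differentiableAt (by norm_num)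
          have e1 := dw_inv_al_sq h hx j
          unfold dz at e1 ⊢
          rw [dw_mul _ _ d1 (d3.fun_mul d2), dw_mul _ _ d3 d2, e1]
          have : (al P C x : ℂ) ≠ 0 := by exact_mod_cast (h.al_pos hx).ne'
          simp only [ha, cx]
          push_cast
          field_simp
          ring
        · have := dw_off hθ' (-Complex.I) j hx
          have h2 := dw_off hη (-Complex.I) j hx
          have h3 := hη.off hx
          unfold dz
          rw [this, h2, h3]; simp
      have hpt2 : ∀ x, g x * (al P C x * P x ^ 2 * (cx η x * ((cx fun x => (al P C x)⁻¹ ^ 2) x * θ x)))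
          = g x * (cx η x * a x * (P x : ℂ)^2) * θ x := by
        intro x
        by_cases hx : x ∈ Ω
        · have : (al P C x : ℂ) ≠ 0 := by exact_mod_cast (h.al_pos hx).ne'
          simp only [ha, cx]
          push_cast
          field_simp
        · rw [hη.off hx]; simp
      simp_rw [hpt, hpt2] at h1
      have hθ0 : Tst 0 univ θ := hθ.mono (by norm_num)
      have hdθ : ∀ s j, Tst 0 univ (dw s j θ) := fun s j => (Tst.dw (k := 1) hθ s j).mono (by norm_num)
      have i1 : ∀ j, Integrable (fun x => k j x * (cx η x * a x) * dz j θ x) := fun j =>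
        tst_int_mul (tst_memLp_mul (hk j) E1) (hdθ _ j)
      have i2 : ∀ j, Integrable (fun x => k j x * (dz j (cx η) x * a x) * θ x) := fun j =>
        tst_int_mul (tst_memLp_mul (hk j) (E2 _ j)) hθ0
      have i3 : ∀ j, Integrable (fun x => k j x * (cx η x * a x * XC P C j x) * θ x) := fun j =>
        tst_int_mul (tst_memLp_mul (hk j) (E3 j)) hθ0
      have i4 : Integrable (fun x => g x * (cx η x * a x * (P x : ℂ)^2) * θ x) :=
        tst_int_mul (tst_memLp_mul hg E4) hθ0
      have h2 : ∀ j, ∫ x, (k j x * (cx η x * a x) * dz j θ x + k j x * (dz j (cx η) x * a x) * θ x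
            - k j x * (cx η x * a x * XC P C j x) * θ x) = (∫ x, k j x * (cx η x * a x) * dz j θ x) +
            (∫ x, k j x * (dz j (cx η) x * a x) * θ x) - ∫ x, k j x * (cx η x * a x * XC P C j x) * θ x := by
        intro j
        rw [integral_sub ((i1 j).fun_add (i2 j)) (i3 j), integral_add (i1 j) (i2 j)]
      simp_rw [h2] at h1
      have h3 : ∫ x, b x * θ x = - (∫ x, g x * (cx η x * a x * (P x : ℂ)^2) * θ x)
          + (∑ j, (∫ x, k j x * (dz j (cx η) x * a x) * θ x) - ∑ j, ∫ x, k j x * (cx η x * a x * XC P C j x) * θ x) := by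
        have hI : Integrable (fun x => ∑ j, k j x * (dz j (cx η) x * a x) * θ x
            - ∑ j, k j x * (cx η x * a x * XC P C j x) * θ x) :=
          (integrable_finsetSum _ fun j _ => i2 j).sub (integrable_finsetSum _ fun j _ => i3 j)
        rw [← integral_finsetSum _ fun j _ => i2 j, ← integral_finsetSum _ fun j _ => i3 j, ← integral_neg,
          ← integral_sub (integrable_finsetSum _ fun j _ => i2 j) (integrable_finsetSum _ fun j _ => i3 j),
          ← integral_add i4.fun_neg hI]
        congr 1
        ext x
        simp only [hb, ← Finset.sum_mul]
        ring
      rw [h3]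
      rw [Finset.sum_sub_distrib, Finset.sum_add_distrib] at h1
      linear_combination h1)
    (fun θ hθ j i => by
      have hθ' : Tst 2 Ω (fun x => cx η x * θ x) := hη.contDiff_mul h.isOpen hθ.1.contDiffOn
      have h1 := hK _ hθ' i j
      have hpt : ∀ i j x, k j x * (((al P C x)⁻¹ : ℝ) * dzb i (fun x => cx η x * θ x) x)
          = k j x * (cx η x * a x) * dzb i θ x + k j x * (dzb i (cx η) x * a x) * θ x := by
        intro i j x
        have d1 : DifferentiableAt ℝ (cx η) x := hη.1.differentiable (by norm_num) x
        have d2 : DifferentiableAt ℝ θ x := hθ.1.differentiable (by norm_num) x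
        unfold dzb
        rw [dw_mul _ _ d1 d2]
        simp only [ha, cx]
        ring
      have hθ0 : Tst 0 univ θ := hθ.mono (by norm_num)
      have hdθ : ∀ s j, Tst 0 univ (dw s j θ) := fun s j => (Tst.dw (k := 1) hθ s j).mono (by norm_num)
      have i1 : ∀ j i, Integrable (fun x => k j x * (cx η x * a x) * dzb i θ x) := fun j i =>
        tst_int_mul (tst_memLp_mul (hk j) E1) (hdθ _ i)
      have i2 : ∀ j i, Integrable (fun x => k j x * (dzb i (cx η) x * a x) * θ x) := fun j i =>
        tst_int_mul (tst_memLp_mul (hk j) (E2 _ i)) hθ0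
      simp_rw [hpt] at h1
      rw [integral_sub ((i1 j i).fun_add (i2 j i)) ((i1 i j).fun_add (i2 i j)), integral_add (i1 j i) (i2 j i),
        integral_add (i1 i j) (i2 i j)] at h1
      have h3 : ∫ x, (k j x * (dzb i (cx η) x * a x) - k i x * (dzb j (cx η) x * a x)) * θ x
          = (∫ x, k j x * (dzb i (cx η) x * a x) * θ x) - ∫ x, k i x * (dzb j (cx η) x * a x) * θ x := by
        rw [← integral_sub (i2 j i) (i2 i j)]
        congr 1; ext x; ring
      rw [h3]
      linear_combination h1)
  have N2 : ∀ j, Integrable (fun x => ‖k j x‖^2) := fun j => (hk j).norm.integrable_sq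
  have G2 : Integrable (fun x => ‖g x‖^2) := hg.norm.integrable_sq
  have SN : Integrable (fun x => ∑ j, ‖k j x‖^2) := integrable_finsetSum _ fun j _ => N2 j
  -- left side
  have L : ∀ j, ∫ x, ‖k j x * (cx η x * a x)‖^2 * (P x ^ 4 * Real.exp (-phi P C x)) = ∫ x, ‖k j x‖^2 * η x ^ 2 := by
    intro j
    congr 1; ext x
    by_cases hx : x ∈ Ω
    · have h1 := h.al_pos hx
      have h2 := al_sq P C x
      rw [mul_comm (P x ^ 4), ← h2, norm_mul, norm_mul]
      simp only [ha, cx, Complex.norm_real, Real.norm_eq_abs, mul_pow, sq_abs]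
      field_simp
    · rw [hη.off hx]
      have : η x = 0 := by have := hη.off hx; simpa [cx] using this
      simp [this]
  have R1 : ∫ x, ‖b x + ∑ j, k j x * (cx η x * a x) * XC P C j x‖^2 * Real.exp (-phi P C x)
      ≤ ∫ x, ((1 + t) * ‖g x‖^2 + (1 + 1/t) * (n * D^2 * ∑ j, ‖k j x‖^2)) := by
    refine integral_mono_of_nonneg (Eventually.of_forall fun x => by positivity)
      ((G2.const_mul _).add ((SN.const_mul _).const_mul _)) (Eventually.of_forall fun x => ?_)
    by_cases hx : x ∈ Ω
    · have hP := h.pos hx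
      have h1 := h.al_pos hx
      have h2 := al_sq P C x
      have hPc : (P x : ℂ) ≠ 0 := by exact_mod_cast hP.ne'
      have e : b x + ∑ j, k j x * (cx η x * a x) * XC P C j x
          = (- (g x * η x) + ∑ j, k j x * (dz j (cx η) x / (P x)^2)) * (a x * (P x : ℂ)^2) := by
        simp only [hb, add_mul, Finset.sum_mul]
        have e1 : ∑ j, k j x * (dz j (cx η) x / (P x)^2) * (a x * (P x : ℂ)^2) = ∑ j, k j x * (dz j (cx η) x * a x) := by
          refine Finset.sum_congr rfl fun j _ => ?_
          field_simp
        have e2 : ∑ j, k j x * (cx η x * a x) * XC P C j x = ∑ j, k j x * (cx η x * a x * XC P C j x) :=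
          Finset.sum_congr rfl fun j _ => by ring
        rw [e1, e2]
        simp only [cx]; ring
      have e3 : ‖a x * (P x : ℂ)^2‖^2 * Real.exp (-phi P C x) = 1 := by
        have : ‖a x * (P x : ℂ)^2‖ = (al P C x)⁻¹ * P x ^ 2 := by
          rw [norm_mul, norm_pow]
          simp only [ha, cx, Complex.norm_real, Real.norm_eq_abs]
          rw [abs_of_pos hP, abs_of_pos (inv_pos.2 h1)]
        rw [this, mul_pow, inv_pow, h2]
        have := (Real.exp_pos (-phi P C x)).ne'
        field_simp
      show ‖b x + ∑ j, k j x * (cx η x * a x) * XC P C j x‖^2 * Real.exp (-phi P C x) ≤ (1 + t) * ‖g x‖^2 + (1 + 1/t) * (n * D^2 * ∑ j, ‖k j x‖^2)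
      rw [e, norm_mul, mul_pow, mul_assoc, e3, mul_one]
      refine (sq_add_le _ _ ht).trans ?_
      gcongr
      · rw [norm_neg, norm_mul, Complex.norm_real]
        exact mul_le_of_le_one_right (norm_nonneg _) (hη1 x)
      · refine sum_sq_le (fun j => k j x) _ fun j => ?_
        rw [norm_div, norm_pow, Complex.norm_real, Real.norm_of_nonneg hP.le, div_le_iff₀ (by positivity)]
        exact (hD x hx j).1
    · have h1 : b x + ∑ j, k j x * (cx η x * a x) * XC P C j x = 0 := by
        have := fun j => dw_off hη (-Complex.I) j hx
        simp [hb, hη.off hx, dz, this]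
      show ‖b x + ∑ j, k j x * (cx η x * a x) * XC P C j x‖^2 * Real.exp (-phi P C x) ≤ (1 + t) * ‖g x‖^2 + (1 + 1/t) * (n * D^2 * ∑ j, ‖k j x‖^2)
      rw [h1]
      simp only [norm_zero, ne_eq, OfNat.ofNat_ne_zero, not_false_eq_true, zero_pow, zero_mul]
      have : 0 ≤ ∑ j, ‖k j x‖^2 := Finset.sum_nonneg fun j _ => by positivity
      positivity
  have R2 : ∀ j i, ∫ x, ‖k j x * (dzb i (cx η) x * a x) - k i x * (dzb j (cx η) x * a x)‖^2 * Real.exp (-phi P C x)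
      ≤ ∫ x, (2 * D^2 * ‖k j x‖^2 + 2 * D^2 * ‖k i x‖^2) := by
    intro j i
    refine integral_mono_of_nonneg (Eventually.of_forall fun x => by positivity)
      (((N2 j).const_mul _).add ((N2 i).const_mul _)) (Eventually.of_forall fun x => ?_)
    by_cases hx : x ∈ Ω
    · have hP := h.pos hx
      have h1 := h.al_pos hx
      have h2 := al_sq P C x
      have hx1 := (hD x hx i).2
      have hx2 := (hD x hx j).2
      have e3 : ‖a x‖^2 * Real.exp (-phi P C x) = (P x ^ 4)⁻¹ := by
        simp only [ha, cx, Complex.norm_real, Real.norm_eq_abs, sq_abs, inv_pow]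
        rw [h2]
        have := (Real.exp_pos (-phi P C x)).ne'
        field_simp
      show ‖k j x * (dzb i (cx η) x * a x) - k i x * (dzb j (cx η) x * a x)‖^2 * Real.exp (-phi P C x) ≤ _
      have e4 : k j x * (dzb i (cx η) x * a x) - k i x * (dzb j (cx η) x * a x)
        = (k j x * dzb i (cx η) x - k i x * dzb j (cx η) x) * a x := by ring
      rw [e4, norm_mul, mul_pow, mul_assoc, e3, ← div_eq_mul_inv, div_le_iff₀ (by positivity)]
      have h5 : ‖k j x * dzb i (cx η) x - k i x * dzb j (cx η) x‖ ≤ ‖k j x‖ * (D * P x ^ 2) + ‖k i x‖ * (D * P x ^ 2) := by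
        refine (norm_sub_le _ _).trans ?_
        rw [norm_mul, norm_mul]
        gcongr
      have h6 := pow_le_pow_left₀ (norm_nonneg _) h5 2
      have h7 : 0 ≤ (‖k j x‖ - ‖k i x‖)^2 * (D * P x ^ 2)^2 := by positivity
      nlinarith
    · have := fun j => dw_off hη (Complex.I) j hx
      simp only [dzb, this]
      simp
      positivity
  simp_rw [L] at key
  have R2s : ∑ j, ∑ i, ∫ x, ‖k j x * (dzb i (cx η) x * a x) - k i x * (dzb j (cx η) x * a x)‖^2 * Real.exp (-phi P C x)
      ≤ 4 * n * D^2 * ∑ j, ∫ x, ‖k j x‖^2 := by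
    refine (Finset.sum_le_sum fun j _ => Finset.sum_le_sum fun i _ => R2 j i).trans (le_of_eq ?_)
    have : ∀ j i, ∫ x, (2 * D^2 * ‖k j x‖^2 + 2 * D^2 * ‖k i x‖^2)
        = 2 * D^2 * (∫ x, ‖k j x‖^2) + 2 * D^2 * ∫ x, ‖k i x‖^2 := fun j i => by
      rw [integral_add ((N2 j).const_mul _) ((N2 i).const_mul _), integral_const_mul, integral_const_mul]
    simp_rw [this, Finset.sum_add_distrib]
    simp only [Finset.sum_const, Finset.card_univ, Fintype.card_fin, nsmul_eq_mul, ← Finset.mul_sum]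
    ring
  have R1s : ∫ x, ((1 + t) * ‖g x‖^2 + (1 + 1/t) * (n * D^2 * ∑ j, ‖k j x‖^2))
      = (1 + t) * (∫ x, ‖g x‖^2) + (1 + 1/t) * (n * D^2 * ∑ j, ∫ x, ‖k j x‖^2) := by
    rw [integral_add (G2.const_mul _) ((SN.const_mul _).const_mul _), integral_const_mul, integral_const_mul,
      integral_const_mul, integral_finsetSum _ fun j _ => N2 j]
  rw [R1s] at R1
  nlinarith

open MeasureTheory

lemma smoothTransition_deriv_bdd : ∃ M : ℝ, 0 ≤ M ∧ ∀ t, |deriv Real.smoothTransition t| ≤ M := by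
  have hc : Continuous (deriv Real.smoothTransition) :=
    (Real.smoothTransition.contDiff (n := 1)).continuous_deriv (by norm_num)
  obtain ⟨M, hM⟩ := (isCompact_Icc (a := (0:ℝ)) (b := 1)).exists_bound_of_continuousOn hc.continuousOn
  refine ⟨max M 0, le_max_right _ _, fun t => ?_⟩
  by_cases h0 : t < 0
  · have : Real.smoothTransition =ᶠ[𝓝 t] fun _ => 0 := by
      filter_upwards [Iio_mem_nhds h0] with s hs
      exact Real.smoothTransition.zero_of_nonpos (le_of_lt hs)
    rw [this.deriv_eq]; simp
  by_cases h1 : 1 < t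
  · have : Real.smoothTransition =ᶠ[𝓝 t] fun _ => 1 := by
      filter_upwards [Ioi_mem_nhds h1] with s hs
      exact Real.smoothTransition.one_of_one_le (le_of_lt hs)
    rw [this.deriv_eq]; simp
  exact (hM t ⟨not_lt.1 h0, not_lt.1 h1⟩).trans (le_max_left _ _)

lemma norm_ee {n : ℕ} (j : Fin n) : ‖(ee j : CSp n)‖ = 1 := by simp [ee]

lemma norm_dw_le {n : ℕ} {f : CSp n → ℂ} {x : CSp n} {s : ℂ} (hs : ‖s‖ = 1) (j : Fin n) :
    ‖dw s j f x‖ ≤ ‖fderiv ℝ f x‖ := by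
  unfold dw
  have h1 := (fderiv ℝ f x).le_opNorm (ee j)
  have h2 := (fderiv ℝ f x).le_opNorm (Complex.I • ee j)
  rw [norm_smul, Complex.norm_I, one_mul, norm_ee, mul_one] at h2
  rw [norm_ee, mul_one] at h1
  rw [norm_div]
  have h3 := norm_add_le (fderiv ℝ f x (ee j)) (s * fderiv ℝ f x (Complex.I • ee j))
  rw [norm_mul, hs, one_mul] at h3
  have h4 : ‖(2:ℂ)‖ = 2 := by simp
  rw [h4]; linarith

lemma exists_cut {n : ℕ} {Ω : Set (CSp n)} {P : CSp n → ℝ} {C : ℝ} (h : Wgt Ω P C) :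
    ∃ L : ℝ, ∀ ν : ℕ, ∃ η : CSp n → ℝ, Tst 2 Ω (cx η) ∧ (∀ x, |η x| ≤ 1) ∧ (∀ x ∈ Ω, P x ≤ ν + 1 → η x = 1) ∧
      ∀ x ∈ Ω, ∀ j, ‖dz j (cx η) x‖ ≤ (L / (ν + 1)) * P x ^ 2 ∧ ‖dzb j (cx η) x‖ ≤ (L / (ν + 1)) * P x ^ 2 := by
  classical
  obtain ⟨M, hM0, hM⟩ := smoothTransition_deriv_bdd
  refine ⟨M * C, fun ν => ?_⟩
  have hν : (0:ℝ) < ν + 1 := by positivity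
  set η : CSp n → ℝ := fun x => if x ∈ Ω then Real.smoothTransition (2 - P x / (ν + 1)) else 0 with hη
  set K := {x | x ∈ Ω ∧ P x ≤ 2 * (ν + 1)} with hK
  have hKc : IsCompact K := h.cpt _
  have hz : ∀ x ∉ K, η x = 0 := by
    intro x hx
    simp only [hη]
    split_ifs with hxΩ
    · apply Real.smoothTransition.zero_of_nonpos
      have : 2 * (ν + 1) < P x := by
        by_contra hc; exact hx ⟨hxΩ, not_lt.1 hc⟩
      have := (lt_div_iff₀ hν).2 this
      linarith
    · rfl
  have hev : ∀ x ∈ Ω, η =ᶠ[𝓝 x] fun x => Real.smoothTransition (2 - P x / (ν + 1)) := by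
    intro x hx
    filter_upwards [h.isOpen.mem_nhds hx] with y hy
    simp [hη, hy]
  have hsm : ContDiff ℝ 2 η := by
    rw [contDiff_iff_contDiffAt]
    intro x
    by_cases hx : x ∈ Ω
    · refine ContDiffAt.congr_of_eventuallyEq ?_ (hev x hx)
      exact (Real.smoothTransition.contDiff.contDiffAt).comp x (contDiffAt_const.sub ((h.cda hx).div_const _))
    · have : η =ᶠ[𝓝 x] fun _ => 0 := by
        filter_upwards [hKc.isClosed.isOpen_compl.mem_nhds (fun hk => hx hk.1)] with y hy
        exact hz y hy
      exact contDiffAt_const.congr_of_eventuallyEq this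
  have hts : tsupport (cx η) ⊆ K := by
    refine closure_minimal (fun x hx => ?_) hKc.isClosed
    by_contra hc
    exact hx (by simp [cx, hz x hc])
  refine ⟨η, ⟨Complex.ofRealCLM.contDiff.comp hsm, hKc.of_isClosed_subset (isClosed_tsupport _) hts, hts.trans fun x hx => hx.1⟩,
    fun x => ?_, fun x hx hPx => ?_, fun x hx j => ?_⟩
  · simp only [hη]
    split_ifs
    · rw [abs_of_nonneg (Real.smoothTransition.nonneg _)]; exact Real.smoothTransition.le_one _
    · simp
  · simp only [hη, hx, if_true]
    apply Real.smoothTransition.one_of_one_le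
    have := (div_le_one hν).2 hPx
    linarith
  · have hd : DifferentiableAt ℝ η x := hsm.differentiable (by norm_num) x
    have hP := ((h.cda hx).differentiableAt (by norm_num)).hasFDerivAt
    have h1 : HasFDerivAt (fun x => 2 - P x / (ν + 1)) (-((ν + 1 : ℝ)⁻¹ • fderiv ℝ P x)) x := by
      have := (hP.const_mul (ν + 1 : ℝ)⁻¹).const_sub 2
      simpa only [div_eq_inv_mul] using this
    have h2 : HasFDerivAt (fun x => Real.smoothTransition (2 - P x / (ν + 1)))
        (deriv Real.smoothTransition (2 - P x / (ν + 1)) • -((ν + 1 : ℝ)⁻¹ • fderiv ℝ P x)) x :=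
      HasDerivAt.comp_hasFDerivAt (h₂ := Real.smoothTransition) x
        ((Real.smoothTransition.contDiff (n := 1)).differentiable (by norm_num) _).hasDerivAt h1
    have h3 : ‖fderiv ℝ η x‖ ≤ M * C / (ν + 1) * P x ^ 2 := by
      rw [(hev x hx).fderiv_eq, h2.fderiv, norm_smul, norm_neg, norm_smul, Real.norm_eq_abs, norm_inv,
        Real.norm_of_nonneg hν.le]
      have := hM (2 - P x / (ν + 1))
      have hg := h.grad x hx
      calc _ ≤ M * ((ν + 1 : ℝ)⁻¹ * (C * P x ^ 2)) := by gcongr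
        _ = _ := by field_simp
    have h4 : ‖fderiv ℝ (cx η) x‖ ≤ ‖fderiv ℝ η x‖ := by
      refine ContinuousLinearMap.opNorm_le_bound _ (norm_nonneg _) fun v => ?_
      rw [fderiv_cx hd, Complex.norm_real]
      exact (fderiv ℝ η x).le_opNorm v
    exact ⟨(norm_dw_le (by simp) j).trans (h4.trans h3), (norm_dw_le (by simp) j).trans (h4.trans h3)⟩

lemma main_est {n : ℕ} {Ω : Set (CSp n)} {P : CSp n → ℝ} {C : ℝ} (h : Wgt Ω P C)
    {k : Fin n → CSp n → ℂ} {g : CSp n → ℂ} (hk : ∀ j, MemLp (k j) 2 volume) (hg : MemLp g 2 volume)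
    (hK : ∀ θ, Tst 2 Ω θ → ∀ i j, ∫ x, (k j x * (((al P C x)⁻¹ : ℝ) * dzb i θ x) - k i x * (((al P C x)⁻¹ : ℝ) * dzb j θ x)) = 0)
    (hT : ∀ θ, Tst 2 Ω θ → ∑ j, ∫ x, k j x * (al P C x * dz j θ x) = ∫ x, g x * (al P C x * P x ^ 2 * θ x)) :
    ∑ j, ∫ x in Ω, ‖k j x‖^2 ≤ ∫ x, ‖g x‖^2 := by
  obtain ⟨L, hL⟩ := exists_cut h
  choose η hη1 hη2 hη3 hη4 using hL
  have est : ∀ ν : ℕ, ∑ j, ∫ x, ‖k j x‖^2 * η ν x ^ 2 ≤ (1 + 1/((ν:ℝ)+1)) * (∫ x, ‖g x‖^2)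
      + (2 * (1/((ν:ℝ)+1)) ^ 2 + 1/((ν:ℝ)+1)) * (n * L^2 * ∑ j, ∫ x, ‖k j x‖^2) := by
    intro ν
    have hν : (0:ℝ) < ν + 1 := by positivity
    refine (cut_est h hk hg hK hT (hη1 ν) (hη2 ν) (hη4 ν) (t := 1/((ν:ℝ)+1)) (by positivity)).trans (le_of_eq ?_)
    field_simp
  have hl : Tendsto (fun ν : ℕ => (1 + 1/((ν:ℝ)+1)) * (∫ x, ‖g x‖^2)
      + (2 * (1/((ν:ℝ)+1)) ^ 2 + 1/((ν:ℝ)+1)) * (n * L^2 * ∑ j, ∫ x, ‖k j x‖^2)) atTop (𝓝 (∫ x, ‖g x‖^2)) := by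
    have h0 := tendsto_one_div_add_atTop_nhds_zero_nat (𝕜 := ℝ)
    have := ((h0.const_add 1).mul_const (∫ x, ‖g x‖^2)).add
      ((((h0.pow 2).const_mul 2).add h0).mul_const (n * L^2 * ∑ j, ∫ x, ‖k j x‖^2))
    simpa using this
  have hl2 : ∀ j, Tendsto (fun ν : ℕ => ∫ x, ‖k j x‖^2 * η ν x ^ 2) atTop (𝓝 (∫ x in Ω, ‖k j x‖^2)) := by
    intro j
    rw [← integral_indicator h.isOpen.measurableSet]
    refine tendsto_integral_of_dominated_convergence (fun x => ‖k j x‖^2) (fun ν => ?_)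
      (hk j).norm.integrable_sq (fun ν => Eventually.of_forall fun x => ?_) (Eventually.of_forall fun x => ?_)
    · refine ((hk j).norm.integrable_sq.1).mul ?_
      have : Continuous (η ν) := by
        have := Complex.continuous_re.comp (hη1 ν).continuous
        exact this
      exact (this.pow 2).aestronglyMeasurable
    · rw [norm_mul, norm_pow, norm_norm, norm_pow]
      refine mul_le_of_le_one_right (by positivity) (pow_le_one₀ (norm_nonneg _) (hη2 ν x))
    · by_cases hx : x ∈ Ω
      · apply tendsto_const_nhds.congr'
        obtain ⟨N, hN⟩ := exists_nat_ge (P x)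
        filter_upwards [eventually_ge_atTop N] with ν hν
        rw [hη3 ν x hx (by have : (N:ℝ) ≤ ν := by exact_mod_cast hν
                           linarith)]
        simp [hx]
      · have : ∀ ν, η ν x = 0 := fun ν => by
          have := (hη1 ν).off hx
          simpa [cx] using this
        simp [this, hx]
  exact le_of_tendsto_of_tendsto' (tendsto_finsetSum _ fun j _ => hl2 j) hl est

open MeasureTheory

/-- scalar `L²` -/
abbrev L2s (n : ℕ) := Lp ℂ 2 (volume : Measure (CSp n))
/-- `L²` forms -/
abbrev L2f (n : ℕ) := PiLp 2 (fun _ : Fin n => L2s n)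

lemma l2_inner {n : ℕ} {f g : CSp n → ℂ} (hf : MemLp f 2 volume) (hg : MemLp g 2 volume) :
    inner ℂ (hf.toLp f) (hg.toLp g) = ∫ x, star (f x) * g x := by
  rw [L2.inner_def]
  apply integral_congr_ae
  filter_upwards [hf.coeFn_toLp, hg.coeFn_toLp] with x h1 h2
  rw [h1, h2, RCLike.inner_apply, mul_comm]; rfl

lemma l2_norm {n : ℕ} {f : CSp n → ℂ} (hf : MemLp f 2 volume) : ‖hf.toLp f‖^2 = ∫ x, ‖f x‖^2 := by
  have h1 := inner_self_eq_norm_sq_to_K (𝕜 := ℂ) (hf.toLp f)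
  rw [l2_inner hf hf] at h1
  have h2 : ∫ x, star (f x) * f x = ((∫ x, ‖f x‖^2 : ℝ) : ℂ) := by
    rw [← integral_complex_ofReal]
    congr 1; ext x
    have := Complex.conj_mul' (f x)
    rw [Complex.star_def, this]; push_cast; rfl
  rw [h2] at h1
  exact Complex.ofReal_injective (by push_cast; exact h1.symm)

/-- build an element of `L2f` -/
def mkf {n : ℕ} {f : Fin n → CSp n → ℂ} (hf : ∀ j, MemLp (f j) 2 volume) : L2f n :=
  WithLp.toLp 2 (fun j => (hf j).toLp (f j))

lemma mkf_inner {n : ℕ} {f g : Fin n → CSp n → ℂ} (hf : ∀ j, MemLp (f j) 2 volume) (hg : ∀ j, MemLp (g j) 2 volume) :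
    inner ℂ (mkf hf) (mkf hg) = ∑ j, ∫ x, star (f j x) * g j x := by
  rw [PiLp.inner_apply]
  exact Finset.sum_congr rfl fun j _ => l2_inner (hf j) (hg j)

lemma mkf_norm {n : ℕ} {f : Fin n → CSp n → ℂ} (hf : ∀ j, MemLp (f j) 2 volume) :
    ‖mkf hf‖^2 = ∑ j, ∫ x, ‖f j x‖^2 := by
  rw [PiLp.norm_sq_eq_of_L2]
  exact Finset.sum_congr rfl fun j _ => l2_norm (hf j)

lemma mkf_coe {n : ℕ} (k : L2f n) : mkf (f := fun j => (k j : CSp n → ℂ)) (fun j => Lp.memLp (k j)) = k := by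
  ext j : 1
  exact Lp.toLp_coeFn (k j) (Lp.memLp (k j))

/-- the closed forms condition, for functions -/
def ClosedF {n : ℕ} (Ω : Set (CSp n)) (P : CSp n → ℝ) (C : ℝ) (k : Fin n → CSp n → ℂ) : Prop :=
  ∀ θ, Tst 2 Ω θ → ∀ i j, ∫ x, (k j x * (((al P C x)⁻¹ : ℝ) * dzb i θ x) - k i x * (((al P C x)⁻¹ : ℝ) * dzb j θ x)) = 0

lemma ai_dz_tst {n : ℕ} {Ω : Set (CSp n)} {P : CSp n → ℝ} {C : ℝ} (h : Wgt Ω P C) {θ : CSp n → ℂ} (hθ : Tst 2 Ω θ)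
    (s : ℂ) (i : Fin n) : Tst 0 Ω (fun x => (((al P C x)⁻¹ : ℝ) : ℂ) * dw s i θ x) := by
  have h1 : Tst 0 Ω (dw s i θ) := (Tst.dw (k := 1) hθ s i).mono (by norm_num)
  have h2 : ContDiffOn ℝ (0:ℕ) (cx fun x => (al P C x)⁻¹) Ω := h.ai_smooth.of_le (by norm_num)
  have := h1.contDiff_mul h.isOpen h2
  simpa only [mul_comm, cx] using this

lemma al_dz_tst {n : ℕ} {Ω : Set (CSp n)} {P : CSp n → ℝ} {C : ℝ} (h : Wgt Ω P C) {θ : CSp n → ℂ} (hθ : Tst 2 Ω θ)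
    (s : ℂ) (i : Fin n) : Tst 0 Ω (fun x => (al P C x : ℂ) * dw s i θ x) := by
  have h1 : Tst 0 Ω (dw s i θ) := (Tst.dw (k := 1) hθ s i).mono (by norm_num)
  have h2 : ContDiffOn ℝ (0:ℕ) (cx (al P C)) Ω := (cx_contDiffOn (k := 2) h.al_smooth).of_le (by norm_num)
  have := h1.contDiff_mul h.isOpen h2
  simpa only [mul_comm, cx] using this

/-- generators of the orthogonal complement of the closed forms -/
def sgen {n : ℕ} (Ω : Set (CSp n)) (P : CSp n → ℝ) (C : ℝ) : Set (L2f n) :=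
  {s | ∃ (θ : CSp n → ℂ) (_ : Tst 2 Ω θ) (i j : Fin n) (hf : ∀ l, MemLp (fun x => 
    (if l = j then star ((((al P C x)⁻¹ : ℝ) : ℂ) * dzb i θ x) else 0)
      - (if l = i then star ((((al P C x)⁻¹ : ℝ) : ℂ) * dzb j θ x) else 0)) 2 volume), s = mkf hf}

lemma sgen_inner {n : ℕ} {Ω : Set (CSp n)} {P : CSp n → ℝ} {C : ℝ} (h : Wgt Ω P C) {θ : CSp n → ℂ} (hθ : Tst 2 Ω θ)
    (i j : Fin n) {k : Fin n → CSp n → ℂ} (hk : ∀ j, MemLp (k j) 2 volume) :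
    (∑ l, ∫ x, star ((if l = j then star ((((al P C x)⁻¹ : ℝ) : ℂ) * dzb i θ x) else 0)
      - (if l = i then star ((((al P C x)⁻¹ : ℝ) : ℂ) * dzb j θ x) else 0)) * k l x)
    = ∫ x, (k j x * (((al P C x)⁻¹ : ℝ) * dzb i θ x) - k i x * (((al P C x)⁻¹ : ℝ) * dzb j θ x)) := by
  have i1 : ∀ i j, Integrable (fun x => k j x * ((((al P C x)⁻¹ : ℝ) : ℂ) * dzb i θ x)) := fun i j =>
    tst_int_mul (hk j) (ai_dz_tst h hθ _ i)
  have e : ∀ l x, star ((if l = j then star ((((al P C x)⁻¹ : ℝ) : ℂ) * dzb i θ x) else 0)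
      - (if l = i then star ((((al P C x)⁻¹ : ℝ) : ℂ) * dzb j θ x) else 0)) * k l x
      = (if l = j then k l x * ((((al P C x)⁻¹ : ℝ) : ℂ) * dzb i θ x) else 0)
        - (if l = i then k l x * ((((al P C x)⁻¹ : ℝ) : ℂ) * dzb j θ x) else 0) := by
    intro l x
    rw [star_sub]
    split_ifs <;> simp only [star_star, star_zero] <;> ring
  simp_rw [e]
  have i2 : ∀ l i j, Integrable (fun x => if l = j then k l x * ((((al P C x)⁻¹ : ℝ) : ℂ) * dzb i θ x) else 0) := by
    intro l i j
    split_ifs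
    · exact i1 i l
    · simp
  rw [← integral_finsetSum _ fun l _ => (i2 l i j).sub' (i2 l j i)]
  congr 1; ext x
  simp [Finset.sum_sub_distrib]

lemma mem_sgen_orth {n : ℕ} {Ω : Set (CSp n)} {P : CSp n → ℝ} {C : ℝ} (h : Wgt Ω P C) {k : Fin n → CSp n → ℂ}
    (hk : ∀ j, MemLp (k j) 2 volume) :
    mkf hk ∈ (Submodule.span ℂ (sgen Ω P C))ᗮ ↔ ClosedF Ω P C k := by
  rw [Submodule.mem_orthogonal]
  constructor
  · intro H θ hθ i j
    have hf : ∀ l, MemLp (fun x => 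
      (if l = j then star ((((al P C x)⁻¹ : ℝ) : ℂ) * dzb i θ x) else 0)
      - (if l = i then star ((((al P C x)⁻¹ : ℝ) : ℂ) * dzb j θ x) else 0)) 2 volume := by
      intro l
      refine MemLp.sub ?_ ?_
      · split_ifs
        · exact tst_memLp (ai_dz_tst h hθ _ i).starf
        · exact MemLp.zero
      · split_ifs
        · exact tst_memLp (ai_dz_tst h hθ _ j).starf
        · exact MemLp.zero
    have := H (mkf hf) (Submodule.subset_span ⟨θ, hθ, i, j, hf, rfl⟩)
    rw [mkf_inner] at this
    rw [← sgen_inner h hθ i j hk]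
    exact this
  · intro H u hu
    induction hu using Submodule.span_induction with
    | mem x hx =>
      obtain ⟨θ, hθ, i, j, hf, rfl⟩ := hx
      rw [mkf_inner, sgen_inner h hθ i j hk]
      exact H θ hθ i j
    | zero => simp
    | add x y _ _ hx hy => rw [inner_add_left, hx, hy, add_zero]
    | smul a x _ hx => rw [inner_smul_left, hx, mul_zero]

/-- `α ∂̄θ` is closed -/
lemma closed_dbar {n : ℕ} {Ω : Set (CSp n)} {P : CSp n → ℝ} {C : ℝ} (h : Wgt Ω P C) {u : CSp n → ℂ}
    (hu : ContDiffOn ℝ 2 u Ω) {w : Fin n → CSp n → ℂ} (hw : ∀ j, ∀ x ∈ Ω, w j x = al P C x * dzb j u x) :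
    ClosedF Ω P C w := by
  intro θ hθ i j
  have hdθ : ∀ i, Tst 1 Ω (dzb i θ) := fun i => Tst.dw (k := 1) hθ _ i
  have hdu : ∀ i, ContDiffOn ℝ (1:ℕ) (dzb i u) Ω := fun i => dw_contDiffOn (k := 1) h.isOpen _ i hu
  have hu1 : ContDiffOn ℝ 1 u Ω := hu.of_le (by norm_num)
  have e : ∀ i j x, w j x * (((al P C x)⁻¹ : ℝ) * dzb i θ x) = dzb i θ x * dzb j u x := by
    intro i j x
    by_cases hx : x ∈ Ω
    · have : (al P C x : ℂ) ≠ 0 := by exact_mod_cast (h.al_pos hx).ne'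
      rw [hw j x hx]; push_cast; field_simp
    · rw [(hdθ i).off hx]; simp
  simp_rw [e]
  have i1 : ∀ i j, Integrable (fun x => dzb i θ x * dzb j u x) := fun i j =>
    ((hdθ i).contDiff_mul h.isOpen (hdu j)).integrable
  rw [integral_sub (i1 i j) (i1 j i)]
  have i2 := fun i j => ibp h.isOpen (hdθ i) hu1 Complex.I j
  unfold dzb at i2 ⊢
  rw [i2, i2]
  have : ∀ x, dw Complex.I j (dw Complex.I i θ) x = dw Complex.I i (dw Complex.I j θ) x := fun x =>
    dw_comm _ _ _ _ hθ.1.contDiffAt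
  have e3 : ∀ i, (fun x => dw Complex.I i θ x) = dw Complex.I i θ := fun i => rfl
  simp only [e3, this, sub_self]

lemma proj_ex {E : Type*} [NormedAddCommGroup E] [InnerProductSpace ℂ E] [CompleteSpace E] (S : Set E) (v : E) :
    ∃ k ∈ (Submodule.span ℂ S)ᗮ, ∀ u ∈ (Submodule.span ℂ S)ᗮ, inner ℂ u v = inner ℂ u k := by
  set K := (Submodule.span ℂ S)ᗮ with hKdef
  refine ⟨K.starProjection v, Submodule.starProjection_apply_mem _ _, fun u hu => ?_⟩
  have := K.sub_starProjection_mem_orthogonal v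
  have h2 := (Submodule.mem_orthogonal _ _).1 this u hu
  rw [inner_sub_right, sub_eq_zero] at h2
  exact h2

/-- the duality inequality -/
lemma dual_est {n : ℕ} {Ω : Set (CSp n)} {P : CSp n → ℝ} {C : ℝ} (h : Wgt Ω P C) {v w : Fin n → CSp n → ℂ}
    {g : CSp n → ℂ} (hv : ∀ j, MemLp (v j) 2 volume) (hw : ∀ j, MemLp (w j) 2 volume) (hg : MemLp g 2 volume)
    (hwΩ : ∀ j, ∀ x ∉ Ω, w j x = 0) (hwc : ClosedF Ω P C w)
    (hT : ∀ θ, Tst 2 Ω θ → ∑ j, ∫ x, v j x * (al P C x * dz j θ x) = ∫ x, g x * (al P C x * P x ^ 2 * θ x)) :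
    ‖∑ j, ∫ x, star (w j x) * v j x‖ ≤ √(∑ j, ∫ x, ‖w j x‖^2) * √(∫ x, ‖g x‖^2) := by
  set K := (Submodule.span ℂ (sgen Ω P C))ᗮ with hKdef
  obtain ⟨k, hkK, hort⟩ := proj_ex (sgen Ω P C) (mkf hv)
  set kf : Fin n → CSp n → ℂ := fun j => (k j : CSp n → ℂ) with hkf
  have hkm : ∀ j, MemLp (kf j) 2 volume := fun j => Lp.memLp (k j)
  have hkk : mkf hkm = k := mkf_coe k
  have hkc : ClosedF Ω P C kf := by
    rw [← mem_sgen_orth h hkm, hkk]; exact hkK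
  have hkT : ∀ θ, Tst 2 Ω θ → ∑ j, ∫ x, kf j x * (al P C x * dz j θ x) = ∫ x, g x * (al P C x * P x ^ 2 * θ x) := by
    intro θ hθ
    rw [← hT θ hθ]
    have hAm : ∀ j, MemLp (fun x => star ((al P C x : ℂ) * dz j θ x)) 2 volume := fun j =>
      tst_memLp (al_dz_tst h hθ _ j).starf
    have hA : mkf hAm ∈ K := by
      rw [mem_sgen_orth h hAm]
      refine closed_dbar h (u := fun x => star (θ x)) hθ.starf.1.contDiffOn fun j x hx => ?_
      rw [dzb, dw_star _ _ (hθ.1.differentiable (by norm_num) x), dz]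
      simp
    have := hort _ hA
    rw [← hkk, mkf_inner, mkf_inner] at this
    simp only [star_star] at this
    simp_rw [mul_comm (kf _ _), mul_comm (v _ _)]
    exact this.symm
  have hmain := main_est h hkm hg hkc hkT
  have hW : mkf hw ∈ K := by rw [mem_sgen_orth h hw]; exact hwc
  have h1 := hort _ hW
  rw [mkf_inner] at h1
  have hk'm : ∀ j, MemLp (Ω.indicator (kf j)) 2 volume := fun j => (hkm j).indicator h.isOpen.measurableSet
  have h2 : inner ℂ (mkf hw) k = inner ℂ (mkf hw) (mkf hk'm) := by
    rw [← hkk, mkf_inner, mkf_inner]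
    refine Finset.sum_congr rfl fun j _ => ?_
    congr 1; ext x
    by_cases hx : x ∈ Ω
    · simp [hx]
    · simp [hwΩ j x hx]
  rw [h1, h2]
  refine (norm_inner_le_norm _ _).trans ?_
  have h3 : ‖mkf hk'm‖^2 ≤ ∫ x, ‖g x‖^2 := by
    rw [mkf_norm]
    refine le_trans (le_of_eq ?_) hmain
    refine Finset.sum_congr rfl fun j _ => ?_
    rw [← integral_indicator h.isOpen.measurableSet]
    congr 1; ext x
    by_cases hx : x ∈ Ω <;> simp [hx]
  rw [← mkf_norm hw, Real.sqrt_sq (norm_nonneg _)]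
  gcongr
  exact Real.le_sqrt_of_sq_le h3

open MeasureTheory

/-- the formal adjoint on test forms -/
def tvf {n : ℕ} (P : CSp n → ℝ) (C : ℝ) (v : Fin n → CSp n → ℂ) (x : CSp n) : ℂ :=
  - ∑ j, dz j (fun y => v j y * cx (al P C) y) x * (((al P C x)⁻¹ * (P x ^ 2)⁻¹ : ℝ) : ℂ)

lemma Wgt.alc {n : ℕ} {Ω : Set (CSp n)} {P : CSp n → ℝ} {C : ℝ} (h : Wgt Ω P C) :
    ContDiffOn ℝ (2:ℕ) (cx (al P C)) Ω := cx_contDiffOn (k := 2) h.al_smooth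

lemma Wgt.apc {n : ℕ} {Ω : Set (CSp n)} {P : CSp n → ℝ} {C : ℝ} (h : Wgt Ω P C) :
    ContDiffOn ℝ (2:ℕ) (cx fun x => (al P C x)⁻¹ * (P x ^ 2)⁻¹) Ω := 
  cx_contDiffOn (k := 2) ((h.al_smooth.inv fun _ hx => (h.al_pos hx).ne').mul
    ((h.smooth.pow 2).inv fun _ hx => pow_ne_zero 2 (h.pos hx).ne'))

lemma tvf_tst {n : ℕ} {Ω : Set (CSp n)} {P : CSp n → ℝ} {C : ℝ} (h : Wgt Ω P C) {v : Fin n → CSp n → ℂ}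
    (hv : ∀ j, Tst 2 Ω (v j)) : Tst 0 Ω (tvf P C v) := by
  have h1 : Tst 0 Ω (fun x => ∑ j, dz j (fun y => v j y * cx (al P C) y) x * cx (fun x => (al P C x)⁻¹ * (P x ^ 2)⁻¹) x) := by
    refine Tst.sumf _ fun j _ => ?_
    refine Tst.contDiff_mul h.isOpen ?_ (h.apc.of_le (by norm_num))
    exact (Tst.dw (k := 1) ((hv j).contDiff_mul h.isOpen h.alc) _ j).mono (by norm_num)
  have h2 := (Tst.zerof (k := 0) (Ω := Ω)).subf h1
  simp only [zero_sub] at h2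
  exact h2

lemma tvf_pair {n : ℕ} {Ω : Set (CSp n)} {P : CSp n → ℝ} {C : ℝ} (h : Wgt Ω P C) {v : Fin n → CSp n → ℂ}
    (hv : ∀ j, Tst 2 Ω (v j)) {g : CSp n → ℂ} (hg : ContDiffOn ℝ 1 g Ω) :
    ∫ x, tvf P C v x * (al P C x * P x ^ 2 * g x) = ∑ j, ∫ x, v j x * (al P C x * dz j g x) := by
  have hva : ∀ j, Tst 2 Ω (fun y => v j y * cx (al P C) y) := fun j => (hv j).contDiff_mul h.isOpen h.alc
  have e : ∀ x, tvf P C v x * (al P C x * P x ^ 2 * g x) = ∑ j, - (dz j (fun y => v j y * cx (al P C) y) x * g x) := by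
    intro x
    by_cases hx : x ∈ Ω
    · have h1 : (al P C x : ℂ) ≠ 0 := by exact_mod_cast (h.al_pos hx).ne'
      have h2 : (P x : ℂ) ≠ 0 := by exact_mod_cast (h.pos hx).ne'
      rw [tvf, neg_mul, Finset.sum_mul, ← Finset.sum_neg_distrib]
      refine Finset.sum_congr rfl fun j _ => ?_
      push_cast
      field_simp
    · rw [(tvf_tst h hv).off hx, zero_mul]
      symm
      refine Finset.sum_eq_zero fun j _ => ?_
      rw [dz, dw_off (hva j) _ j hx]; simp
  simp_rw [e]
  have i1 : ∀ j, Integrable (fun x => dz j (fun y => v j y * cx (al P C) y) x * g x) := fun j =>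
    ((Tst.dw (k := 1) (hva j) _ j).contDiff_mul h.isOpen hg).integrable
  rw [integral_finsetSum _ fun j _ => (i1 j).fun_neg]
  refine Finset.sum_congr rfl fun j _ => ?_
  rw [integral_neg]
  have := ibp h.isOpen ((hva j).mono (by norm_num)) hg (-Complex.I) j
  unfold dz
  rw [← this]
  congr 1; ext x
  simp only [cx]; ring

/-- images of test forms -/
def tsub {n : ℕ} {Ω : Set (CSp n)} {P : CSp n → ℝ} {C : ℝ} (h : Wgt Ω P C) : Submodule ℂ (L2s n) where
  carrier := {g | ∃ (v : Fin n → CSp n → ℂ) (hv : ∀ j, Tst 2 Ω (v j)), g = (tst_memLp (tvf_tst h hv)).toLp}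
  add_mem' := by
    rintro _ _ ⟨v, hv, rfl⟩ ⟨w, hw, rfl⟩
    refine ⟨fun j x => v j x + w j x, fun j => (hv j).addf (hw j), ?_⟩
    rw [← MemLp.toLp_add]
    congr 1
    ext x
    have hva : ∀ {v : Fin n → CSp n → ℂ}, (∀ j, Tst 2 Ω (v j)) → ∀ j, DifferentiableAt ℝ (fun y => v j y * cx (al P C) y) x :=
      fun hv j => ((hv j).contDiff_mul h.isOpen h.alc).1.differentiable (by norm_num) x
    simp only [tvf, Pi.add_apply, dz]
    rw [← neg_add, ← Finset.sum_add_distrib]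
    congr 1
    refine Finset.sum_congr rfl fun j _ => ?_
    simp only [add_mul (v j _)]
    rw [dw_add _ _ (hva hv j) (hva hw j), add_mul]
  zero_mem' := by
    refine ⟨fun _ _ => 0, fun j => Tst.zerof, ?_⟩
    rw [← MemLp.toLp_zero]
    congr 1
    ext x
    simp [tvf, dz, dw]
    exact MemLp.zero
  smul_mem' := by
    rintro c _ ⟨v, hv, rfl⟩
    have hc : ∀ j, Tst 2 Ω (fun x => v j x * c) := fun j => (hv j).contDiff_mul h.isOpen contDiffOn_const
    refine ⟨fun j x => v j x * c, hc, ?_⟩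
    rw [← MemLp.toLp_const_smul]
    congr 1
    ext x
    have hva : ∀ j, DifferentiableAt ℝ (fun y => v j y * cx (al P C) y) x :=
      fun j => ((hv j).contDiff_mul h.isOpen h.alc).1.differentiable (by norm_num) x
    simp only [tvf, Pi.smul_apply, dz, smul_eq_mul]
    rw [mul_neg, Finset.mul_sum]
    congr 1
    refine Finset.sum_congr rfl fun j _ => ?_
    have e : (fun y => v j y * c * cx (al P C) y) = fun y => (fun _ => c) y * (v j y * cx (al P C) y) := by
      ext y; ring
    rw [e, dw_mul _ _ (differentiableAt_const c) (hva j)]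
    have : dw (-Complex.I) j (fun _ : CSp n => c) x = 0 := by simp [dw]
    rw [this]; ring

lemma proj_closure {E : Type*} [NormedAddCommGroup E] [InnerProductSpace ℂ E] [CompleteSpace E] (T : Submodule ℂ E) (f : E)
    {M : ℝ} (hM0 : 0 ≤ M) (hM : ∀ x ∈ T, ‖inner ℂ f x‖ ≤ M * ‖x‖) :
    ∃ u : E, ‖u‖ ≤ M ∧ ∀ x ∈ T, inner ℂ (f - u) x = 0 := by
  set K := T.topologicalClosure with hK
  haveI : CompleteSpace K := T.isClosed_topologicalClosure.completeSpace_coe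
  have hM' : ∀ x ∈ K, ‖inner ℂ f x‖ ≤ M * ‖x‖ := by
    intro x hx
    have hcl : IsClosed {x : E | ‖inner ℂ f x‖ ≤ M * ‖x‖} := isClosed_le (by fun_prop) (by fun_prop)
    exact closure_minimal (s := (T : Set E)) hM hcl hx
  have horth : ∀ x ∈ K, inner ℂ (f - K.starProjection f) x = 0 := fun x hx =>
    (Submodule.mem_orthogonal' _ _).1 (K.sub_starProjection_mem_orthogonal f) x hx
  have hmem : K.starProjection f ∈ K := Submodule.starProjection_apply_mem _ _
  refine ⟨K.starProjection f, ?_, fun x hx => horth x (T.le_topologicalClosure hx)⟩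
  have h1 := horth _ hmem
  rw [inner_sub_left, sub_eq_zero] at h1
  have h2 := hM' _ hmem
  rw [h1, inner_self_eq_norm_sq_to_K] at h2
  rw [norm_pow] at h2
  simp only [RCLike.norm_ofReal, abs_norm] at h2
  by_cases h0 : ‖K.starProjection f‖ = 0
  · rw [h0]; exact hM0
  · have : 0 < ‖K.starProjection f‖ := lt_of_le_of_ne (norm_nonneg _) (Ne.symm h0)
    nlinarith

open MeasureTheory

lemma ind_memLp {n : ℕ} {Ω : Set (CSp n)} (hΩ : IsOpen Ω) (hb : Bornology.IsBounded Ω) {f : CSp n → ℂ}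
    (hf : ContinuousOn f Ω) {M : ℝ} (hM : ∀ x ∈ Ω, ‖f x‖ ≤ M) : MemLp (Ω.indicator f) 2 volume := by
  rw [memLp_indicator_iff_restrict hΩ.measurableSet]
  haveI : IsFiniteMeasure (volume.restrict Ω) := ⟨by
    rw [Measure.restrict_apply_univ]; exact hb.measure_lt_top⟩
  refine MemLp.of_bound (hf.aestronglyMeasurable hΩ.measurableSet) M ?_
  exact (ae_restrict_iff' hΩ.measurableSet).2 (Eventually.of_forall hM)

lemma ind_int_le {n : ℕ} {Ω : Set (CSp n)} (hΩ : IsOpen Ω) (hb : Bornology.IsBounded Ω) {f : CSp n → ℂ}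
    {M : ℝ} (hM : ∀ x ∈ Ω, ‖f x‖ ≤ M) :
    ∫ x, ‖Ω.indicator f x‖^2 ≤ M^2 * volume.real Ω := by
  have e : (fun x => ‖Ω.indicator f x‖^2) = Ω.indicator (fun x => ‖f x‖^2) := by
    ext x; by_cases hx : x ∈ Ω <;> simp [hx]
  rw [e, integral_indicator hΩ.measurableSet]
  have := norm_setIntegral_le_of_norm_le_const (μ := volume) (s := Ω) (f := fun x => ‖f x‖^2) (C := M^2) hb.measure_lt_top
    (fun x hx => by
      rw [Real.norm_eq_abs, abs_of_nonneg (by positivity)]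
      exact pow_le_pow_left₀ (norm_nonneg _) (hM x hx) 2)
  exact (le_abs_self _).trans this

lemma Wgt.exp_le {n : ℕ} {Ω : Set (CSp n)} {P : CSp n → ℝ} {C : ℝ} (h : Wgt Ω P C) {x : CSp n} (hx : x ∈ Ω) :
    al P C x * P x ^ 2 ≤ 2 / KK C := by
  have hP := h.one_le x hx
  have hK := KK_pos C
  have hphi : 0 < phi P C x / 2 := by unfold phi; positivity
  have h1 : Real.exp (-phi P C x / 2) ≤ (phi P C x / 2)⁻¹ := by
    rw [neg_div, Real.exp_neg]
    exact inv_anti₀ hphi ((le_add_of_nonneg_right zero_le_one).trans (Real.add_one_le_exp _))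
  unfold al
  calc Real.exp (-phi P C x / 2) * P x ^ 2 * P x ^ 2 ≤ (phi P C x / 2)⁻¹ * P x ^ 2 * P x ^ 2 := by gcongr
    _ = 2 / KK C * (P x)⁻¹ := by unfold phi; field_simp
    _ ≤ 2 / KK C * 1 := by
      gcongr; exact inv_le_one_of_one_le₀ hP
    _ = 2 / KK C := mul_one _

lemma Wgt.al_le {n : ℕ} {Ω : Set (CSp n)} {P : CSp n → ℝ} {C : ℝ} (h : Wgt Ω P C) {x : CSp n} (hx : x ∈ Ω) :
    al P C x ≤ 2 / KK C := by
  refine le_trans ?_ (h.exp_le hx)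
  have := h.one_le x hx
  exact le_mul_of_one_le_right (h.al_pos hx).le (one_le_pow₀ this)

lemma solve {n : ℕ} {Ω : Set (CSp n)} {P : CSp n → ℝ} {C : ℝ} (h : Wgt Ω P C) {u : CSp n → ℂ}
    (hu : ContDiffOn ℝ 2 u Ω) {B ε : ℝ} (hB : ∀ x ∈ Ω, ‖u x‖ ≤ B)
    (hε : ∀ x ∈ Ω, ∀ j, ‖dzb j u x‖ ≤ ε) :
    ∃ e : CSp n → ℂ, MemLp e 2 volume ∧ ∫ x, ‖e x‖^2 ≤ n * ((2 / KK C * ε)^2 * volume.real Ω) ∧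
      ∀ θ, Tst 2 Ω θ → ∀ j, ∫ x, (u x - e x / (al P C x * P x ^ 2)) * dzb j θ x = 0 := by
  have hK := KK_pos C
  set hf : CSp n → ℂ := Ω.indicator (fun x => (al P C x : ℂ) * P x ^ 2 * u x) with hhf
  set w : Fin n → CSp n → ℂ := fun j => Ω.indicator (fun x => (al P C x : ℂ) * dzb j u x) with hw
  have c1 : ContinuousOn (fun x => (al P C x : ℂ)) Ω := h.alc.continuousOn
  have c2 : ContinuousOn (fun x => (P x : ℂ)) Ω := (cx_contDiffOn (k := 2) h.smooth).continuousOn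
  have bw : ∀ j, ∀ x ∈ Ω, ‖(al P C x : ℂ) * dzb j u x‖ ≤ 2 / KK C * ε := fun j x hx => by
    rw [norm_mul, Complex.norm_real, Real.norm_eq_abs, abs_of_pos (h.al_pos hx)]
    exact mul_le_mul (h.al_le hx) (hε x hx j) (norm_nonneg _) (by positivity)
  have hfm : MemLp hf 2 volume := by
    refine ind_memLp h.isOpen h.bdd ((c1.mul (c2.pow 2)).mul hu.continuousOn) (M := 2 / KK C * B) fun x hx => ?_
    rw [norm_mul]
    refine mul_le_mul ?_ (hB x hx) (norm_nonneg _) (by positivity)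
    have : ((al P C x : ℂ) * P x ^ 2) = ((al P C x * P x ^ 2 : ℝ) : ℂ) := by push_cast; rfl
    have h3 := h.al_pos hx
    rw [this, Complex.norm_real, Real.norm_eq_abs, abs_of_nonneg (by positivity)]
    exact h.exp_le hx
  have hwm : ∀ j, MemLp (w j) 2 volume := fun j => by
    refine ind_memLp h.isOpen h.bdd (c1.mul ?_) (bw j)
    exact (dw_contDiffOn (k := 1) h.isOpen _ j hu).continuousOn
  have hwΩ : ∀ j, ∀ x ∉ Ω, w j x = 0 := fun j x hx => by simp [hw, hx]
  have hwc : ClosedF Ω P C w := closed_dbar h hu fun j x hx => by simp [hw, hx]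
  set M := √(∑ j, ∫ x, ‖w j x‖^2) with hM
  have hM0 : 0 ≤ M := Real.sqrt_nonneg _
  have hM2 : M^2 ≤ n * ((2 / KK C * ε)^2 * volume.real Ω) := by
    rw [hM, Real.sq_sqrt (Finset.sum_nonneg fun j _ => integral_nonneg fun x => by positivity)]
    calc ∑ j, ∫ x, ‖w j x‖^2 ≤ ∑ j : Fin n, (2 / KK C * ε)^2 * volume.real Ω :=
          Finset.sum_le_sum fun j _ => ind_int_le h.isOpen h.bdd (bw j)
      _ = _ := by simp
  obtain ⟨e, he, hort⟩ := proj_closure (tsub h) (hfm.toLp hf) hM0 (by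
    rintro _ ⟨v, hv, rfl⟩
    have hvm : ∀ j, MemLp (v j) 2 volume := fun j => tst_memLp ((hv j).mono (by norm_num))
    have hd := dual_est h hvm hwm (tst_memLp (tvf_tst h hv)) hwΩ hwc
      (fun θ hθ => (tvf_pair h hv (hθ.1.contDiffOn.of_le (by norm_num))).symm)
    rw [← l2_norm (tst_memLp (tvf_tst h hv)), Real.sqrt_sq (norm_nonneg _)] at hd
    refine le_trans (le_of_eq ?_) hd
    congr 1
    rw [l2_inner]
    have e1 := tvf_pair h hv (g := fun x => star (u x)) (by
      have : ContDiffOn ℝ 1 u Ω := hu.of_le (by norm_num)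
      exact (starL' ℝ : ℂ ≃L[ℝ] ℂ).contDiff.comp_contDiffOn this)
    trans ∫ x, tvf P C v x * (al P C x * P x ^ 2 * star (u x))
    · congr 1; ext x
      by_cases hx : x ∈ Ω
      · simp only [hhf, indicator_of_mem hx]; simp; ring
      · rw [(tvf_tst h hv).off hx]; simp
    · rw [e1]
      refine Finset.sum_congr rfl fun j _ => ?_
      congr 1; ext x
      by_cases hx : x ∈ Ω
      · simp only [hw, indicator_of_mem hx, dz]
        rw [dw_star _ _ ((hu.contDiffAt (h.isOpen.mem_nhds hx)).differentiableAt (by norm_num))]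
        simp [dzb]; ring
      · rw [(hv j).off hx]; simp)
  have hem : MemLp (e : CSp n → ℂ) 2 volume := Lp.memLp e
  have hee : hem.toLp = e := Lp.toLp_coeFn e hem
  refine ⟨e, hem, ?_, ?_⟩
  · rw [← l2_norm hem, hee]
    exact (pow_le_pow_left₀ (norm_nonneg _) he 2).trans hM2
  · intro θ hθ j
    set v : Fin n → CSp n → ℂ := fun i x => if i = j then star (θ x) * cx (fun x => (al P C x)⁻¹) x else 0 with hv
    have hvt : ∀ i, Tst 2 Ω (v i) := by
      intro i
      by_cases hi : i = j
      · simp only [hv, hi, if_true]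
        exact hθ.starf.contDiff_mul h.isOpen h.ai_smooth
      · simp only [hv, hi, if_false]; exact Tst.zerof
    have h1 := hort _ ⟨v, hvt, rfl⟩
    rw [← hee, ← MemLp.toLp_sub hfm hem, l2_inner] at h1
    have h2 : ∀ x, star ((hf - e) x) * tvf P C v x = - star ((u x - e x / (al P C x * P x ^ 2)) * dzb j θ x) := by
      intro x
      by_cases hx : x ∈ Ω
      · have a0 : (al P C x : ℂ) ≠ 0 := by exact_mod_cast (h.al_pos hx).ne'
        have p0 : (P x : ℂ) ≠ 0 := by exact_mod_cast (h.pos hx).ne'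
        have h3 : tvf P C v x = - (star (dzb j θ x) * (((al P C x)⁻¹ * (P x ^ 2)⁻¹ : ℝ) : ℂ)) := by
          unfold tvf
          congr 1
          rw [Finset.sum_eq_single j]
          · congr 1
            have : star (dzb j θ x) = dz j (fun y => star (θ y)) x := by
              rw [dz, dw_star _ _ (hθ.1.differentiable (by norm_num) x)]; simp [dzb]
            rw [this]
            refine dw_congr _ _ ?_
            filter_upwards [h.isOpen.mem_nhds hx] with y hy
            have a0 : (al P C y : ℂ) ≠ 0 := by exact_mod_cast (h.al_pos hy).ne'
            simp only [hv, if_true, cx]; push_cast; field_simp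
          · intro i _ hi
            simp [hv, hi, dz, dw]
          · simp
        rw [h3]
        simp only [Pi.sub_apply, hhf, indicator_of_mem hx]
        simp
        field_simp
      · rw [(tvf_tst h hvt).off hx, dzb, dw_off hθ _ _ hx]; simp
    simp_rw [h2] at h1
    rw [integral_neg, neg_eq_zero] at h1
    have h4 := congrArg star h1
    rw [star_zero] at h4
    have h5 : ∫ x, star ((u x - e x / (al P C x * P x ^ 2)) * dzb j θ x) = star (∫ x, (u x - e x / (al P C x * P x ^ 2)) * dzb j θ x) :=
      integral_conj
    rw [h5, star_star] at h4
    exact h4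

open MeasureTheory

/-- rotation by a unit complex number -/
def rotE {n : ℕ} (c : ℂ) (hc : ‖c‖ = 1) : CSp n ≃ₗᵢ[ℝ] CSp n where
  toFun y := c • y
  invFun y := c⁻¹ • y
  map_add' x y := smul_add c x y
  map_smul' r x := smul_comm c r x
  left_inv y := inv_smul_smul₀ (by rintro rfl; simp at hc) y
  right_inv y := smul_inv_smul₀ (by rintro rfl; simp at hc) y
  norm_map' y := by
    change ‖c • y‖ = ‖y‖
    rw [norm_smul, hc, one_mul]

lemma integral_rot {n : ℕ} {c : ℂ} (hc : ‖c‖ = 1) (g : CSp n → ℂ) : ∫ y, g (c • y) = ∫ y, g y := by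
  have := (LinearIsometryEquiv.measurePreserving (rotE (n := n) c hc)).integral_comp
    (rotE (n := n) c hc).toHomeomorph.measurableEmbedding g
  exact this

/-- vanishing `∂̄` implies holomorphic -/
lemma holo_of_dzb {n : ℕ} {f : CSp n → ℂ} {x : CSp n} (hf : DifferentiableAt ℝ f x) (h : ∀ j, dzb j f x = 0) :
    DifferentiableAt ℂ f x := by
  rw [differentiableAt_iff_restrictScalars ℝ hf]
  set L := fderiv ℝ f x with hL
  have hj : ∀ j, L (Complex.I • ee j) = Complex.I * L (ee j) := by
    intro j
    have := h j
    simp only [dzb, dw, ← hL] at this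
    have h2 : L (ee j) + Complex.I * L (Complex.I • ee j) = 0 := by linear_combination 2 * this
    linear_combination (-Complex.I) * h2 + (L (Complex.I • ee j)) * Complex.I_sq
  have hI : ∀ v, L (Complex.I • v) = Complex.I * L v := by
    intro v
    have h1 : L v = ∑ j, ((v j).re * L (ee j) + (v j).im * L (Complex.I • ee j)) := by
      conv_lhs => rw [vec_expand v]
      simp
    have h2 : L (Complex.I • v) = ∑ j, (-(v j).im * L (ee j) + (v j).re * L (Complex.I • ee j)) := by
      conv_lhs => rw [vec_expand_I v]
      simp
    rw [h1, h2, Finset.mul_sum]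
    refine Finset.sum_congr rfl fun j _ => ?_
    rw [hj]
    linear_combination (-((v j).im : ℂ) * L (ee j)) * Complex.I_sq
  refine ⟨⟨⟨L.toLinearMap.toAddHom, ?_⟩, L.cont⟩, ?_⟩
  · intro c v
    change L (c • v) = c * L v
    conv_lhs => rw [← Complex.re_add_im c, add_smul, mul_comm, mul_smul]
    rw [map_add, hI]
    have hr : ∀ (r : ℝ) (w : CSp n), L ((r : ℂ) • w) = r * L w := by
      intro r w
      have := L.map_smul r w
      rw [Complex.real_smul] at this
      rw [← this]; rfl
    rw [hr, hr]
    conv_rhs => rw [← Complex.re_add_im c]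
    ring
  · ext v; rfl

/-- a version with the smooth radial kernel of the mean value property -/
lemma mean_value {n : ℕ} {f : CSp n → ℂ} {U : Set (CSp n)} (hU : IsOpen U) (hf : DifferentiableOn ℂ f U) {z : CSp n} {σ : ℝ}
    (hσ : 0 < σ) (hz : closedBall z σ ⊆ U) : mol σ f z = f z := by
  set h : CSp n → ℂ := fun y => kapc σ (z - y) * f y with hh
  have hT : Tst 0 U h := (kapc_sub_tst hσ 0 hz).contDiff_mul hU (contDiffOn_zero.2 hf.continuousOn)
  have h1 : mol σ f z = ∫ y, h (z - y) := by
    rw [mol_swap]; congr 1; ext y; simp only [hh, sub_sub_cancel]; ring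
  have h2 : ∀ θ : ℝ, mol σ f z = ∫ y, h (z - circleMap 0 1 θ • y) := by
    intro θ
    rw [h1, ← integral_rot (c := circleMap 0 1 θ) (by simp) (fun y => h (z - y))]
  have hoff : ∀ (θ : ℝ) y, y ∉ closedBall (0 : CSp n) σ → h (z - circleMap 0 1 θ • y) = 0 := by
    intro θ y hy
    simp only [hh, sub_sub_cancel]
    rw [kapc, kap_eq_zero hσ]
    · simp
    · rw [norm_smul]; simp at hy ⊢; exact hy.le
  have h3 : ∀ θ : ℝ, mol σ f z = ∫ y in closedBall (0 : CSp n) σ, h (z - circleMap 0 1 θ • y) := by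
    intro θ
    rw [h2 θ, setIntegral_eq_integral_of_forall_compl_eq_zero fun y hy => hoff θ y hy]
  have hcont : Continuous (fun p : ℝ × CSp n => h (z - circleMap 0 1 p.1 • p.2)) := by
    have c1 := hT.continuous
    have c2 := continuous_circleMap 0 1
    fun_prop
  have h4 : ∫ θ in (0:ℝ)..2 * Real.pi, mol σ f z = ∫ y in closedBall (0 : CSp n) σ, ∫ θ in (0:ℝ)..2 * Real.pi, h (z - circleMap 0 1 θ • y) := by
    rw [← intervalIntegral_integral_swap]
    · congr 1; ext θ; exact h3 θ
    · rw [Measure.prod_restrict]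
      refine IntegrableOn.mono_set (t := uIcc 0 (2 * Real.pi) ×ˢ closedBall 0 σ) ?_ (prod_mono_left uIoc_subset_uIcc)
      exact hcont.continuousOn.integrableOn_compact (isCompact_uIcc.prod (isCompact_closedBall _ _))
  have h5 : ∀ y ∈ closedBall (0 : CSp n) σ, ∫ θ in (0:ℝ)..2 * Real.pi, h (z - circleMap 0 1 θ • y) = kapc σ y * (2 * Real.pi * f z) := by
    intro y hy
    have hd : DiffContOnCl ℂ (fun t : ℂ => f (z - t • y)) (ball 0 |1|) := by
      have : DifferentiableOn ℂ (fun t : ℂ => f (z - t • y)) (closedBall 0 |1|) := by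
        refine hf.comp (by fun_prop) ?_
        intro t ht
        apply hz
        simp at ht hy ⊢
        rw [norm_smul]
        nlinarith [norm_nonneg t, norm_nonneg y]
      exact DifferentiableOn.diffContOnCl (this.mono (by rw [closure_ball _ (by simp)]))
    have := hd.circleAverage
    rw [Real.circleAverage_def] at this
    simp only [zero_smul, sub_zero] at this
    have e : ∀ θ : ℝ, h (z - circleMap 0 1 θ • y) = kapc σ y * f (z - circleMap 0 1 θ • y) := by
      intro θ
      simp only [hh, sub_sub_cancel]
      congr 1
      unfold kapc
      rw [kap_norm σ (z := y)]
      rw [norm_smul]; simp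
    simp_rw [e]
    rw [intervalIntegral.integral_const_mul]
    congr 1
    rw [← this]
    simp
    have : (Real.pi : ℂ) ≠ 0 := by exact_mod_cast Real.pi_ne_zero
    field_simp
  rw [setIntegral_congr_fun measurableSet_closedBall h5, integral_mul_const] at h4
  have h6 : ∫ y in closedBall (0 : CSp n) σ, kapc σ y = 1 := by
    rw [setIntegral_eq_integral_of_forall_compl_eq_zero]
    · have := kapc_integral (n := n) hσ 0
      rw [← this, integral_sub_left_eq_self (kapc σ)]
    · intro y hy
      rw [kapc, kap_eq_zero hσ]
      · simp
      · simp at hy; exact hy.le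
  rw [h6] at h4
  simp at h4
  have : (Real.pi : ℂ) ≠ 0 := by exact_mod_cast Real.pi_ne_zero
  have h7 : (2 * Real.pi : ℂ) ≠ 0 := by simpa using this
  exact mul_left_cancel₀ h7 (by simpa using h4)

open MeasureTheory

lemma mol_holo {n : ℕ} {Ω : Set (CSp n)} {G : CSp n → ℂ} (hG : MemLp G 2 volume)
    (hw : ∀ θ, Tst 2 Ω θ → ∀ j, ∫ x, G x * dzb j θ x = 0) {z : CSp n} {σ : ℝ} (hσ : 0 < σ) (hz : closedBall z σ ⊆ Ω) :
    DifferentiableAt ℂ (mol σ G) z := by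
  refine holo_of_dzb ((mol_contDiff hσ (memLp_locInt hG) 1).differentiable (by norm_num) z) fun j => ?_
  rw [dzb, mol_dw hσ (memLp_locInt hG)]
  have := hw _ (kapc_sub_tst hσ 2 hz) j
  unfold dzb at this
  rw [this, neg_zero]

/-- the main output of the `∂̄`-theory -/
lemma dbar_approx {n : ℕ} {Ω : Set (CSp n)} {P : CSp n → ℝ} {C : ℝ} (h : Wgt Ω P C) {K : Set (CSp n)} (hK : IsCompact K)
    (hKΩ : K ⊆ Ω) {σ₀ : ℝ} (hσ₀ : 0 < σ₀) :
    ∃ σ, 0 < σ ∧ σ ≤ σ₀ ∧ (∀ z ∈ K, closedBall z σ ⊆ Ω) ∧ ∃ Ω' : Set (CSp n), IsOpen Ω' ∧ K ⊆ Ω' ∧ ∃ A : ℝ, 0 ≤ A ∧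
      ∀ (u : CSp n → ℂ) (B ε : ℝ), 0 ≤ ε → ContDiffOn ℝ 2 u Ω → (∀ x ∈ Ω, ‖u x‖ ≤ B) → (∀ x ∈ Ω, ∀ j, ‖dzb j u x‖ ≤ ε) →
        ∃ f : CSp n → ℂ, DifferentiableOn ℂ f Ω' ∧ ∀ z ∈ K, ‖f z - mol σ u z‖ ≤ A * ε := by
  obtain ⟨δ, hδ, hδΩ⟩ := hK.exists_cthickening_subset_open h.isOpen hKΩ
  set σ := min σ₀ (δ/2) with hσdef
  have hσ : 0 < σ := lt_min hσ₀ (by linarith)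
  have hσδ : σ ≤ δ/2 := min_le_right _ _
  set Ω2 := thickening δ K with hΩ2
  have hΩ2o : IsOpen Ω2 := isOpen_thickening
  have hΩ2Ω : Ω2 ⊆ Ω := (thickening_subset_cthickening δ K).trans hδΩ
  have hb : ∀ z ∈ thickening (δ/2) K, closedBall z σ ⊆ Ω2 := by
    intro z hz y hy
    rw [hΩ2, mem_thickening_iff]
    obtain ⟨x, hx, hxz⟩ := mem_thickening_iff.1 hz
    refine ⟨x, hx, ?_⟩
    have := dist_triangle y z x
    rw [mem_closedBall] at hy
    linarith
  have hcpt : IsCompact (cthickening δ K) := hK.cthickening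
  -- lower bound of the weight on the compact neighbourhood
  have hcont : ContinuousOn (fun x => (al P C x * P x ^ 2)⁻¹) (cthickening δ K) := by
    refine ContinuousOn.inv₀ ?_ fun x hx => ?_
    · exact (h.al_smooth.continuousOn.mul (h.smooth.continuousOn.pow 2)).mono hδΩ
    · exact (mul_pos (h.al_pos (hδΩ hx)) (pow_pos (h.pos (hδΩ hx)) 2)).ne'
  obtain ⟨m, hm⟩ := hcpt.exists_bound_of_continuousOn hcont
  have hm' : ∀ x ∈ Ω2, ‖(al P C x * P x ^ 2)⁻¹‖ ≤ |m| := fun x hx => 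
    (hm x (thickening_subset_cthickening δ K hx)).trans (le_abs_self m)
  have hkm : MemLp (kapc (n := n) σ) 2 volume := (kapc_continuous σ).memLp_of_hasCompactSupport (kapc_hcs hσ)
  set Q := √(∫ x : CSp n, ‖kapc σ x‖^2) with hQ
  have hKpos := KK_pos C
  refine ⟨σ, hσ, min_le_left _ _, fun z hz => (hb z (self_subset_thickening (by linarith) K hz)).trans hΩ2Ω,
    thickening (δ/2) K, isOpen_thickening, self_subset_thickening (by linarith) K,
    Q * (|m| * √(n * ((2 / KK C)^2 * volume.real Ω))), by positivity, ?_⟩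
  intro u B ε hε0 hu hB hε
  obtain ⟨e, hem, he, hort⟩ := solve h hu hB hε
  set E : CSp n → ℂ := Ω2.indicator (fun x => (((al P C x * P x ^ 2)⁻¹ : ℝ) : ℂ)) with hE
  have hEm : AEStronglyMeasurable E volume := by
    rw [hE, aestronglyMeasurable_indicator_iff hΩ2o.measurableSet]
    refine ContinuousOn.aestronglyMeasurable ?_ hΩ2o.measurableSet
    exact Complex.continuous_ofReal.comp_continuousOn (hcont.mono (thickening_subset_cthickening δ K))
  have hEb : ∀ x, ‖E x‖ ≤ |m| := by
    intro x
    by_cases hx : x ∈ Ω2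
    · simp only [hE, indicator_of_mem hx, Complex.norm_real]; exact hm' x hx
    · simp only [hE, indicator_of_notMem hx]; simp
  have hgm := bdd_mul_memLp hEm hEb hem
  set g : CSp n → ℂ := fun x => E x * e x with hg
  have hub := ind_memLp hΩ2o (hcpt.isBounded.subset (thickening_subset_cthickening δ K))
    (hu.continuousOn.mono hΩ2Ω) (M := B) fun x hx => hB x (hΩ2Ω hx)
  set G : CSp n → ℂ := Ω2.indicator u - g with hGdef
  have hGm : MemLp G 2 volume := hub.sub hgm
  have hw : ∀ θ, Tst 2 Ω2 θ → ∀ j, ∫ x, G x * dzb j θ x = 0 := by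
    intro θ hθ j
    rw [← hort θ ⟨hθ.1, hθ.2.1, hθ.2.2.trans hΩ2Ω⟩ j]
    congr 1; ext x
    by_cases hx : x ∈ Ω2
    · simp only [hGdef, hg, hE, Pi.sub_apply, indicator_of_mem hx]
      push_cast
      ring
    · rw [dzb, dw_off hθ _ _ hx]; simp
  refine ⟨mol σ G, fun z hz => (mol_holo hGm hw hσ (hb z hz)).differentiableWithinAt, fun z hz => ?_⟩
  have hz' := hb z (self_subset_thickening (by linarith) K hz)
  have e1 : mol σ u z = mol σ (Ω2.indicator u) z := by
    unfold mol
    congr 1; ext y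
    by_cases hy : y ∈ Ω2
    · rw [indicator_of_mem hy]
    · have : σ ≤ ‖z - y‖ := by
        by_contra hc
        apply hy; apply hz'
        rw [mem_closedBall, dist_comm, dist_eq_norm]; exact (not_le.1 hc).le
      simp [kapc, kap_eq_zero hσ this]
  have e2 : mol σ G z - mol σ u z = - mol σ g z := by
    rw [e1, hGdef, mol_sub hσ (memLp_locInt hub) (memLp_locInt hgm)]
    simp
  rw [e2, norm_neg]
  have hk2 : MemLp (fun y => kapc σ (z - y)) 2 volume := 
    hkm.comp_measurePreserving (Measure.measurePreserving_sub_left volume z)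
  have e3 : mol σ g z = inner ℂ (hk2.toLp) (hgm.toLp) := by
    rw [l2_inner]; unfold mol
    congr 1; ext y
    simp [kapc]; ring
  rw [e3]
  refine (norm_inner_le_norm _ _).trans ?_
  have n1 : ‖hk2.toLp‖ = Q := by
    rw [hQ, ← Real.sqrt_sq (norm_nonneg (hk2.toLp)), l2_norm]
    congr 1
    exact integral_sub_left_eq_self (fun y => ‖kapc σ y‖^2) volume z
  have n2 : ‖hgm.toLp‖ ≤ |m| * √(n * ((2 / KK C)^2 * volume.real Ω)) * ε := by
    have h1 : ‖hgm.toLp‖ ≤ |m| * ‖hem.toLp‖ := by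
      rw [Lp.norm_toLp, Lp.norm_toLp]
      have := eLpNorm_le_mul_eLpNorm_of_ae_le_mul (μ := volume) (f := g) (g := e) (c := |m|) (p := 2) (Eventually.of_forall fun x => by
        simp only [hg, norm_mul]; exact mul_le_mul_of_nonneg_right (hEb x) (norm_nonneg _))
      have h2 := ENNReal.toReal_mono (ENNReal.mul_ne_top ENNReal.ofReal_ne_top hem.2.ne) this
      rwa [ENNReal.toReal_mul, ENNReal.toReal_ofReal (abs_nonneg m)] at h2
    have h2 : ‖hem.toLp‖ ≤ √(n * ((2 / KK C)^2 * volume.real Ω)) * ε := by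
      rw [← l2_norm hem] at he
      have h3 : ‖hem.toLp‖ ≤ √(n * ((2 / KK C * ε)^2 * volume.real Ω)) := Real.le_sqrt_of_sq_le he
      rw [show (n * ((2 / KK C * ε)^2 * volume.real Ω)) = (n * ((2 / KK C)^2 * volume.real Ω)) * ε^2 by ring,
        Real.sqrt_mul (by positivity), Real.sqrt_sq hε0] at h3
      exact h3
    calc _ ≤ |m| * ‖hem.toLp‖ := h1
      _ ≤ |m| * (√(n * ((2 / KK C)^2 * volume.real Ω)) * ε) := by gcongr
      _ = _ := by ring
  rw [n1, mul_assoc Q]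
  exact mul_le_mul_of_nonneg_left n2 (Real.sqrt_nonneg _)

open MeasureTheory

/-- complex linear functional with real part `ℓ` -/
def clin {n : ℕ} (l : CSp n →L[ℝ] ℝ) (v : CSp n) : ℂ :=
  ∑ j, v j * ((l (ee j) : ℂ) + (-Complex.I) * (l (Complex.I • ee j) : ℂ))

lemma clin_eq {n : ℕ} (l : CSp n →L[ℝ] ℝ) (v : CSp n) :
    clin l v = (l v : ℂ) - Complex.I * (l (Complex.I • v) : ℂ) := by
  have := lin_sum l v
  have h2 : clin l v = 2 * ∑ j, v j * (((l (ee j) : ℂ) + (-Complex.I) * (l (Complex.I • ee j) : ℂ)) / 2) := by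
    rw [clin, Finset.mul_sum]
    refine Finset.sum_congr rfl fun j _ => by ring
  rw [h2, this]; ring

lemma coord_diff {n : ℕ} (j : Fin n) : Differentiable ℂ (fun v : CSp n => v j) :=
  (EuclideanSpace.proj j : CSp n →L[ℂ] ℂ).differentiable

lemma clin_diff {n : ℕ} (l : CSp n →L[ℝ] ℝ) : Differentiable ℂ (clin l) := by
  unfold clin
  exact Differentiable.fun_sum fun j _ => (coord_diff j).mul_const _

/-- complex quadratic form -/
def cquad {n : ℕ} (H : CSp n →L[ℝ] CSp n →L[ℝ] ℝ) (v : CSp n) : ℂ :=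
  ∑ j, v j * (clin (H (ee j)) v + (-Complex.I) * clin (H (Complex.I • ee j)) v)

lemma cquad_diff {n : ℕ} (H : CSp n →L[ℝ] CSp n →L[ℝ] ℝ) : Differentiable ℂ (cquad H) := by
  unfold cquad
  exact Differentiable.fun_sum fun j _ => (coord_diff j).fun_mul ((clin_diff _).fun_add ((clin_diff _).const_mul _))

lemma cquad_re {n : ℕ} (H : CSp n →L[ℝ] CSp n →L[ℝ] ℝ) (v : CSp n) :
    (cquad H v).re = H v v - H (Complex.I • v) (Complex.I • v) := by
  have h1 := clin_eq (H.flip v) v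
  have h2 := clin_eq (H.flip (Complex.I • v)) v
  have h3 : cquad H v = clin (H.flip v) v - Complex.I * clin (H.flip (Complex.I • v)) v := by
    unfold cquad
    simp_rw [clin_eq (H _)]
    unfold clin
    rw [Finset.mul_sum, ← Finset.sum_sub_distrib]
    refine Finset.sum_congr rfl fun j _ => ?_
    simp only [ContinuousLinearMap.flip_apply]
    ring
  rw [h3, h1, h2]
  simp

/-- minus the Levi polynomial -/
def lpol {n : ℕ} (ρ : CSp n → ℝ) (ζ v : CSp n) : ℂ := -(clin (fderiv ℝ ρ ζ) v + cquad (hes ρ ζ) v / 4)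

lemma lpol_diff {n : ℕ} (ρ : CSp n → ℝ) (ζ : CSp n) : Differentiable ℂ (lpol ρ ζ) :=
by
  have h : Differentiable ℂ (fun v => cquad (hes ρ ζ) v / 4) := by
    simp_rw [div_eq_mul_inv]
    exact (cquad_diff _).mul_const _
  exact ((clin_diff _).fun_add h).fun_neg

lemma lpol_re {n : ℕ} (ρ : CSp n → ℝ) (ζ v : CSp n) : 
    (lpol ρ ζ v).re = - (fderiv ℝ ρ ζ v + hes ρ ζ v v / 2) + lev ρ ζ v / 4 := by
  have h4 : (cquad (hes ρ ζ) v / 4).re = (cquad (hes ρ ζ) v).re / 4 := by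
    rw [show (4:ℂ) = ((4:ℝ):ℂ) by norm_num, Complex.div_ofReal_re]
  have : (clin (fderiv ℝ ρ ζ) v).re = fderiv ℝ ρ ζ v := by rw [clin_eq]; simp
  rw [lpol, Complex.neg_re, Complex.add_re, h4, cquad_re, this, lev]
  ring

lemma hes_cont {n : ℕ} {ρ : CSp n → ℝ} (hρ : ContDiff ℝ 2 ρ) : Continuous (hes ρ) :=
  (hρ.fderiv_right (m := 1) (by norm_num)).continuous_fderiv (by norm_num)

lemma fd_diff {n : ℕ} {ρ : CSp n → ℝ} (hρ : ContDiff ℝ 2 ρ) : Differentiable ℝ (fderiv ℝ ρ) :=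
  (hρ.fderiv_right (m := 1) (by norm_num)).differentiable (by norm_num)

/-- uniform second order Taylor expansion -/
lemma taylor2 {n : ℕ} {ρ : CSp n → ℝ} (hρ : ContDiff ℝ 2 ρ) {K : Set (CSp n)} (hK : IsCompact K) {η : ℝ} (hη : 0 < η) :
    ∃ r > 0, ∀ ζ ∈ K, ∀ z, ‖z - ζ‖ ≤ r →
      |ρ z - ρ ζ - (fderiv ℝ ρ ζ (z - ζ) + hes ρ ζ (z - ζ) (z - ζ) / 2)| ≤ η * ‖z - ζ‖^2 := by
  have hcpt : IsCompact (cthickening 1 K) := hK.cthickening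
  have huc := hcpt.uniformContinuousOn_of_continuous (f := hes ρ) (hes_cont hρ).continuousOn
  obtain ⟨d, hd, hd2⟩ := (Metric.uniformContinuousOn_iff (f := hes ρ) (s := cthickening 1 K)).1 huc η hη
  refine ⟨min 1 (d/2), by positivity, fun ζ hζ z hz => ?_⟩
  set r := min 1 (d/2) with hr
  have hbd : ∀ x ∈ closedBall ζ r, ‖hes ρ x - hes ρ ζ‖ ≤ η := by
    intro x hx
    have h1 : x ∈ cthickening 1 K := mem_cthickening_of_dist_le x ζ 1 K hζ ((mem_closedBall.1 hx).trans (min_le_left _ _))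
    have h2 : ζ ∈ cthickening 1 K := self_subset_cthickening K hζ
    have := hd2 x h1 ζ h2 ((mem_closedBall.1 hx).trans_lt (by linarith [min_le_right 1 (d/2)]))
    have e := (dist_eq_norm (hes ρ x) (hes ρ ζ)).symm
    exact e.le.trans this.le
  have hfd : ∀ x ∈ closedBall ζ r, ‖fderiv ℝ ρ x - fderiv ℝ ρ ζ - hes ρ ζ (x - ζ)‖ ≤ η * ‖x - ζ‖ := by
    intro x hx
    exact (convex_closedBall ζ r).norm_image_sub_le_of_norm_fderiv_le' (𝕜 := ℝ) (fun y _ => fd_diff hρ y) hbd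
      (mem_closedBall_self (by positivity)) hx
  set E : CSp n → ℝ := fun x => ρ x - hes ρ ζ (x - ζ) (x - ζ) / 2 with hE
  have hsym : ∀ v w, hes ρ ζ v w = hes ρ ζ w v := fun v w =>
    (hρ.contDiffAt (x := ζ)).isSymmSndFDerivAt (by simp) v w
  have hEd : ∀ x, HasFDerivAt E (fderiv ℝ ρ x - hes ρ ζ (x - ζ)) x := by
    intro x
    have h0 : HasFDerivAt (fun x : CSp n => x - ζ) (ContinuousLinearMap.id ℝ (CSp n)) x := (hasFDerivAt_id x).sub_const ζ
    have h1 : HasFDerivAt (fun x : CSp n => hes ρ ζ (x - ζ)) (hes ρ ζ) x := by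
      have := (hes ρ ζ).hasFDerivAt.comp x h0
      exact this
    have h2 := h1.clm_apply h0
    have h3 := ((hρ.differentiable (by norm_num) x).hasFDerivAt).fun_sub (h2.mul_const (1/2))
    have h4 : fderiv ℝ ρ x - hes ρ ζ (x - ζ) = fderiv ℝ ρ x - (1/2 : ℝ) • ((hes ρ ζ (x - ζ)).comp (ContinuousLinearMap.id ℝ (CSp n)) + (hes ρ ζ).flip (x - ζ)) := by
      ext v
      have e := hsym v (x - ζ)
      simp only [ContinuousLinearMap.sub_apply, ContinuousLinearMap.smul_apply, ContinuousLinearMap.add_apply,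
        ContinuousLinearMap.comp_apply, ContinuousLinearMap.id_apply, ContinuousLinearMap.flip_apply, smul_eq_mul, e]
      ring
    rw [h4]
    refine h3.congr_of_eventuallyEq (Eventually.of_forall fun y => ?_)
    simp only [hE]; ring
  have hzr : z ∈ closedBall ζ ‖z - ζ‖ := by rw [mem_closedBall, dist_eq_norm]
  have := (convex_closedBall ζ ‖z - ζ‖).norm_image_sub_le_of_norm_hasFDerivWithin_le' (𝕜 := ℝ) (f := E) (φ := fderiv ℝ ρ ζ)
    (C := η * ‖z - ζ‖) (fun x _ => (hEd x).hasFDerivWithinAt) (fun x hx => by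
      rw [sub_right_comm]
      refine (hfd x (closedBall_subset_closedBall hz hx)).trans ?_
      rw [mem_closedBall, dist_eq_norm] at hx
      gcongr) (mem_closedBall_self (norm_nonneg _)) hzr
  rw [Real.norm_eq_abs] at this
  simp only [hE, sub_self, map_zero] at this
  simp only [zero_div, sub_zero, map_zero, ContinuousLinearMap.zero_apply] at this
  calc _ = |ρ z - hes ρ ζ (z - ζ) (z - ζ) / 2 - ρ ζ - fderiv ℝ ρ ζ (z - ζ)| := by
        congr 1; ring
    _ ≤ η * ‖z - ζ‖ * ‖z - ζ‖ := this
    _ = _ := by ring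

/-- lower bound of the Levi form on a compact set -/
lemma levi_lower {n : ℕ} {ρ : CSp n → ℝ} (hρ : ContDiff ℝ 2 ρ) {K : Set (CSp n)} (hK : IsCompact K)
    (hpos : ∀ z ∈ K, ∀ v : CSp n, v ≠ 0 → 0 < lev ρ z v) :
    ∃ c > 0, ∀ z ∈ K, ∀ v, c * ‖v‖^2 ≤ lev ρ z v := by
  have hc : Continuous (fun p : CSp n × CSp n => lev ρ p.1 p.2) := by
    have := hes_cont hρ
    unfold lev
    have h2 : Continuous (fun p : CSp n × CSp n => hes ρ p.1) := this.comp continuous_fst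
    have h3 : Continuous (fun p : CSp n × CSp n => Complex.I • p.2) := (continuous_const_smul Complex.I).comp continuous_snd
    exact ((h2.clm_apply continuous_snd).clm_apply continuous_snd).add
      ((h2.clm_apply h3).clm_apply h3)
  have hcpt : IsCompact (K ×ˢ sphere (0 : CSp n) 1) := hK.prod (isCompact_sphere _ _)
  have hex : ∃ c > 0, ∀ z ∈ K, ∀ v ∈ sphere (0 : CSp n) 1, c ≤ lev ρ z v := by
    rcases (K ×ˢ sphere (0 : CSp n) 1).eq_empty_or_nonempty with he | hne
    · refine ⟨1, one_pos, fun z hz v hv => ?_⟩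
      have : (z, v) ∈ K ×ˢ sphere (0 : CSp n) 1 := ⟨hz, hv⟩
      rw [he] at this; exact absurd this (notMem_empty _)
    · obtain ⟨p, hp, hmin⟩ := hcpt.exists_isMinOn hne hc.continuousOn
      refine ⟨lev ρ p.1 p.2, hpos _ hp.1 _ ?_, fun z hz v hv => hmin (show (z, v) ∈ _ from ⟨hz, hv⟩)⟩
      rintro h0
      have := hp.2
      rw [h0] at this; simp at this
  obtain ⟨c, hc0, hcl⟩ := hex
  refine ⟨c, hc0, fun z hz v => ?_⟩
  by_cases hv : v = 0
  · simp [hv, lev]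
  · have hn : 0 < ‖v‖ := norm_pos_iff.2 hv
    have h1 := hcl z hz (‖v‖⁻¹ • v) (by simp [norm_smul, hn.ne'])
    have h2 : lev ρ z (‖v‖⁻¹ • v) = ‖v‖⁻¹^2 * lev ρ z v := by
      unfold lev
      rw [smul_comm Complex.I]
      simp; ring
    rw [h2] at h1
    calc c * ‖v‖^2 ≤ (‖v‖⁻¹^2 * lev ρ z v) * ‖v‖^2 := by gcongr
      _ = lev ρ z v := by field_simp

lemma lev_upper {n : ℕ} {ρ : CSp n → ℝ} {z : CSp n} {B : ℝ} (hB : ‖hes ρ z‖ ≤ B) (v : CSp n) : |lev ρ z v| ≤ 2 * B * ‖v‖^2 := by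
  have h : ∀ w : CSp n, |hes ρ z w w| ≤ B * ‖w‖^2 := by
    intro w
    have := (hes ρ z).le_opNorm₂ w w
    rw [Real.norm_eq_abs] at this
    refine this.trans ?_
    rw [mul_assoc, ← sq]; gcongr
  have h1 := h v
  have h2 := h (Complex.I • v)
  rw [norm_smul, Complex.norm_I, one_mul] at h2
  unfold lev
  exact (abs_add_le _ _).trans (by linarith)

/-- estimates of the Levi polynomial -/
lemma lpol_est {n : ℕ} {ρ : CSp n → ℝ} (hρ : ContDiff ℝ 2 ρ) {K : Set (CSp n)} (hK : IsCompact K)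
    (hpos : ∀ z ∈ K, ∀ v : CSp n, v ≠ 0 → 0 < lev ρ z v) (h0 : ∀ z ∈ K, ρ z = 0) :
    ∃ r > 0, ∃ c > 0, ∃ C > 0, ∀ ζ ∈ K, ∀ z, ‖z - ζ‖ ≤ r →
      - ρ z + c * ‖z - ζ‖^2 ≤ (lpol ρ ζ (z - ζ)).re ∧ (lpol ρ ζ (z - ζ)).re ≤ - ρ z + C * ‖z - ζ‖^2 := by
  obtain ⟨c, hc, hcl⟩ := levi_lower hρ hK hpos
  obtain ⟨r, hr, ht⟩ := taylor2 hρ hK (η := c/8) (by positivity)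
  obtain ⟨B, hB⟩ := hK.exists_bound_of_continuousOn (f := hes ρ) (hes_cont hρ).continuousOn
  refine ⟨r, hr, c/8, by positivity, c/8 + |B|, by positivity, fun ζ hζ z hz => ?_⟩
  have h1 := abs_le.1 (ht ζ hζ z hz)
  have h2 := hcl ζ hζ (z - ζ)
  have h3 := abs_le.1 (lev_upper ((hB ζ hζ).trans (le_abs_self B)) (z - ζ))
  rw [h0 ζ hζ] at h1
  rw [lpol_re]
  have : 0 ≤ |B| * ‖z - ζ‖^2 := by positivity
  constructor <;> nlinarith [h1.1, h1.2, h3.1, h3.2]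

open MeasureTheory

/-- the real inner product as a real bilinear form -/
lemma exists_inner_form (n : ℕ) : ∃ B : CSp n →L[ℝ] CSp n →L[ℝ] ℝ, (∀ v, B v v = ‖v‖^2) ∧ (∀ v w, B v w = B w v) ∧ (∀ v w, |B v w| ≤ ‖v‖ * ‖w‖) := by
  let _ : InnerProductSpace ℝ (CSp n) := InnerProductSpace.complexToReal
  refine ⟨innerSL ℝ, fun v => ?_, fun v w => ?_, fun v w => ?_⟩
  · rw [innerSL_apply_apply]; exact real_inner_self_eq_norm_sq v
  · rw [innerSL_apply_apply, innerSL_apply_apply]; exact real_inner_comm _ _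
  · rw [innerSL_apply_apply]; exact abs_real_inner_le_norm _ _

lemma hasFDerivAt_nsq {n : ℕ} {B : CSp n →L[ℝ] CSp n →L[ℝ] ℝ} (hB : ∀ v, B v v = ‖v‖^2) (hs : ∀ v w, B v w = B w v) (x : CSp n) :
    HasFDerivAt (fun x : CSp n => ‖x‖^2) ((2:ℝ) • B x) x := by
  have h0 : HasFDerivAt (fun x : CSp n => x) (ContinuousLinearMap.id ℝ (CSp n)) x := hasFDerivAt_id x
  have h1 : HasFDerivAt (fun x : CSp n => B x) B x := B.hasFDerivAt
  have h2 := h1.clm_apply h0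
  have h4 : (2:ℝ) • B x = (B x).comp (ContinuousLinearMap.id ℝ (CSp n)) + B.flip x := by
    ext v
    have e := hs v x
    simp only [ContinuousLinearMap.smul_apply, ContinuousLinearMap.add_apply,
        ContinuousLinearMap.comp_apply, ContinuousLinearMap.id_apply, ContinuousLinearMap.flip_apply, smul_eq_mul, e]
    ring
  rw [h4]
  refine h2.congr_of_eventuallyEq (Eventually.of_forall fun y => ?_)
  simp only [hB]

/-- the weight function -/
def wP {n : ℕ} (ρ : CSp n → ℝ) (δ A : ℝ) (z : CSp n) : ℝ := 1 + (δ - ρ z)⁻¹ + A * ‖z‖^2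

lemma wP_hasFDerivAt {n : ℕ} {ρ : CSp n → ℝ} (hρ : ContDiff ℝ 2 ρ) {δ A : ℝ} {B : CSp n →L[ℝ] CSp n →L[ℝ] ℝ}
    (hB : ∀ v, B v v = ‖v‖^2) (hs : ∀ v w, B v w = B w v) {x : CSp n} (hx : ρ x < δ) :
    HasFDerivAt (wP ρ δ A) (((δ - ρ x)⁻¹^2) • fderiv ℝ ρ x + (2 * A) • B x) x := by
  have h1 : HasFDerivAt (fun y => δ - ρ y) (-fderiv ℝ ρ x) x :=
    ((hρ.differentiable (by norm_num) x).hasFDerivAt).const_sub δ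
  have h2 := (hasDerivAt_inv (x := δ - ρ x) (by linarith)).comp_hasFDerivAt x h1
  have h3 := (h2.const_add 1).fun_add ((hasFDerivAt_nsq hB hs x).const_mul A)
  have h4 : ((δ - ρ x)⁻¹^2) • fderiv ℝ ρ x + (2 * A) • B x = -((δ - ρ x) ^ 2)⁻¹ • -fderiv ℝ ρ x + A • (2:ℝ) • B x := by
    ext v
    simp only [ContinuousLinearMap.smul_apply, ContinuousLinearMap.add_apply, ContinuousLinearMap.neg_apply, smul_eq_mul, inv_pow]
    ring
  rw [h4]
  exact h3

lemma wP_hes {n : ℕ} {ρ : CSp n → ℝ} (hρ : ContDiff ℝ 2 ρ) {δ A : ℝ} {x : CSp n} (hx : ρ x < δ) (w : CSp n) :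
    hes (wP ρ δ A) x w w = (δ - ρ x)⁻¹^2 * hes ρ x w w + 2 * (δ - ρ x)⁻¹^3 * (fderiv ℝ ρ x w)^2 + 2 * A * ‖w‖^2 := by
  obtain ⟨B, hB, hs, -⟩ := exists_inner_form n
  have hev : fderiv ℝ (wP ρ δ A) =ᶠ[𝓝 x] fun y => ((δ - ρ y)⁻¹^2) • fderiv ℝ ρ y + (2 * A) • B y := by
    filter_upwards [(hρ.continuous.tendsto x).eventually (gt_mem_nhds hx)] with y hy
    exact (wP_hasFDerivAt hρ hB hs hy).fderiv
  have h1 : HasFDerivAt (fun y => δ - ρ y) (-fderiv ℝ ρ x) x :=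
    ((hρ.differentiable (by norm_num) x).hasFDerivAt).const_sub δ
  have h2 : HasFDerivAt (fun y => (δ - ρ y)⁻¹) (-((δ - ρ x) ^ 2)⁻¹ • -fderiv ℝ ρ x) x := (hasDerivAt_inv (x := δ - ρ x) (by linarith)).comp_hasFDerivAt x h1
  have h3 := ((h2.pow 2).smul (fd_diff hρ x).hasFDerivAt)
  have h4 : HasFDerivAt (fun y : CSp n => (2 * A) • B y) ((2 * A) • B) x := ((2 * A) • B).hasFDerivAt
  have h5 : hes (wP ρ δ A) x = _ := hev.fderiv_eq.trans (h3.fun_add h4).fderiv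
  rw [h5]
  have hne : δ - ρ x ≠ 0 := by linarith
  simp [hB]
  generalize δ - ρ x = q at *
  field_simp

lemma wP_lev {n : ℕ} {ρ : CSp n → ℝ} (hρ : ContDiff ℝ 2 ρ) {δ A : ℝ} {x : CSp n} (hx : ρ x < δ) (w : CSp n) :
    (δ - ρ x)⁻¹^2 * lev ρ x w + 4 * A * ‖w‖^2 ≤ lev (wP ρ δ A) x w := by
  unfold lev
  rw [wP_hes hρ hx, wP_hes hρ hx, norm_smul, Complex.norm_I, one_mul]
  have : 0 < (δ - ρ x)⁻¹ := inv_pos.2 (by linarith)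
  have : 0 ≤ 2 * (δ - ρ x)⁻¹^3 * (fderiv ℝ ρ x w)^2 := by positivity
  have : 0 ≤ 2 * (δ - ρ x)⁻¹^3 * (fderiv ℝ ρ x (Complex.I • w))^2 := by positivity
  linarith

/-- unpacked data of a strictly pseudoconvex domain -/
structure Spc {n : ℕ} (D U : Set (CSp n)) (ρ : CSp n → ℝ) : Prop where
  open_D : IsOpen D
  conn : IsConnected D
  bdd : Bornology.IsBounded D
  open_U : IsOpen U
  sub : frontier D ⊆ U
  smooth : ContDiff ℝ 2 ρ
  eq : D = {z | ρ z < 0}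
  dne : ∀ z ∈ frontier D, fderiv ℝ ρ z ≠ 0
  levi : ∀ z ∈ U, ∀ v : CSp n, v ≠ 0 → 0 < lev ρ z v

lemma Spc.cont {n : ℕ} {D U : Set (CSp n)} {ρ : CSp n → ℝ} (h : Spc D U ρ) : Continuous ρ := h.smooth.continuous

lemma Spc.le_zero {n : ℕ} {D U : Set (CSp n)} {ρ : CSp n → ℝ} (h : Spc D U ρ) : ∀ z ∈ closure D, ρ z ≤ 0 := by
  intro z hz
  have : closure D ⊆ {z | ρ z ≤ 0} := closure_minimal (fun z hz => by rw [h.eq] at hz; exact le_of_lt (show ρ z < 0 from hz))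
    (isClosed_le h.cont continuous_const)
  exact this hz

lemma Spc.front {n : ℕ} {D U : Set (CSp n)} {ρ : CSp n → ℝ} (h : Spc D U ρ) : ∀ z ∈ frontier D, ρ z = 0 := by
  intro z hz
  rw [h.open_D.frontier_eq] at hz
  refine le_antisymm (h.le_zero z hz.1) (not_lt.1 fun hlt => hz.2 ?_)
  rw [h.eq]; exact hlt

lemma Spc.cptF {n : ℕ} {D U : Set (CSp n)} {ρ : CSp n → ℝ} (h : Spc D U ρ) : IsCompact (frontier D) :=
  isCompact_of_isClosed_isBounded isClosed_frontier (h.bdd.closure.subset frontier_subset_closure)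

lemma Spc.cptC {n : ℕ} {D U : Set (CSp n)} {ρ : CSp n → ℝ} (h : Spc D U ρ) : IsCompact (closure D) :=
  h.bdd.isCompact_closure

lemma Spc.mem_of {n : ℕ} {D U : Set (CSp n)} {ρ : CSp n → ℝ} (h : Spc D U ρ) {z : CSp n} (h0 : ρ z = 0) (hd : fderiv ℝ ρ z ≠ 0) :
    z ∈ frontier D := by
  rw [h.open_D.frontier_eq]
  refine ⟨?_, fun hz => ?_⟩
  · by_contra hz
    apply hd
    apply IsLocalMin.fderiv_eq_zero
    have : (closure D)ᶜ ∈ 𝓝 z := isClosed_closure.isOpen_compl.mem_nhds hz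
    filter_upwards [this] with y hy
    rw [h0]
    by_contra hlt
    exact hy (subset_closure (by rw [h.eq]; exact not_le.1 hlt))
  · rw [h.eq] at hz; simp only [mem_setOf_eq] at hz; linarith

lemma Spc.wgt {n : ℕ} {D U : Set (CSp n)} {ρ : CSp n → ℝ} (h : Spc D U ρ) {δ₀ : ℝ} (hδ₀ : 0 < δ₀) :
    ∃ Ω P C, Wgt Ω P C ∧ closure D ⊆ Ω ∧ ∀ z ∈ Ω, ρ z < δ₀ := by
  have hWo : IsOpen (U ∩ {z | fderiv ℝ ρ z ≠ 0}) := h.open_U.inter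
    (isOpen_ne_fun (h.smooth.continuous_fderiv (by norm_num)) continuous_const)
  obtain ⟨r1, hr1, hr1s⟩ := h.cptF.exists_cthickening_subset_open hWo (fun z hz => ⟨h.sub hz, h.dne z hz⟩)
  set T := cthickening r1 (frontier D) with hT
  set T' := thickening r1 (frontier D) with hT'
  have hTc : IsCompact T := h.cptF.cthickening
  have hT'o : IsOpen T' := isOpen_thickening
  have hTT : T' ⊆ T := thickening_subset_cthickening _ _
  have hSc : IsCompact (T \ (D ∪ T')) := hTc.diff (h.open_D.union hT'o)
  have hSpos : ∀ z ∈ T \ (D ∪ T'), 0 < ρ z := by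
    intro z hz
    have h1 : 0 ≤ ρ z := not_lt.1 fun hlt => hz.2 (Or.inl (by rw [h.eq]; exact hlt))
    refine lt_of_le_of_ne h1 fun h0 => hz.2 (Or.inr ?_)
    exact self_subset_thickening hr1 _ (h.mem_of h0.symm (hr1s hz.1).2)
  have hδ1 : ∃ δ1 > 0, ∀ z ∈ T \ (D ∪ T'), δ1 ≤ ρ z := by
    rcases (T \ (D ∪ T')).eq_empty_or_nonempty with he | hne
    · exact ⟨1, one_pos, fun z hz => by rw [he] at hz; exact absurd hz (notMem_empty _)⟩
    · obtain ⟨p, hp, hmin⟩ := hSc.exists_isMinOn hne h.cont.continuousOn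
      exact ⟨ρ p, hSpos p hp, fun z hz => hmin hz⟩
  obtain ⟨δ1, hδ1, hδ1S⟩ := hδ1
  obtain ⟨δ, hδ, hδ1', hδ0'⟩ : ∃ δ > 0, δ ≤ δ1 ∧ δ ≤ δ₀ := ⟨min δ1 δ₀, by positivity, min_le_left _ _, min_le_right _ _⟩
  set Ω := (D ∪ T') ∩ {z | ρ z < δ} with hΩ
  have hΩo : IsOpen Ω := (h.open_D.union hT'o).inter (isOpen_lt h.cont continuous_const)
  have hclo : closure D ⊆ Ω := by
    intro z hz
    refine ⟨?_, (h.le_zero z hz).trans_lt hδ⟩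
    by_cases hzD : z ∈ D
    · exact Or.inl hzD
    · refine Or.inr (self_subset_thickening hr1 _ ?_)
      rw [h.open_D.frontier_eq]; exact ⟨hz, hzD⟩
  have hΩb : Bornology.IsBounded Ω := (h.bdd.union (hTc.isBounded.subset hTT)).subset inter_subset_left
  obtain ⟨R, hR⟩ := hΩb.subset_closedBall 0
  obtain ⟨B1, hB1⟩ := (isCompact_closedBall (0 : CSp n) R).exists_bound_of_continuousOn (f := fderiv ℝ ρ)
    (h.smooth.continuous_fderiv (by norm_num)).continuousOn
  obtain ⟨L, hL⟩ := (isCompact_closedBall (0 : CSp n) R).exists_bound_of_continuousOn (f := hes ρ)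
    (hes_cont h.smooth).continuousOn
  set A : ℝ := 1 + δ⁻¹^2 * |L| with hA
  have hA1 : 1 ≤ A := by rw [hA]; linarith [show 0 ≤ δ⁻¹^2 * |L| by positivity]
  obtain ⟨B, hB, hBs, hBn⟩ := exists_inner_form n
  have hg : ∀ x ∈ Ω, 0 < (δ - ρ x)⁻¹ := fun x hx => inv_pos.2 (by have : ρ x < δ := hx.2; linarith)
  have hP1 : ∀ x ∈ Ω, 1 ≤ wP ρ δ A x := by
    intro x hx
    have := hg x hx
    have : 0 ≤ A * ‖x‖^2 := by positivity
    unfold wP; linarith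
  have hPg : ∀ x ∈ Ω, (δ - ρ x)⁻¹ ≤ wP ρ δ A x := by
    intro x hx
    have : 0 ≤ A * ‖x‖^2 := by positivity
    unfold wP; linarith
  refine ⟨Ω, wP ρ δ A, |B1| + 2 * A * |R|, ⟨hΩo, hΩb, hP1, ?_, ?_, ?_, ?_, by positivity⟩, hclo, fun z hz => lt_of_lt_of_le hz.2 hδ0'⟩
  · intro x hx
    have h1 : ContDiffAt ℝ 2 (fun y => (δ - ρ y)⁻¹) x := (contDiffAt_const.sub h.smooth.contDiffAt).inv
      (by have : ρ x < δ := hx.2; linarith)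
    have h2 : ContDiffAt ℝ 2 (fun y : CSp n => ‖y‖^2) x := (contDiff_norm_sq ℂ (n := 2)).restrict_scalars ℝ |>.contDiffAt
    exact ((contDiffAt_const.add h1).add (contDiffAt_const.mul h2)).contDiffWithinAt
  · intro c
    have : {x | x ∈ Ω ∧ wP ρ δ A x ≤ c} = (closure D ∪ T) ∩ ({x | ρ x ≤ δ} ∩ {x | (1 + A * ‖x‖^2) * (δ - ρ x) + 1 ≤ c * (δ - ρ x)}) := by
      ext x
      have key : ρ x < δ → (wP ρ δ A x ≤ c ↔ (1 + A * ‖x‖^2) * (δ - ρ x) + 1 ≤ c * (δ - ρ x)) := by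
        intro hx
        have hd : 0 < δ - ρ x := by linarith
        rw [← mul_le_mul_iff_left₀ hd]
        unfold wP
        rw [show (1 + (δ - ρ x)⁻¹ + A * ‖x‖^2) * (δ - ρ x) = (1 + A * ‖x‖^2) * (δ - ρ x) + 1 by field_simp; ring]
      constructor
      · rintro ⟨hx, hc⟩
        refine ⟨?_, (show ρ x < δ from hx.2).le, (key hx.2).1 hc⟩
        exact hx.1.imp (fun h => subset_closure h) (fun h => hTT h)
      · rintro ⟨hx, hx2, hc⟩
        have hlt : ρ x < δ := by
          refine lt_of_le_of_ne hx2 fun he => ?_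
          simp only [mem_setOf_eq, he, sub_self, mul_zero] at hc; linarith
        refine ⟨?_, (key hlt).2 hc⟩
        rcases hx with hx | hx
        · exact hclo hx
        · refine ⟨?_, hlt⟩
          by_contra hn
          linarith [hδ1S x ⟨hx, hn⟩]
    rw [this]
    refine (h.cptC.union hTc).inter_right ((isClosed_le h.cont continuous_const).inter (isClosed_le ?_ ?_))
    · have := h.cont; fun_prop
    · have := h.cont; fun_prop
  · intro x hx
    rw [(wP_hasFDerivAt h.smooth hB hBs hx.2).fderiv]
    have h1 : ‖B x‖ ≤ |R| := by
      refine ContinuousLinearMap.opNorm_le_bound _ (abs_nonneg _) fun w => ?_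
      refine (hBn x w).trans ?_
      have := mem_closedBall_zero_iff.1 (hR hx)
      gcongr
      exact this.trans (le_abs_self _)
    have h2 : ‖fderiv ℝ ρ x‖ ≤ |B1| := (hB1 x (hR hx)).trans (le_abs_self _)
    have h3 := hg x hx
    have h4 := hPg x hx
    have h5 := hP1 x hx
    calc _ ≤ ‖((δ - ρ x)⁻¹^2) • fderiv ℝ ρ x‖ + ‖(2 * A) • B x‖ := norm_add_le _ _
      _ = (δ - ρ x)⁻¹^2 * ‖fderiv ℝ ρ x‖ + (2 * A) * ‖B x‖ := by
        rw [norm_smul, norm_smul, Real.norm_of_nonneg (by positivity), Real.norm_of_nonneg (by positivity)]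
      _ ≤ (wP ρ δ A x)^2 * |B1| + (2 * A) * |R| * (wP ρ δ A x)^2 := by
        have : (1:ℝ) ≤ (wP ρ δ A x)^2 := one_le_pow₀ h5
        have h6 : (2 * A) * ‖B x‖ ≤ (2 * A) * |R| * 1 := by rw [mul_one]; gcongr
        have h7 : (2 * A) * |R| * 1 ≤ (2 * A) * |R| * (wP ρ δ A x)^2 := by gcongr
        have h8 : (δ - ρ x)⁻¹^2 * ‖fderiv ℝ ρ x‖ ≤ (wP ρ δ A x)^2 * |B1| := by gcongr
        linarith
      _ = _ := by ring
  · intro x hx v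
    refine le_trans ?_ (wP_lev h.smooth hx.2 v)
    have hv2 : ‖v‖^2 ≤ A * ‖v‖^2 := le_mul_of_one_le_left (by positivity) hA1
    by_cases hxU : x ∈ U
    · have : 0 ≤ lev ρ x v := by
        by_cases hv : v = 0
        · simp [hv, lev]
        · exact (h.levi x hxU v hv).le
      have := hg x hx
      have : 0 ≤ (δ - ρ x)⁻¹^2 * lev ρ x v := by positivity
      have : 0 ≤ A * ‖v‖^2 := by positivity
      linarith
    · have hxD : x ∈ D := by
        rcases hx.1 with hx | hx
        · exact hx
        · exact absurd (hr1s (hTT hx)).1 hxU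
      rw [h.eq] at hxD
      have hneg : ρ x < 0 := hxD
      have h1 := abs_le.1 (lev_upper ((hL x (hR hx)).trans (le_abs_self L)) v)
      have h2 : (δ - ρ x)⁻¹ ≤ δ⁻¹ := inv_anti₀ hδ (by linarith)
      have h0 := hg x hx
      have h3 : (δ - ρ x)⁻¹^2 ≤ δ⁻¹^2 := by gcongr
      have h4 : (δ - ρ x)⁻¹^2 * (-(2 * |L| * ‖v‖^2)) ≤ (δ - ρ x)⁻¹^2 * lev ρ x v := by
        gcongr; exact h1.1
      have h5 : (δ - ρ x)⁻¹^2 * (2 * |L| * ‖v‖^2) ≤ δ⁻¹^2 * (2 * |L| * ‖v‖^2) := by gcongr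
      have h6 : A * ‖v‖^2 = ‖v‖^2 + δ⁻¹^2 * |L| * ‖v‖^2 := by rw [hA]; ring
      nlinarith [show 0 ≤ δ⁻¹^2 * |L| * ‖v‖^2 by positivity]

open MeasureTheory

lemma mol_norm_le {n : ℕ} {σ : ℝ} (hσ : 0 < σ) {f : CSp n → ℂ} {x : CSp n} {b : ℝ}
    (h : ∀ y, ‖x - y‖ < σ → ‖f y‖ ≤ b) : ‖mol σ f x‖ ≤ b := by
  have hI : ∫ y, b * kap σ (x - y) = b := by
    rw [integral_const_mul, integral_sub_left_eq_self (fun y => kap σ y), kap_integral hσ, mul_one]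
  rw [← hI, mol]
  refine norm_integral_le_of_norm_le ?_ (Eventually.of_forall fun y => ?_)
  · have h1 : Continuous (fun y : CSp n => kap σ (x - y)) := (kap_contDiff σ 0).continuous.comp (continuous_const.sub continuous_id)
    have h2 : Integrable (kap (n := n) σ) := (kap_contDiff σ 0).continuous.integrable_of_hasCompactSupport (kap_hcs hσ)
    exact (h2.comp_sub_left x).const_mul b
  · rw [norm_mul, kapc, Complex.norm_real, Real.norm_of_nonneg (kap_nonneg hσ _)]
    by_cases hy : ‖x - y‖ < σ
    · exact mul_le_mul_of_nonneg_right (h y hy) (kap_nonneg hσ _)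
    · rw [kap_eq_zero hσ (not_lt.1 hy)]; simp

lemma dzb_holo {n : ℕ} {f : CSp n → ℂ} {x : CSp n} (hf : DifferentiableAt ℂ f x) (j : Fin n) : dzb j f x = 0 := by
  have h : fderiv ℝ f x = (fderiv ℂ f x).restrictScalars ℝ := (hf.hasFDerivAt.restrictScalars ℝ).fderiv
  unfold dzb dw
  rw [h]
  simp only [ContinuousLinearMap.coe_restrictScalars', map_smul, smul_eq_mul]
  rw [← mul_assoc, Complex.I_mul_I]; ring

lemma lpol_smooth {n : ℕ} (ρ : CSp n → ℝ) (ζ : CSp n) : ContDiff ℂ 2 (lpol ρ ζ) := by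
  have h0 : ∀ j : Fin n, ContDiff ℂ 2 (fun v : CSp n => v j) := fun j => (EuclideanSpace.proj j : CSp n →L[ℂ] ℂ).contDiff
  have h1 : ∀ l : CSp n →L[ℝ] ℝ, ContDiff ℂ 2 (clin l) := fun l => by
    unfold clin
    exact ContDiff.sum fun j _ => (h0 j).mul contDiff_const
  have h2 : ContDiff ℂ 2 (cquad (hes ρ ζ)) := by
    unfold cquad
    exact ContDiff.sum fun j _ => (h0 j).mul ((h1 _).add (contDiff_const.mul (h1 _)))
  unfold lpol
  exact ((h1 _).add (h2.div_const _)).neg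

/-- cutoff function -/
def chi {n : ℕ} (r : ℝ) (v : CSp n) : ℝ := Real.smoothTransition (2 - 4 * ‖v‖^2 / r^2)

lemma chi_smooth {n : ℕ} (r : ℝ) : ContDiff ℝ 2 (chi (n := n) r) := by
  have h2 : ContDiff ℝ 2 (fun y : CSp n => ‖y‖^2) := (contDiff_norm_sq ℂ (n := 2)).restrict_scalars ℝ
  exact Real.smoothTransition.contDiff.comp (contDiff_const.sub ((contDiff_const.mul h2).div_const _))

lemma chi_one {n : ℕ} {r : ℝ} (hr : 0 < r) {v : CSp n} (hv : ‖v‖ ≤ r/2) : chi r v = 1 := by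
  apply Real.smoothTransition.one_of_one_le
  have : 4 * ‖v‖^2 / r^2 ≤ 1 := by
    rw [div_le_one (by positivity)]; nlinarith [norm_nonneg v]
  linarith

lemma chi_zero {n : ℕ} {r : ℝ} (hr : 0 < r) {v : CSp n} (hv : 3/4 * r ≤ ‖v‖) : chi r v = 0 := by
  apply Real.smoothTransition.zero_of_nonpos
  have : 2 ≤ 4 * ‖v‖^2 / r^2 := by
    rw [le_div_iff₀ (by positivity)]; nlinarith [norm_nonneg v]
  linarith

lemma chi_bd {n : ℕ} (r : ℝ) (v : CSp n) : |chi r v| ≤ 1 := by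
  rw [chi, abs_of_nonneg (Real.smoothTransition.nonneg _)]; exact Real.smoothTransition.le_one _

lemma chi_fd {n : ℕ} (r : ℝ) : ∃ B : ℝ, 0 ≤ B ∧ ∀ ζ z : CSp n, ‖z - ζ‖ ≤ r → ‖fderiv ℝ (fun z => (chi r (z - ζ) : ℂ)) z‖ ≤ B := by
  have hs : ContDiff ℝ 2 (fun v : CSp n => (chi r v : ℂ)) := Complex.ofRealCLM.contDiff.comp (chi_smooth r)
  obtain ⟨B, hB⟩ := (isCompact_closedBall (0 : CSp n) r).exists_bound_of_continuousOn (f := fderiv ℝ (fun v : CSp n => (chi r v : ℂ)))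
    (hs.continuous_fderiv (by norm_num)).continuousOn
  refine ⟨|B|, abs_nonneg _, fun ζ z hz => ?_⟩
  rw [fderiv_comp_sub (f := fun v : CSp n => (chi r v : ℂ))]
  exact (hB _ (by rwa [mem_closedBall_zero_iff])).trans (le_abs_self _)

/-- peak functions -/
lemma Spc.peak {n : ℕ} {D U : Set (CSp n)} {ρ : CSp n → ℝ} (h : Spc D U ρ) :
    ∃ Ω', IsOpen Ω' ∧ closure D ⊆ Ω' ∧ ∃ r c C c2 C2 : ℝ, 0 < r ∧ 0 < c ∧ 0 < C ∧ 0 < c2 ∧ 0 < C2 ∧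
      ∀ ζ ∈ frontier D, ∀ M : ℝ, 0 ≤ M → ∃ g : CSp n → ℂ, DifferentiableOn ℂ g Ω' ∧ ∀ z ∈ closure D,
        ‖g z‖ ≤ Real.exp (-M * (-ρ z + c * ‖z - ζ‖^2)) + C2 * Real.exp (-c2 * M) ∧
        (‖z - ζ‖ ≤ r → Real.exp (-M * (-ρ z + C * ‖z - ζ‖^2)) - C2 * Real.exp (-c2 * M) ≤ ‖g z‖) := by
  obtain ⟨r, hr, c, hc, C, hC, hest⟩ := lpol_est h.smooth h.cptF (fun z hz => h.levi z (h.sub hz)) h.front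
  obtain ⟨Ω, P, C0, hW, hcl, hρδ⟩ := h.wgt (δ₀ := c * r^2 / 128) (by positivity)
  obtain ⟨σ, hσ, hσr, hσΩ, Ω', hΩ', hKΩ', A, hA, happ⟩ := dbar_approx hW h.cptC hcl (σ₀ := r/8) (by positivity)
  obtain ⟨B, hB0, hB⟩ := chi_fd (n := n) r
  refine ⟨Ω', hΩ', hKΩ', r/4, c, C, c * r^2/128, 1 + A * B, by positivity, hc, hC, by positivity, by positivity, ?_⟩
  intro ζ hζ M hM
  set e : CSp n → ℂ := fun z => Complex.exp (-M * lpol ρ ζ (z - ζ)) with he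
  set u : CSp n → ℂ := fun z => (chi r (z - ζ) : ℂ) * e z with hu
  have hed : Differentiable ℂ e := by
    have h1 : Differentiable ℂ (fun z : CSp n => z - ζ) := differentiable_id.sub_const ζ
    have h2 : Differentiable ℂ (fun z : CSp n => lpol ρ ζ (z - ζ)) := (lpol_diff ρ ζ).comp h1
    exact (h2.const_mul _).cexp
  have hen : ∀ z, ‖e z‖ = Real.exp (-M * (lpol ρ ζ (z - ζ)).re) := by
    intro z
    rw [he, Complex.norm_exp]; congr 1
    rw [← Complex.ofReal_neg, Complex.re_ofReal_mul]
  have hes' : ContDiff ℝ 2 e := by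
    have h1 : ContDiff ℂ 2 (fun z : CSp n => z - ζ) := contDiff_id.sub contDiff_const
    have h2 : ContDiff ℂ 2 (fun z : CSp n => lpol ρ ζ (z - ζ)) := (lpol_smooth ρ ζ).comp h1
    have h3 : ContDiff ℂ 2 e := (contDiff_const.mul h2).cexp
    exact h3.restrict_scalars ℝ
  have hchis : ContDiff ℝ 2 (fun z : CSp n => (chi r (z - ζ) : ℂ)) :=
    (Complex.ofRealCLM.contDiff.comp (chi_smooth r)).comp (contDiff_id.sub contDiff_const)
  have hus : ContDiff ℝ 2 u := hchis.mul hes'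
  have hun : ∀ z, ‖u z‖ ≤ ‖e z‖ := by
    intro z
    rw [hu, norm_mul, Complex.norm_real, Real.norm_eq_abs]
    exact mul_le_of_le_one_left (norm_nonneg _) (chi_bd _ _)
  have hu0 : ∀ z, r ≤ ‖z - ζ‖ → u z = 0 := by
    intro z hz
    rw [hu]; simp only; rw [chi_zero hr (by linarith)]; simp
  have hebd : ∀ z ∈ Ω, ∀ s, 0 ≤ s → s ≤ ‖z - ζ‖ → ‖z - ζ‖ ≤ r → ‖e z‖ ≤ Real.exp (-M * (c * s^2 - c * r^2/128)) := by
    intro z hz s hs hsz hzr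
    rw [hen]
    apply Real.exp_le_exp.2
    have h1 := (hest ζ hζ z hzr).1
    have h2 := hρδ z hz
    have h3 : c * s^2 ≤ c * ‖z - ζ‖^2 := by gcongr
    nlinarith
  obtain ⟨g, hg, hgK⟩ := happ u (Real.exp (-M * (c * 0^2 - c * r^2/128))) (B * Real.exp (-M * (c * (r/2)^2 - c * r^2/128)))
    (by positivity) hus.contDiffOn
    (by
      intro x hx
      by_cases hxr : ‖x - ζ‖ ≤ r
      · exact (hun x).trans (hebd x hx 0 le_rfl (norm_nonneg _) hxr)
      · rw [hu0 x (not_le.1 hxr).le, norm_zero]; positivity)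
    (by
      intro x hx j
      rcases lt_or_ge ‖x - ζ‖ (r/2) with hlt | hge
      · have : dzb j u x = dzb j e x := by
          apply dw_congr
          have hopen : IsOpen {y : CSp n | ‖y - ζ‖ < r/2} := isOpen_lt (by fun_prop) continuous_const
          filter_upwards [hopen.mem_nhds hlt] with y hy
          rw [hu]; simp only; rw [chi_one hr (le_of_lt (show ‖y - ζ‖ < r/2 from hy))]; simp
        rw [this, dzb_holo (hed x), norm_zero]; positivity
      · rcases lt_or_ge r ‖x - ζ‖ with hgt | hle
        · have : dzb j u x = dzb j (fun _ => 0) x := by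
            apply dw_congr
            have hopen : IsOpen {y : CSp n | r < ‖y - ζ‖} := isOpen_lt continuous_const (by fun_prop)
            filter_upwards [hopen.mem_nhds hgt] with y hy
            exact hu0 y (le_of_lt (show r < ‖y - ζ‖ from hy))
          rw [this, dzb_holo (differentiableAt_const _), norm_zero]; positivity
        · have : dzb j u x = dzb j (fun z => (chi r (z - ζ) : ℂ)) x * e x + (chi r (x - ζ) : ℂ) * dzb j e x :=
            dw_mul _ _ (hchis.differentiable (by norm_num) x) (hes'.differentiable (by norm_num) x)
          rw [this, dzb_holo (hed x), mul_zero, add_zero, norm_mul]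
          refine mul_le_mul ((norm_dw_le (by simp) j).trans (hB ζ x hle)) (hebd x hx _ (by positivity) hge hle) (norm_nonneg _) hB0)
  refine ⟨g, hg, fun z hz => ?_⟩
  have hgz := hgK z hz
  have hsmall : A * (B * Real.exp (-M * (c * (r/2)^2 - c * r^2/128))) ≤ A * B * Real.exp (-(c * r^2/128) * M) := by
    rw [← mul_assoc]
    refine mul_le_mul_of_nonneg_left (Real.exp_le_exp.2 ?_) (by positivity)
    nlinarith [show 0 ≤ M * (c * r^2) by positivity]
  have hE : 0 < Real.exp (-(c * r^2/128) * M) := Real.exp_pos _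
  rcases le_or_gt ‖z - ζ‖ (r/4) with hzr | hzr
  · have hm : mol σ u z = e z := by
      have hueq : ∀ y ∈ ball ζ (r/2), u y = e y := by
        intro y hy
        rw [mem_ball, dist_eq_norm] at hy
        rw [hu]; simp only; rw [chi_one hr hy.le]; simp
      have hzb : z ∈ ball ζ (r/2) := by rw [mem_ball, dist_eq_norm]; linarith
      rw [mean_value isOpen_ball (f := u) (hed.differentiableOn.congr hueq) hσ, hueq z hzb]
      intro y hy
      rw [mem_closedBall] at hy
      rw [mem_ball]
      have := dist_triangle y z ζ
      rw [dist_eq_norm z ζ] at this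
      linarith
    rw [hm] at hgz
    have hez := hen z
    obtain ⟨h1, h2⟩ := hest ζ hζ z (by linarith)
    have h3 : ‖e z‖ ≤ Real.exp (-M * (-ρ z + c * ‖z - ζ‖^2)) := by
      rw [hez]; apply Real.exp_le_exp.2; nlinarith
    have h4 : Real.exp (-M * (-ρ z + C * ‖z - ζ‖^2)) ≤ ‖e z‖ := by
      rw [hez]; apply Real.exp_le_exp.2; nlinarith
    have h5 := norm_sub_norm_le (g z) (e z)
    have h6 := norm_sub_norm_le (e z) (g z)
    rw [norm_sub_rev] at h6
    constructor
    · linarith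
    · intro _; linarith
  · refine ⟨?_, fun hle => absurd hle (not_le.2 hzr)⟩
    have hm : ‖mol σ u z‖ ≤ Real.exp (-(c * r^2/128) * M) := by
      apply mol_norm_le hσ
      intro y hy
      by_cases hyr : ‖y - ζ‖ ≤ r
      · have h1 : y ∈ Ω := hσΩ z hz (by rw [mem_closedBall, dist_comm, dist_eq_norm]; exact hy.le)
        have h2 : r/8 ≤ ‖y - ζ‖ := by
          have := norm_add_le (z - y) (y - ζ)
          rw [sub_add_sub_cancel] at this
          linarith
        refine (hun y).trans ((hebd y h1 _ (by positivity) h2 hyr).trans (Real.exp_le_exp.2 ?_))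
        nlinarith [show 0 ≤ M * (c * r^2) by positivity]
      · rw [hu0 y (not_le.1 hyr).le, norm_zero]; positivity
    have h5 := norm_sub_norm_le (g z) (mol σ u z)
    have h6 : 0 < Real.exp (-M * (-ρ z + c * ‖z - ζ‖^2)) := Real.exp_pos _
    linarith

open MeasureTheory

/-- real coordinates -/
def rc {n : ℕ} (z : CSp n) : Fin n ⊕ Fin n → ℝ := Sum.elim (fun j => (z j).re) (fun j => (z j).im)

lemma rc_sub {n : ℕ} (z w : CSp n) (a : Fin n ⊕ Fin n) : rc (z - w) a = rc z a - rc w a := by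
  cases a <;> simp [rc]

lemma rc_sum {n : ℕ} (z : CSp n) : ∑ a, rc z a ^ 2 = ‖z‖^2 := by
  rw [EuclideanSpace.norm_sq_eq, Fintype.sum_sum_type, ← Finset.sum_add_distrib]
  refine Finset.sum_congr rfl fun j _ => ?_
  rw [← Complex.normSq_eq_norm_sq, Complex.normSq_apply]
  simp [rc]; ring

lemma rc_le {n : ℕ} (z : CSp n) (a : Fin n ⊕ Fin n) : |rc z a| ≤ ‖z‖ := by
  have h : rc z a ^ 2 ≤ ‖z‖^2 := by
    rw [← rc_sum]
    exact Finset.single_le_sum (f := fun a => rc z a ^ 2) (fun _ _ => sq_nonneg _) (Finset.mem_univ a)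
  exact abs_le_of_sq_le_sq h (norm_nonneg _)

/-- index of the cube -/
def cub {n : ℕ} (s : ℝ) (z : CSp n) : Fin n ⊕ Fin n → ℤ := fun a => ⌊s * rc z a⌋

lemma sum_int_bd {q : ℝ} (hq0 : 0 ≤ q) (hq1 : q < 1) : ∃ B : ℝ, 0 ≤ B ∧ ∀ (T : Finset ℤ) (m : ℤ), ∑ x ∈ T, q ^ (m - x).natAbs ≤ B := by
  have hs : Summable (fun x : ℤ => q ^ x.natAbs) := by
    apply Summable.of_nat_of_neg
    · simpa using summable_geometric_of_lt_one hq0 hq1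
    · simpa using summable_geometric_of_lt_one hq0 hq1
  refine ⟨∑' x : ℤ, q ^ x.natAbs, tsum_nonneg fun x => by positivity, fun T m => ?_⟩
  have hs2 : Summable (fun x : ℤ => q ^ (m - x).natAbs) := by
    have e := ((Equiv.subLeft m).summable_iff (f := fun x : ℤ => q ^ x.natAbs)).2 hs
    refine e.congr fun x => ?_
    simp only [Function.comp_apply, Equiv.subLeft_apply]
  calc _ ≤ ∑' x : ℤ, q ^ (m - x).natAbs := hs2.sum_le_tsum T fun x _ => by positivity
    _ = _ := by
      rw [← (Equiv.subLeft m).tsum_eq (fun x : ℤ => q ^ x.natAbs)]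
      simp only [Equiv.subLeft_apply]

lemma exp_grid {c' : ℝ} (hc : 0 < c') (x y : ℝ) :
    Real.exp (-c' * (x - y)^2) ≤ Real.exp c' * Real.exp (-c'/2) ^ (⌊x⌋ - ⌊y⌋).natAbs := by
  rw [← Real.exp_nat_mul, ← Real.exp_add]
  apply Real.exp_le_exp.2
  set p : ℕ := (⌊x⌋ - ⌊y⌋).natAbs with hp
  have hp1 : (p : ℝ) = |(⌊x⌋ : ℝ) - ⌊y⌋| := by
    rw [hp, Nat.cast_natAbs]; push_cast; rfl
  have h1 : (p:ℝ) - 1 ≤ |x - y| := by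
    have hx := Int.fract_nonneg x
    have hx1 := Int.fract_lt_one x
    have hy := Int.fract_nonneg y
    have hy1 := Int.fract_lt_one y
    have ex : (⌊x⌋ : ℝ) = x - Int.fract x := by rw [Int.self_sub_fract]
    have ey : (⌊y⌋ : ℝ) = y - Int.fract y := by rw [Int.self_sub_fract]
    rw [hp1, ex, ey]
    have : |x - Int.fract x - (y - Int.fract y)| ≤ |x - y| + |Int.fract y - Int.fract x| := by
      rw [show x - Int.fract x - (y - Int.fract y) = (x - y) + (Int.fract y - Int.fract x) by ring]
      exact abs_add_le _ _
    have : |Int.fract y - Int.fract x| ≤ 1 := abs_le.2 ⟨by linarith, by linarith⟩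
    linarith
  have hpp : (p:ℝ) ≤ (p:ℝ)^2 := by exact_mod_cast Nat.le_self_pow (by norm_num) p
  have h2 : (p:ℝ)/2 - 1 ≤ (x - y)^2 := by
    rcases Nat.eq_zero_or_pos p with h0 | h0
    · rw [h0]; simp; nlinarith [sq_nonneg (x - y)]
    · have h3 : (0:ℝ) ≤ (p:ℝ) - 1 := by
        have : (1:ℝ) ≤ p := by exact_mod_cast h0
        linarith
      have h4 : ((p:ℝ) - 1)^2 ≤ (x - y)^2 := by
        rw [← sq_abs (x - y)]; gcongr
      nlinarith [sq_nonneg ((p:ℝ) - 2)]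
  nlinarith

lemma grid_sum (n : ℕ) {c' : ℝ} (hc : 0 < c') : ∃ B : ℝ, 0 ≤ B ∧ ∀ (s : ℝ) (I : Finset (CSp n)), InjOn (cub s) (I : Set (CSp n)) →
    ∀ z, ∑ ζ ∈ I, Real.exp (-c' * (s^2 * ‖z - ζ‖^2)) ≤ B := by
  obtain ⟨B, hB0, hB⟩ := sum_int_bd (q := Real.exp (-c'/2)) (Real.exp_nonneg _) (by rw [Real.exp_lt_one_iff]; linarith)
  refine ⟨(Real.exp c' * B) ^ (Fintype.card (Fin n ⊕ Fin n)), by positivity, fun s I hI z => ?_⟩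
  classical
  set ψ : (Fin n ⊕ Fin n) → ℤ → ℝ := fun a m => Real.exp c' * Real.exp (-c'/2) ^ (cub s z a - m).natAbs with hψ
  have h1 : ∀ ζ, Real.exp (-c' * (s^2 * ‖z - ζ‖^2)) ≤ ∏ a, ψ a (cub s ζ a) := by
    intro ζ
    rw [← rc_sum, Finset.mul_sum, Finset.mul_sum, Real.exp_sum]
    refine Finset.prod_le_prod (fun _ _ => by positivity) fun a _ => ?_
    have := exp_grid hc (s * rc z a) (s * rc ζ a)
    rw [rc_sub]
    refine le_trans (le_of_eq ?_) this
    congr 1; ring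
  set T : (Fin n ⊕ Fin n) → Finset ℤ := fun a => I.image (fun ζ => cub s ζ a) with hT
  calc ∑ ζ ∈ I, Real.exp (-c' * (s^2 * ‖z - ζ‖^2)) ≤ ∑ ζ ∈ I, ∏ a, ψ a (cub s ζ a) := Finset.sum_le_sum fun ζ _ => h1 ζ
    _ = ∑ κ ∈ I.image (cub s), ∏ a, ψ a (κ a) := by
        rw [Finset.sum_image]; exact hI
    _ ≤ ∑ κ ∈ Fintype.piFinset T, ∏ a, ψ a (κ a) := by
        refine Finset.sum_le_sum_of_subset_of_nonneg ?_ fun _ _ _ => Finset.prod_nonneg fun _ _ => by positivity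
        intro κ hκ
        obtain ⟨ζ, hζ, rfl⟩ := Finset.mem_image.1 hκ
        rw [Fintype.mem_piFinset]
        exact fun a => Finset.mem_image.2 ⟨ζ, hζ, rfl⟩
    _ = ∏ a, ∑ m ∈ T a, ψ a m := (Finset.prod_univ_sum T ψ).symm
    _ ≤ ∏ _a : Fin n ⊕ Fin n, (Real.exp c' * B) := by
        refine Finset.prod_le_prod (fun _ _ => Finset.sum_nonneg fun _ _ => by positivity) fun a _ => ?_
        rw [← Finset.mul_sum]
        exact mul_le_mul_of_nonneg_left (hB _ _) (Real.exp_nonneg _)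
    _ = _ := by rw [Finset.prod_const, Finset.card_univ]

/-- finite nets with colours -/
lemma grid_net {n : ℕ} {S : Set (CSp n)} (hS : Bornology.IsBounded S) {s : ℝ} (hs : 0 < s) (k : ℕ) :
    ∃ I : Finset (CSp n), (I : Set (CSp n)) ⊆ S ∧ InjOn (cub s) (I : Set (CSp n)) ∧ 
      (∀ z ∈ S, ∃ ζ ∈ I, s^2 * ‖z - ζ‖^2 ≤ 2 * n) ∧
      ∀ ζ ∈ I, ∀ ζ' ∈ I, ζ ≠ ζ' → (fun a => (cub s ζ a : ZMod k)) = (fun a => (cub s ζ' a : ZMod k)) → (k:ℝ) - 1 ≤ s * ‖ζ - ζ'‖ := by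
  obtain ⟨R, hR⟩ := hS.subset_closedBall 0
  have hfin : (cub s '' S).Finite := by
    refine (Set.finite_Icc (fun _ : Fin n ⊕ Fin n => ⌊-(s * R)⌋) (fun _ => ⌊s * R⌋)).subset ?_
    rintro _ ⟨z, hz, rfl⟩
    have h1 := mem_closedBall_zero_iff.1 (hR hz)
    have h2 : ∀ a, |s * rc z a| ≤ s * R := fun a => by
      rw [abs_mul, abs_of_pos hs]
      have := (rc_le z a).trans h1
      gcongr
    exact ⟨fun a => Int.floor_le_floor (abs_le.1 (h2 a)).1, fun a => Int.floor_le_floor (abs_le.1 (h2 a)).2⟩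
  obtain ⟨S', hS'S, hbij⟩ := Set.exists_subset_bijOn S (cub s)
  have hfin' : S'.Finite := by
    refine Set.Finite.of_finite_image ?_ hbij.injOn
    rw [hbij.image_eq]; exact hfin
  refine ⟨hfin'.toFinset, by simpa using hS'S, by simpa using hbij.injOn, ?_, ?_⟩
  · intro z hz
    obtain ⟨ζ, hζ, he⟩ := hbij.surjOn ⟨z, hz, rfl⟩
    refine ⟨ζ, by simpa using hζ, ?_⟩
    rw [← rc_sum, Finset.mul_sum]
    calc ∑ a, s^2 * rc (z - ζ) a ^ 2 ≤ ∑ _a : Fin n ⊕ Fin n, (1:ℝ) := by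
          refine Finset.sum_le_sum fun a _ => ?_
          have h1 : |s * rc z a - s * rc ζ a| < 1 := by
            apply Int.abs_sub_lt_one_of_floor_eq_floor
            exact (congrFun he a).symm
          rw [rc_sub, show s^2 * (rc z a - rc ζ a)^2 = (s * rc z a - s * rc ζ a)^2 by ring, ← sq_abs]
          exact pow_le_one₀ (abs_nonneg _) h1.le
      _ = 2 * n := by simp; ring
  · intro ζ hζ ζ' hζ' hne hcol
    have hne2 : cub s ζ ≠ cub s ζ' := fun he => hne (hbij.injOn (by simpa using hζ) (by simpa using hζ') he)
    obtain ⟨a, ha⟩ := Function.ne_iff.1 hne2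
    have hmod := congrFun hcol a
    have hdvd : (k:ℤ) ∣ cub s ζ a - cub s ζ' a := by
      rw [← ZMod.intCast_eq_intCast_iff_dvd_sub]; exact hmod.symm
    have h1 : (k:ℤ) ≤ |cub s ζ a - cub s ζ' a| := Int.le_of_dvd (abs_pos.2 (sub_ne_zero.2 ha)) ((dvd_abs _ _).2 hdvd)
    have h2 : (k:ℝ) ≤ |(cub s ζ a : ℝ) - cub s ζ' a| := by exact_mod_cast h1
    have h3 : |(cub s ζ a : ℝ) - cub s ζ' a| ≤ |s * rc ζ a - s * rc ζ' a| + 1 := by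
      have hx := Int.fract_nonneg (s * rc ζ a)
      have hx1 := Int.fract_lt_one (s * rc ζ a)
      have hy := Int.fract_nonneg (s * rc ζ' a)
      have hy1 := Int.fract_lt_one (s * rc ζ' a)
      have ex : (cub s ζ a : ℝ) = s * rc ζ a - Int.fract (s * rc ζ a) := by rw [Int.self_sub_fract]; rfl
      have ey : (cub s ζ' a : ℝ) = s * rc ζ' a - Int.fract (s * rc ζ' a) := by rw [Int.self_sub_fract]; rfl
      rw [ex, ey, show ∀ x y u v : ℝ, x - u - (y - v) = (x - y) + (v - u) by intros; ring]
      have : |Int.fract (s * rc ζ' a) - Int.fract (s * rc ζ a)| ≤ 1 := abs_le.2 ⟨by linarith, by linarith⟩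
      exact (abs_add_le _ _).trans (by linarith)
    have h4 : |s * rc ζ a - s * rc ζ' a| ≤ s * ‖ζ - ζ'‖ := by
      rw [← mul_sub, abs_mul, abs_of_pos hs, ← rc_sub]
      exact mul_le_mul_of_nonneg_left (rc_le _ _) hs.le
    linarith

open MeasureTheory

lemma ev_exp (A : ℝ) {a ε : ℝ} (ha : 0 < a) (hε : 0 < ε) : ∀ᶠ s : ℝ in atTop, A * Real.exp (-a * s^2) ≤ ε := by
  have h1 : Tendsto (fun s : ℝ => a * s^2) atTop atTop := (tendsto_pow_atTop (by norm_num)).const_mul_atTop ha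
  have h2 : Tendsto (fun s : ℝ => A * Real.exp (-(a * s^2))) atTop (𝓝 (A * 0)) := (Real.tendsto_exp_neg_atTop_nhds_zero.comp h1).const_mul A
  rw [mul_zero] at h2
  filter_upwards [h2.eventually (gt_mem_nhds hε)] with s hs
  rw [neg_mul]; exact hs.le

lemma ev_div (A : ℝ) {ε : ℝ} (hε : 0 < ε) : ∀ᶠ s : ℝ in atTop, A / s ≤ ε := by
  have h2 : Tendsto (fun s : ℝ => A / s) atTop (𝓝 0) := tendsto_const_nhds.div_atTop tendsto_id
  filter_upwards [h2.eventually (gt_mem_nhds hε)] with s hs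
  exact hs.le

set_option maxHeartbeats 1600000 in
/-- families of weights -/
lemma Spc.weights {n : ℕ} {D U : Set (CSp n)} {ρ : CSp n → ℝ} (h : Spc D U ρ) :
    ∃ (Λ : Type) (_ : Fintype Λ) (Ω' : Set (CSp n)) (B β : ℝ), IsOpen Ω' ∧ closure D ⊆ Ω' ∧ 0 < B ∧ 0 < β ∧
      ∀ τ > 0, ∃ (I : Finset (CSp n)) (col : CSp n → Λ) (g : CSp n → CSp n → ℂ) (δ d' : ℝ),
        0 < δ ∧ δ ≤ τ ∧ 0 < d' ∧ d' ≤ τ ∧ (∀ ζ ∈ I, ζ ∈ frontier D) ∧ (∀ ζ ∈ I, DifferentiableOn ℂ (g ζ) Ω') ∧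
        (∀ z ∈ closure D, ∑ ζ ∈ I, ‖g ζ z‖ ≤ B) ∧
        (∀ z ∈ closure D, ∀ I' ⊆ I, (∀ ζ ∈ I', τ ≤ ‖z - ζ‖) → ∑ ζ ∈ I', ‖g ζ z‖ ≤ τ) ∧
        (∀ z ∈ closure D, ρ z ≤ -τ → ∑ ζ ∈ I, ‖g ζ z‖ ≤ τ) ∧
        (∀ z ∈ closure D, ∀ I' ⊆ I, (∀ ζ ∈ I', δ ≤ ‖z - ζ‖) → ∑ ζ ∈ I', ‖g ζ z‖ ≤ β) ∧
        (∀ ζ ∈ I, ∀ ζ' ∈ I, ζ ≠ ζ' → col ζ = col ζ' → 2 * δ ≤ ‖ζ - ζ'‖) ∧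
        (∀ z ∈ closure D, -d' ≤ ρ z → ∃ ζ ∈ I, ‖z - ζ‖ < δ ∧ 4 * β ≤ ‖g ζ z‖) := by
  obtain ⟨Ω', hΩ', hcl, r, c, C, c2, C2, hr, hc, hC, hc2, hC2, hpk⟩ := h.peak
  obtain ⟨Δ, hΔ, hΔd⟩ : ∃ Δ : ℝ, 0 < Δ ∧ ∀ z ∈ closure D, ∀ ζ ∈ closure D, ‖z - ζ‖ ≤ Δ := by
    refine ⟨diam (closure D) + 1, by linarith [diam_nonneg (s := closure D)], fun z hz ζ hζ => ?_⟩
    have := dist_le_diam_of_mem h.cptC.isBounded hz hζ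
    rw [dist_eq_norm] at this
    linarith
  obtain ⟨B1, hB10, hB1⟩ := grid_sum n (c' := c/2) (by positivity)
  obtain ⟨B2, hB20, hB2⟩ := grid_sum n (c' := c2/(2*Δ^2)) (by positivity)
  set r0 : ℝ := 1 + Real.sqrt (2 * n) with hr0
  have hr0pos : 0 < r0 := by positivity
  set β : ℝ := Real.exp (-1 - C * r0^2) / 8 with hβ
  have hβ0 : 0 < β := by positivity
  obtain ⟨k, hkR, hkβ, hk1⟩ : ∃ k : ℕ, r0 < ((k:ℝ) - 1)/2 ∧ B1 * Real.exp (-(c/2) * (((k:ℝ) - 1)/2)^2) ≤ β/2 ∧ 1 ≤ k := by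
    have ht : Tendsto (fun k : ℕ => ((k:ℝ) - 1)/2) atTop atTop :=
      (tendsto_atTop_add_const_right _ (-1) tendsto_natCast_atTop_atTop).atTop_div_const (by norm_num)
    exact ((ht.eventually_gt_atTop r0).and ((ht.eventually (ev_exp B1 (by positivity : 0 < c/2) (by positivity : 0 < β/2))).and
      (eventually_ge_atTop 1))).exists
  set R : ℝ := ((k:ℝ) - 1)/2 with hR
  have : NeZero k := ⟨by omega⟩
  refine ⟨Fin n ⊕ Fin n → ZMod k, inferInstance, Ω', B1 + C2 * B2 + 1, β, hΩ', hcl, by positivity, hβ0, fun τ hτ => ?_⟩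
  obtain ⟨s, hs, e1, e2, e3, e4, e5, e6, e7⟩ := ((eventually_gt_atTop (0:ℝ)).and
    ((ev_exp (C2 * B2) (half_pos hc2) (half_pos hτ)).and ((ev_exp (C2 * B2) (half_pos hc2) (half_pos hβ0)).and
    ((ev_exp B1 (by positivity : 0 < c/2 * τ^2) (half_pos hτ)).and ((ev_exp B1 hτ (half_pos hτ)).and
    ((ev_exp C2 hc2 (by positivity : 0 < 4 * β)).and ((ev_div r0 hr).and (ev_div R hτ)))))))).exists
  obtain ⟨I, hIS, hIinj, hInet, hIcol⟩ := grid_net (S := frontier D) h.cptF.isBounded hs k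
  have hpk' : ∀ ζ, ∃ g : CSp n → ℂ, ζ ∈ I → DifferentiableOn ℂ g Ω' ∧ ∀ z ∈ closure D,
        ‖g z‖ ≤ Real.exp (-s^2 * (-ρ z + c * ‖z - ζ‖^2)) + C2 * Real.exp (-c2 * s^2) ∧
        (‖z - ζ‖ ≤ r → Real.exp (-s^2 * (-ρ z + C * ‖z - ζ‖^2)) - C2 * Real.exp (-c2 * s^2) ≤ ‖g z‖) := by
    intro ζ
    by_cases hζ : ζ ∈ I
    · obtain ⟨g, hg⟩ := hpk ζ (hIS hζ) (s^2) (by positivity)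
      exact ⟨g, fun _ => hg⟩
    · exact ⟨0, fun h => absurd h hζ⟩
  choose g hg using hpk'
  have hcount : ∀ z ∈ closure D, (I.card : ℝ) * (C2 * Real.exp (-c2 * s^2)) ≤ C2 * B2 * Real.exp (-(c2/2) * s^2) := by
    intro z hz
    have h1 := hB2 s I hIinj z
    have h2 : (I.card : ℝ) * Real.exp (-(c2/2) * s^2) ≤ B2 := by
      refine le_trans ?_ h1
      rw [← nsmul_eq_mul]
      refine Finset.card_nsmul_le_sum _ _ _ fun ζ hζ => ?_
      apply Real.exp_le_exp.2
      have h3 := hΔd z hz ζ (frontier_subset_closure (hIS hζ))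
      have h4 : ‖z - ζ‖^2 ≤ Δ^2 := by gcongr
      have h5 : c2/(2*Δ^2) * (s^2 * ‖z - ζ‖^2) ≤ c2/(2*Δ^2) * (s^2 * Δ^2) := by gcongr
      have h6 : c2/(2*Δ^2) * (s^2 * Δ^2) = c2/2 * s^2 := by field_simp
      linarith
    have h3 : Real.exp (-c2 * s^2) = Real.exp (-(c2/2) * s^2) * Real.exp (-(c2/2) * s^2) := by
      rw [← Real.exp_add]; congr 1; ring
    rw [h3]
    calc _ = C2 * ((I.card : ℝ) * Real.exp (-(c2/2) * s^2)) * Real.exp (-(c2/2) * s^2) := by ring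
      _ ≤ _ := by gcongr
  have key : ∀ z ∈ closure D, ∀ I' ⊆ I, ∀ t : ℝ, (∀ ζ ∈ I', t ≤ s^2 * ‖z - ζ‖^2) →
      ∑ ζ ∈ I', ‖g ζ z‖ ≤ B1 * Real.exp (s^2 * ρ z - c/2 * t) + C2 * B2 * Real.exp (-(c2/2) * s^2) := by
    intro z hz I' hI' t ht
    have h1 : ∑ ζ ∈ I', Real.exp (-(c/2) * (s^2 * ‖z - ζ‖^2)) ≤ B1 :=
      hB1 s I' (hIinj.mono (by exact_mod_cast hI')) z
    calc ∑ ζ ∈ I', ‖g ζ z‖ ≤ ∑ ζ ∈ I', (Real.exp (-(c/2) * (s^2 * ‖z - ζ‖^2)) * Real.exp (s^2 * ρ z - c/2 * t) + C2 * Real.exp (-c2 * s^2)) := by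
          refine Finset.sum_le_sum fun ζ hζ => (((hg ζ (hI' hζ)).2 z hz).1).trans ?_
          rw [← Real.exp_add]
          gcongr
          have := ht ζ hζ
          nlinarith
      _ = (∑ ζ ∈ I', Real.exp (-(c/2) * (s^2 * ‖z - ζ‖^2))) * Real.exp (s^2 * ρ z - c/2 * t) + I'.card * (C2 * Real.exp (-c2 * s^2)) := by
          rw [Finset.sum_add_distrib, Finset.sum_mul, Finset.sum_const, nsmul_eq_mul]
      _ ≤ B1 * Real.exp (s^2 * ρ z - c/2 * t) + I.card * (C2 * Real.exp (-c2 * s^2)) := by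
          have := Finset.card_le_card hI'
          gcongr
      _ ≤ _ := by linarith [hcount z hz]
  have hRpos : 0 < R := hr0pos.trans hkR
  have hnear : ∃ d0 > 0, ∀ z ∈ closure D, -d0 < ρ z → ∃ ζ' ∈ frontier D, s * ‖z - ζ'‖ ≤ 1 := by
    set K : Set (CSp n) := closure D \ thickening (1/s) (frontier D) with hK
    have hKc : IsCompact K := h.cptC.diff isOpen_thickening
    have hd0 : ∃ d0 > 0, ∀ z ∈ K, ρ z ≤ -d0 := by
      rcases K.eq_empty_or_nonempty with he | hne
      · exact ⟨1, one_pos, fun z hz => by rw [he] at hz; exact absurd hz (notMem_empty _)⟩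
      · obtain ⟨p, hp, hmax⟩ := hKc.exists_isMaxOn hne h.cont.continuousOn
        refine ⟨-ρ p, ?_, fun z hz => by simpa using hmax hz⟩
        have h1 := h.le_zero p hp.1
        rcases h1.lt_or_eq with h1 | h1
        · linarith
        · exfalso
          apply hp.2
          apply self_subset_thickening (by positivity)
          rw [h.open_D.frontier_eq]
          refine ⟨hp.1, fun hpD => ?_⟩
          rw [h.eq] at hpD
          have : ρ p < 0 := hpD
          linarith
    obtain ⟨d0, hd0, hd0K⟩ := hd0
    refine ⟨d0, hd0, fun z hz hzd => ?_⟩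
    have hzT : z ∈ thickening (1/s) (frontier D) := by
      by_contra hn
      linarith [hd0K z ⟨hz, hn⟩]
    obtain ⟨ζ', hζ', hd⟩ := mem_thickening_iff.1 hzT
    refine ⟨ζ', hζ', ?_⟩
    rw [dist_eq_norm, lt_div_iff₀ hs] at hd
    linarith
  obtain ⟨d0, hd0, hd0n⟩ := hnear
  refine ⟨I, fun ζ a => (cub s ζ a : ZMod k), g, R / s, min (min (1/s^2) τ) (d0/2), by positivity, e7, by positivity,
    (min_le_left _ _).trans (min_le_right _ _), fun ζ hζ => hIS hζ, fun ζ hζ => (hg ζ hζ).1, ?_, ?_, ?_, ?_, ?_, ?_⟩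
  · intro z hz
    have h1 := key z hz I le_rfl 0 (fun ζ _ => by positivity)
    have h2 : Real.exp (s^2 * ρ z - c/2 * 0) ≤ 1 := by
      rw [Real.exp_le_one_iff]
      nlinarith [h.le_zero z hz, sq_nonneg s]
    have h3 : Real.exp (-(c2/2) * s^2) ≤ 1 := by
      rw [Real.exp_le_one_iff]; nlinarith [sq_nonneg s]
    have h4 : B1 * Real.exp (s^2 * ρ z - c/2 * 0) ≤ B1 * 1 := by gcongr
    have h5 : C2 * B2 * Real.exp (-(c2/2) * s^2) ≤ C2 * B2 * 1 := by gcongr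
    linarith
  · intro z hz I' hI' hfar
    have h1 := key z hz I' hI' (s^2 * τ^2) (fun ζ hζ => by have := hfar ζ hζ; gcongr)
    have h2 : B1 * Real.exp (s^2 * ρ z - c/2 * (s^2 * τ^2)) ≤ B1 * Real.exp (-(c/2 * τ^2) * s^2) := by
      refine mul_le_mul_of_nonneg_left (Real.exp_le_exp.2 ?_) hB10
      nlinarith [h.le_zero z hz, sq_nonneg s]
    linarith
  · intro z hz hzτ
    have h1 := key z hz I le_rfl 0 (fun ζ _ => by positivity)
    have h2 : B1 * Real.exp (s^2 * ρ z - c/2 * 0) ≤ B1 * Real.exp (-τ * s^2) := by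
      refine mul_le_mul_of_nonneg_left (Real.exp_le_exp.2 ?_) hB10
      nlinarith [sq_nonneg s]
    linarith
  · intro z hz I' hI' hfar
    have h1 := key z hz I' hI' (R^2) (fun ζ hζ => by
      have := hfar ζ hζ
      rw [div_le_iff₀ hs] at this
      rw [← mul_pow, mul_comm s]; gcongr)
    have h2 : B1 * Real.exp (s^2 * ρ z - c/2 * R^2) ≤ B1 * Real.exp (-(c/2) * R^2) := by
      refine mul_le_mul_of_nonneg_left (Real.exp_le_exp.2 ?_) hB10
      nlinarith [h.le_zero z hz, sq_nonneg s]
    linarith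
  · intro ζ hζ ζ' hζ' hne hcol
    have := hIcol ζ hζ ζ' hζ' hne hcol
    rw [← mul_div_assoc, div_le_iff₀ hs, hR]
    linarith
  · intro z hz hzd
    obtain ⟨ζ', hζ', h1⟩ := hd0n z hz (by linarith [min_le_right (min (1/s^2) τ) (d0/2)])
    obtain ⟨ζ, hζ, h2⟩ := hInet ζ' hζ'
    have h3 : s * ‖ζ' - ζ‖ ≤ Real.sqrt (2 * n) := by
      apply Real.le_sqrt_of_sq_le
      rw [mul_pow]; exact h2
    have h4 : s * ‖z - ζ‖ ≤ r0 := by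
      have := norm_add_le (z - ζ') (ζ' - ζ)
      rw [sub_add_sub_cancel] at this
      nlinarith
    refine ⟨ζ, hζ, ?_, ?_⟩
    · rw [lt_div_iff₀ hs]; linarith
    · have h5 : ‖z - ζ‖ ≤ r := by
        refine le_trans ?_ e6
        rw [le_div_iff₀ hs]; linarith
      have h6 := (((hg ζ hζ).2 z hz).2) h5
      have h7 : Real.exp (-1 - C * r0^2) ≤ Real.exp (-s^2 * (-ρ z + C * ‖z - ζ‖^2)) := by
        apply Real.exp_le_exp.2
        have h8 : -ρ z ≤ 1/s^2 := by
          linarith [min_le_left (min (1/s^2) τ) (d0/2), min_le_left (1/s^2) τ]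
        rw [le_div_iff₀ (by positivity)] at h8
        have h9 : (s * ‖z - ζ‖)^2 ≤ r0^2 := by gcongr
        nlinarith
      have h10 : Real.exp (-1 - C * r0^2) = 8 * β := by rw [hβ]; ring
      linarith

open MeasureTheory

/-- coordinate blocks in the target space -/
lemma blocks (n N : ℕ) (Λ : Type) [Fintype Λ] (hN : n + 2 * Fintype.card Λ ≤ N) :
    ∃ (P : Λ → CSp N →L[ℂ] CSp N) (sel : Λ → CSp N → CSp N) (Q : CSp N →L[ℂ] CSp n) (J : CSp n →L[ℂ] CSp N),
      (∀ l v, ‖P l v‖ ≤ ‖v‖) ∧ (∀ l w, ‖sel l w‖ = 1) ∧ (∀ l w, inner ℂ w (sel l w) = 0) ∧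
      (∀ l w, P l (sel l w) = sel l w) ∧ (∀ l l' w, l ≠ l' → P l' (sel l w) = 0) ∧
      (∀ l w, Q (sel l w) = 0) ∧ (∀ v, Q (J v) = v) := by
  classical
  obtain ⟨e⟩ : Nonempty ((Fin n ⊕ (Λ × Fin 2)) ↪ Fin N) := by
    apply Function.Embedding.nonempty_of_card_le
    simp
    omega
  set b : Fin n ⊕ (Λ × Fin 2) → CSp N := fun i => EuclideanSpace.single (e i) (1:ℂ) with hb
  have hbi : ∀ i j, inner ℂ (b i) (b j) = if i = j then (1:ℂ) else 0 := by
    intro i j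
    simp only [hb, EuclideanSpace.inner_single_left, map_one, one_mul, PiLp.single_apply, e.injective.eq_iff]
  set K : Λ → Submodule ℂ (CSp N) := fun l => Submodule.span ℂ {b (Sum.inr (l, 0)), b (Sum.inr (l, 1))} with hK
  have hsel : ∀ (l : Λ) (w : CSp N), ∃ x y : ℂ, ‖x‖^2 + ‖y‖^2 = 1 ∧ x * inner ℂ w (b (Sum.inr (l, 0))) + y * inner ℂ w (b (Sum.inr (l, 1))) = 0 := by
    intro l w
    generalize inner ℂ w (b (Sum.inr (l, 0))) = p
    generalize inner ℂ w (b (Sum.inr (l, 1))) = q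
    by_cases hp : p = 0
    · exact ⟨1, 0, by simp, by simp [hp]⟩
    · have hpos : 0 < ‖q‖^2 + ‖p‖^2 := by
        have := norm_pos_iff.2 hp
        positivity
      refine ⟨-q / (Real.sqrt (‖q‖^2 + ‖p‖^2) : ℝ), p / (Real.sqrt (‖q‖^2 + ‖p‖^2) : ℝ), ?_, by ring⟩
      rw [norm_div, norm_div, norm_neg, Complex.norm_real, Real.norm_of_nonneg (Real.sqrt_nonneg _), div_pow, div_pow,
        Real.sq_sqrt hpos.le, ← add_div, div_self hpos.ne']
  choose x y hxy hxy0 using hsel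
  set Q0 : CSp N →ₗ[ℂ] CSp n :=
    { toFun := fun v => WithLp.toLp 2 fun i => v (e (Sum.inl i))
      map_add' := fun v w => by ext i; simp
      map_smul' := fun c v => by ext i; simp } with hQ0
  set J0 : CSp n →ₗ[ℂ] CSp N :=
    { toFun := fun v => ∑ i, v i • b (Sum.inl i)
      map_add' := fun v w => by simp [add_smul, Finset.sum_add_distrib]
      map_smul' := fun c v => by simp [Finset.smul_sum, smul_smul] } with hJ0
  set a : Λ → CSp N → CSp N := fun l w => x l w • b (Sum.inr (l, 0)) + y l w • b (Sum.inr (l, 1)) with ha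
  have haK : ∀ l w, a l w ∈ K l := fun l w => Submodule.mem_span_pair.2 ⟨x l w, y l w, rfl⟩
  refine ⟨fun l => (K l).starProjection, a, LinearMap.toContinuousLinearMap Q0, LinearMap.toContinuousLinearMap J0, ?_, ?_, ?_, ?_, ?_, ?_, ?_⟩
  · exact fun l v => Submodule.norm_starProjection_apply_le _ _
  · intro l w
    have h1 : inner ℂ (a l w) (a l w) = (1:ℂ) := by
      simp only [ha, inner_add_left, inner_add_right, inner_smul_left, inner_smul_right, hbi]
      have := hxy l w
      simp only [if_true, reduceCtorEq, Sum.inr.injEq, Prod.mk.injEq, true_and, zero_ne_one, one_ne_zero, if_false, mul_zero, mul_one, add_zero, zero_add]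
      rw [mul_comm, mul_comm (y l w), Complex.conj_mul', Complex.conj_mul']
      exact_mod_cast this
    have h2 : ‖a l w‖^2 = 1 := by rw [← inner_self_eq_norm_sq (𝕜 := ℂ), h1]; simp
    nlinarith [norm_nonneg (a l w)]
  · intro l w
    simp only [ha, inner_add_right, inner_smul_right]
    exact hxy0 l w
  · exact fun l w => Submodule.starProjection_eq_self_iff.2 (haK l w)
  · intro l l' w hl
    rw [Submodule.starProjection_apply_eq_zero_iff, Submodule.mem_orthogonal]
    intro u hu
    obtain ⟨s, t, rfl⟩ := Submodule.mem_span_pair.1 hu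
    simp only [ha, inner_add_left, inner_add_right, inner_smul_left, inner_smul_right, hbi]
    simp [hl.symm]
  · intro l w
    ext i
    simp [Q0, ha, hb, e.injective.eq_iff]
  · intro v
    ext i
    simp [Q0, J0, hb, e.injective.eq_iff]

/-- locally uniform limits of holomorphic maps are holomorphic -/
lemma holo_lim {E V : Type*} [NormedAddCommGroup E] [NormedSpace ℂ E] [NormedAddCommGroup V] [NormedSpace ℂ V] [CompleteSpace V]
    {f : ℕ → E → V} {g : E → V} {x : E} {r : ℝ} (hr : 0 < r) (hf : ∀ k, DifferentiableOn ℂ (f k) (ball x r))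
    (hu : UniformCauchySeqOn f atTop (ball x r)) (hg : ∀ y ∈ ball x r, Tendsto (fun k => f k y) atTop (𝓝 (g y))) :
    DifferentiableAt ℂ g x := by
  have hsub : ∀ y ∈ ball x (r/2), ball y (r/2) ⊆ ball x r := fun y hy =>
    ball_subset_ball' (by have := mem_ball.1 hy; linarith)
  have hdiff : ∀ k, ∀ y ∈ ball x r, DifferentiableAt ℂ (f k) y := fun k y hy => (hf k).differentiableAt (isOpen_ball.mem_nhds hy)
  have hu' : UniformCauchySeqOn (fun k => fderiv ℂ (f k)) atTop (ball x (r/2)) := by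
    rw [Metric.uniformCauchySeqOn_iff] at hu ⊢
    intro ε hε
    obtain ⟨N, hN⟩ := hu (ε * (r/4) / 2) (by positivity)
    refine ⟨N, fun k hk j hj y hy => ?_⟩
    have hyr : y ∈ ball x r := hsub y hy (mem_ball_self (by positivity))
    rw [dist_eq_norm]
    have : ‖fderiv ℂ (f k) y - fderiv ℂ (f j) y‖ ≤ ε/2 := by
      refine ContinuousLinearMap.opNorm_le_of_unit_norm (𝕜 := ℂ) (by positivity) fun v hv => ?_
      have hline : ∀ t : ℂ, ‖t‖ < r/2 → y + t • v ∈ ball x r := fun t ht => hsub y hy (by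
        rw [mem_ball, dist_eq_norm, add_sub_cancel_left, norm_smul, hv, mul_one]; exact ht)
      have hd : ∀ m, ∀ t : ℂ, ‖t‖ < r/2 → HasDerivAt (fun t : ℂ => f m (y + t • v)) (fderiv ℂ (f m) (y + t • v) v) t := by
        intro m t ht
        have h1 : HasDerivAt (fun t : ℂ => y + t • v) v t := by
          simpa using ((hasDerivAt_id t).smul_const v).const_add y
        exact (hdiff m _ (hline t ht)).hasFDerivAt.comp_hasDerivAt t h1
      have h2 : ∀ t : ℂ, ‖t‖ < r/2 → HasDerivAt (fun t : ℂ => f k (y + t • v) - f j (y + t • v)) (fderiv ℂ (f k) (y + t • v) v - fderiv ℂ (f j) (y + t • v) v) t :=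
        fun t ht => (hd k t ht).fun_sub (hd j t ht)
      have h3 := Complex.norm_deriv_le_of_forall_mem_sphere_norm_le (c := 0) (R := r/4) (C := ε * (r/4) / 2)
        (f := fun t : ℂ => f k (y + t • v) - f j (y + t • v)) (by positivity) ?_ ?_
      · rw [(h2 0 (by rw [norm_zero]; positivity)).deriv] at h3
        rw [zero_smul, add_zero] at h3
        refine h3.trans (le_of_eq ?_)
        field_simp
      · apply DifferentiableOn.diffContOnCl
        intro t ht
        have := closure_ball_subset_closedBall ht
        rw [mem_closedBall_zero_iff] at this
        exact (h2 t (by linarith)).differentiableAt.differentiableWithinAt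
      · intro t ht
        rw [mem_sphere_zero_iff_norm] at ht
        have := hN k hk j hj _ (hline t (by linarith))
        rw [dist_eq_norm] at this
        exact this.le
    linarith
  have hlim : ∀ y ∈ ball x (r/2), ∃ L : E →L[ℂ] V, Tendsto (fun k => fderiv ℂ (f k) y) atTop (𝓝 L) := fun y hy =>
    cauchySeq_tendsto_of_complete (hu'.cauchySeq hy)
  choose! g' hg' using hlim
  exact (hasFDerivAt_of_tendstoUniformlyOn isOpen_ball (hu'.tendstoUniformlyOn_of_tendsto hg')
    (fun k y hy => (hdiff k y (hsub y hy (mem_ball_self (by positivity)))).hasFDerivAt) (fun y hy => hg y (hsub y hy (mem_ball_self (by positivity)))) (mem_ball_self (by positivity))).differentiableAt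

open MeasureTheory

/-- localisation of weighted sums -/
lemma localize {n : ℕ} {K : Set (CSp n)} (hK : IsCompact K) {W : Type*} [NormedAddCommGroup W] {φ : CSp n → W}
    (hφ : ContinuousOn φ K) {B ε : ℝ} (hB : 0 < B) (hε : 0 < ε) :
    ∃ τ0 > 0, ∀ τ, 0 < τ → τ ≤ τ0 → (∀ z ∈ K, ∀ w ∈ K, ‖z - w‖ ≤ 2 * τ → ‖φ z - φ w‖ ≤ ε) ∧
      ∀ (I : Finset (CSp n)) (c : CSp n → ℝ), ∀ z ∈ K, (∀ ζ ∈ I, ζ ∈ K) → (∀ ζ, 0 ≤ c ζ) → ∑ ζ ∈ I, c ζ ≤ B →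
        (∀ I' ⊆ I, (∀ ζ ∈ I', τ ≤ ‖z - ζ‖) → ∑ ζ ∈ I', c ζ ≤ τ) → ∑ ζ ∈ I, c ζ * ‖φ ζ - φ z‖ ≤ ε := by
  obtain ⟨M, hM⟩ := hK.exists_bound_of_continuousOn (f := φ) hφ
  have huc := Metric.uniformContinuousOn_iff.1 (hK.uniformContinuousOn_of_continuous (f := φ) hφ)
  obtain ⟨δ1, hδ1, h1⟩ := huc (min ε (ε/(2*B))) (by positivity)
  refine ⟨min (δ1/3) (ε/(4*(|M|+1))), by positivity, fun τ hτ hτ0 => ?_⟩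
  have hτ1 : τ ≤ δ1/3 := hτ0.trans (min_le_left _ _)
  have hτ2 : τ ≤ ε/(4*(|M|+1)) := hτ0.trans (min_le_right _ _)
  have hu : ∀ z ∈ K, ∀ w ∈ K, ‖z - w‖ ≤ 2 * τ → ‖φ z - φ w‖ ≤ min ε (ε/(2*B)) := by
    intro z hz w hw hzw
    have := h1 z hz w hw (by rw [dist_eq_norm]; linarith)
    rw [dist_eq_norm] at this
    exact this.le
  refine ⟨fun z hz w hw hzw => (hu z hz w hw hzw).trans (min_le_left _ _), ?_⟩
  intro I c z hz hI hc hsum hfar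
  classical
  rw [← Finset.sum_filter_add_sum_filter_not I (fun ζ => τ ≤ ‖z - ζ‖)]
  have e1 : ∑ ζ ∈ I with τ ≤ ‖z - ζ‖, c ζ * ‖φ ζ - φ z‖ ≤ τ * (2 * (|M|+1)) := by
    calc _ ≤ ∑ ζ ∈ I with τ ≤ ‖z - ζ‖, c ζ * (2 * (|M|+1)) := by
          refine Finset.sum_le_sum fun ζ hζ => mul_le_mul_of_nonneg_left ?_ (hc ζ)
          have a1 := hM ζ (hI ζ (Finset.mem_filter.1 hζ).1)
          have a2 := hM z hz
          have := norm_sub_le (φ ζ) (φ z)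
          linarith [le_abs_self M]
      _ = (∑ ζ ∈ I with τ ≤ ‖z - ζ‖, c ζ) * (2 * (|M|+1)) := by rw [Finset.sum_mul]
      _ ≤ _ := by
          refine mul_le_mul_of_nonneg_right (hfar _ (Finset.filter_subset _ _) fun ζ hζ => (Finset.mem_filter.1 hζ).2) (by positivity)
  have e2 : ∑ ζ ∈ I with ¬ τ ≤ ‖z - ζ‖, c ζ * ‖φ ζ - φ z‖ ≤ B * (ε/(2*B)) := by
    calc _ ≤ ∑ ζ ∈ I with ¬ τ ≤ ‖z - ζ‖, c ζ * (ε/(2*B)) := by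
          refine Finset.sum_le_sum fun ζ hζ => mul_le_mul_of_nonneg_left ?_ (hc ζ)
          have := Finset.mem_filter.1 hζ
          refine (hu ζ (hI ζ this.1) z hz ?_).trans (min_le_right _ _)
          rw [norm_sub_rev]; linarith [not_le.1 this.2]
      _ = (∑ ζ ∈ I with ¬ τ ≤ ‖z - ζ‖, c ζ) * (ε/(2*B)) := by rw [Finset.sum_mul]
      _ ≤ _ := by
          refine mul_le_mul_of_nonneg_right (le_trans ?_ hsum) (by positivity)
          exact Finset.sum_le_sum_of_subset_of_nonneg (Finset.filter_subset _ _) fun ζ _ _ => hc ζ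
  have e3 : τ * (2 * (|M|+1)) ≤ ε/2 := by
    rw [le_div_iff₀ (by positivity)] at hτ2
    linarith
  have e4 : B * (ε/(2*B)) = ε/2 := by field_simp
  linarith

/-- block sums -/
lemma block_sum {n N : ℕ} {Λ : Type} [DecidableEq Λ] {P : Λ → CSp N →L[ℂ] CSp N} {I : Finset (CSp n)} {col : CSp n → Λ} {a : CSp n → CSp N}
    (hP : ∀ ζ, P (col ζ) (a ζ) = a ζ) (hP0 : ∀ ζ l, col ζ ≠ l → P l (a ζ) = 0) (c : CSp n → ℂ) (l : Λ) :
    P l (∑ ζ ∈ I, c ζ • a ζ) = ∑ ζ ∈ I with col ζ = l, c ζ • a ζ := by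
  rw [map_sum, Finset.sum_filter]
  refine Finset.sum_congr rfl fun ζ _ => ?_
  rw [map_smul]
  split_ifs with h1
  · rw [← h1, hP]
  · rw [hP0 ζ l h1, smul_zero]

lemma norm_sum_unit {n N : ℕ} (I : Finset (CSp n)) {a : CSp n → CSp N} (ha : ∀ ζ, ‖a ζ‖ = 1) (c : CSp n → ℂ) :
    ‖∑ ζ ∈ I, c ζ • a ζ‖ ≤ ∑ ζ ∈ I, ‖c ζ‖ := by
  refine (norm_sum_le _ _).trans (Finset.sum_le_sum fun ζ _ => ?_)
  rw [norm_smul, ha, mul_one]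

lemma block_low {n N : ℕ} {Λ : Type} {P : Λ → CSp N →L[ℂ] CSp N} {I : Finset (CSp n)} {col : CSp n → Λ} {a : CSp n → CSp N}
    (ha : ∀ ζ, ‖a ζ‖ = 1) (hP : ∀ ζ, P (col ζ) (a ζ) = a ζ) (hP0 : ∀ ζ l, col ζ ≠ l → P l (a ζ) = 0) (c : CSp n → ℂ)
    {z ζ : CSp n} (hζ : ζ ∈ I) {δ β : ℝ} (hfar : ∀ I' ⊆ I, (∀ ζ ∈ I', δ ≤ ‖z - ζ‖) → ∑ ζ ∈ I', ‖c ζ‖ ≤ β)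
    (hcol : ∀ ζ ∈ I, ∀ ζ' ∈ I, ζ ≠ ζ' → col ζ = col ζ' → 2 * δ ≤ ‖ζ - ζ'‖) :
    (‖z - ζ‖ ≤ δ → 4 * β ≤ ‖c ζ‖ → 3 * β ≤ ‖P (col ζ) (∑ ζ ∈ I, c ζ • a ζ)‖) ∧
    (‖z - ζ‖ = δ → ‖P (col ζ) (∑ ζ ∈ I, c ζ • a ζ)‖ ≤ β) := by
  classical
  have hother : ‖z - ζ‖ ≤ δ → ∀ ζ' ∈ I, ζ' ≠ ζ → col ζ' = col ζ → δ ≤ ‖z - ζ'‖ := by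
    intro hz ζ' hζ' hne hc
    have h1 := hcol ζ hζ ζ' hζ' hne.symm hc.symm
    have h2 := norm_sub_le (z - ζ') (z - ζ)
    rw [sub_sub_sub_cancel_left] at h2
    linarith
  rw [block_sum hP hP0]
  constructor
  · intro hz hc
    have hm : ζ ∈ Finset.filter (fun x => col x = col ζ) I := Finset.mem_filter.2 ⟨hζ, rfl⟩
    rw [← Finset.add_sum_erase _ _ hm]
    set S := ∑ x ∈ (Finset.filter (fun x => col x = col ζ) I).erase ζ, c x • a x with hS
    have h1 : ‖S‖ ≤ β := by
      refine (norm_sum_unit _ ha _).trans (hfar _ ((Finset.erase_subset _ _).trans (Finset.filter_subset _ _)) fun ζ' hζ' => ?_)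
      rw [Finset.mem_erase, Finset.mem_filter] at hζ'
      exact hother hz ζ' hζ'.2.1 hζ'.1 hζ'.2.2
    have h2 := norm_sub_norm_le (c ζ • a ζ) (-S)
    rw [norm_smul, ha, norm_neg, sub_neg_eq_add] at h2
    linarith
  · intro hz
    refine (norm_sum_unit _ ha _).trans (hfar _ (Finset.filter_subset _ _) fun ζ' hζ' => ?_)
    rw [Finset.mem_filter] at hζ'
    by_cases hne : ζ' = ζ
    · rw [hne, hz]
    · exact hother hz.le ζ' hζ'.1 hne hζ'.2

open MeasureTheory

/-- the conclusion of `Spc.weights` for given constants -/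
def Weights {n : ℕ} (D : Set (CSp n)) (ρ : CSp n → ℝ) (Λ : Type) (Ω' : Set (CSp n)) (B β : ℝ) : Prop :=
      ∀ τ > 0, ∃ (I : Finset (CSp n)) (col : CSp n → Λ) (g : CSp n → CSp n → ℂ) (δ d' : ℝ),
        0 < δ ∧ δ ≤ τ ∧ 0 < d' ∧ d' ≤ τ ∧ (∀ ζ ∈ I, ζ ∈ frontier D) ∧ (∀ ζ ∈ I, DifferentiableOn ℂ (g ζ) Ω') ∧
        (∀ z ∈ closure D, ∑ ζ ∈ I, ‖g ζ z‖ ≤ B) ∧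
        (∀ z ∈ closure D, ∀ I' ⊆ I, (∀ ζ ∈ I', τ ≤ ‖z - ζ‖) → ∑ ζ ∈ I', ‖g ζ z‖ ≤ τ) ∧
        (∀ z ∈ closure D, ρ z ≤ -τ → ∑ ζ ∈ I, ‖g ζ z‖ ≤ τ) ∧
        (∀ z ∈ closure D, ∀ I' ⊆ I, (∀ ζ ∈ I', δ ≤ ‖z - ζ‖) → ∑ ζ ∈ I', ‖g ζ z‖ ≤ β) ∧
        (∀ ζ ∈ I, ∀ ζ' ∈ I, ζ ≠ ζ' → col ζ = col ζ' → 2 * δ ≤ ‖ζ - ζ'‖) ∧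
        (∀ z ∈ closure D, -d' ≤ ρ z → ∃ ζ ∈ I, ‖z - ζ‖ < δ ∧ 4 * β ≤ ‖g ζ z‖)

/-- choice of the small parameter -/
lemma small_param {κ β m θ η : ℝ} (hκ : 0 < κ) (hβ : 0 < β) (hm : 0 < m) (hθ : 0 < θ) (hη : 0 < η) :
    ∃ ε > 0, κ^2 * (2 * ε^2) + 2 * κ * ε ≤ θ * m / 2 ∧ κ^2 * ε^2 + 2 * κ * ε ≤ κ^2 * β^2 * m / 2 ∧ 2 * κ * ε ≤ η ∧
      κ * (3 * β * ε + 2 * ε) + ε ≤ κ * β * Real.sqrt m := by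
  have hev : ∀ {f : ℝ → ℝ} {c : ℝ}, Continuous f → f 0 = 0 → 0 < c → ∀ᶠ e in 𝓝[>] (0:ℝ), f e ≤ c := by
    intro f c hf hf0 hc
    have h1 : Tendsto f (𝓝 0) (𝓝 0) := by
      have := hf.tendsto 0
      rwa [hf0] at this
    filter_upwards [(h1.eventually (gt_mem_nhds hc)).filter_mono nhdsWithin_le_nhds] with e he
    exact he.le
  have hs : 0 < Real.sqrt m := Real.sqrt_pos.2 hm
  obtain ⟨e, h0, h1, h2, h3, h4⟩ := ((show ∀ᶠ e in 𝓝[>] (0:ℝ), 0 < e from self_mem_nhdsWithin).and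
    ((hev (f := fun ε => κ^2 * (2 * ε^2) + 2 * κ * ε) (by fun_prop) (by simp) (by positivity : 0 < θ * m / 2)).and
    ((hev (f := fun ε => κ^2 * ε^2 + 2 * κ * ε) (by fun_prop) (by simp) (by positivity : 0 < κ^2 * β^2 * m / 2)).and
    ((hev (f := fun ε => 2 * κ * ε) (by fun_prop) (by simp) hη).and
    (hev (f := fun ε => κ * (3 * β * ε + 2 * ε) + ε) (by fun_prop) (by simp) (by positivity : 0 < κ * β * Real.sqrt m)))))).exists
  exact ⟨e, h0, h1, h2, h3, h4⟩

lemma gap_calc {κ θ B β m ε f x S : ℝ} (hκ2 : κ^2 * (2 * B)^2 = θ) (hB : 0 < B) (hθ : 0 < θ) (hg : m ≤ 1 - f)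
    (b1 : -(κ * ε) ≤ x ∧ x ≤ κ * ε) (b4 : S ≤ 2 * (1 - f) * B^2 + 2 * ε^2) (b5 : 9/2 * β^2 * (1 - f) - ε^2 ≤ S)
    (p1 : κ^2 * (2 * ε^2) + 2 * κ * ε ≤ θ * m / 2) (p2 : κ^2 * ε^2 + 2 * κ * ε ≤ κ^2 * β^2 * m / 2) :
    (1 - θ) * (1 - f) ≤ 1 - (f + 2 * x + κ^2 * S) ∧ 1 - (f + 2 * x + κ^2 * S) ≤ (1 - β^2/B^2 * θ) * (1 - f) := by
  obtain ⟨G, hG⟩ : ∃ G, G = 1 - f := ⟨_, rfl⟩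
  rw [← hG] at hg b4 b5 ⊢
  obtain ⟨b1, b1'⟩ := b1
  have b4' := mul_le_mul_of_nonneg_left b4 (sq_nonneg κ)
  have b5' := mul_le_mul_of_nonneg_left b5 (sq_nonneg κ)
  have hGm : θ * m ≤ θ * G := by gcongr
  have hGm' : κ^2 * β^2 * m ≤ κ^2 * β^2 * G := by gcongr
  constructor
  · have e1 : κ^2 * (2 * G * B^2) = θ * G / 2 := by rw [← hκ2]; ring
    linarith
  · have e1 : β^2/B^2 * θ * G = 4 * (κ^2 * β^2 * G) := by rw [← hκ2]; field_simp; ring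
    linarith

set_option maxHeartbeats 1600000 in
/-- Step lemma -/
lemma Spc.step {n N : ℕ} {D U : Set (CSp n)} {ρ : CSp n → ℝ} (h : Spc D U ρ) {Λ : Type} {Ω' : Set (CSp n)} {B β : ℝ}
    (hW : Weights D ρ Λ Ω' B β) (hcl : closure D ⊆ Ω') (hB : 0 < B) (hβ : 0 < β)
    {P : Λ → CSp N →L[ℂ] CSp N} {sel : Λ → CSp N → CSp N} {Q : CSp N →L[ℂ] CSp n}
    (hPn : ∀ l v, ‖P l v‖ ≤ ‖v‖) (hsn : ∀ l w, ‖sel l w‖ = 1) (hsi : ∀ l w, inner ℂ w (sel l w) = 0)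
    (hPs : ∀ l w, P l (sel l w) = sel l w) (hPs0 : ∀ l l' w, l ≠ l' → P l' (sel l w) = 0) (hQs : ∀ l w, Q (sel l w) = 0)
    {F : CSp n → CSp N} (hF : DifferentiableOn ℂ F Ω') {θ m d η : ℝ} (hθ : 0 < θ) (hm : 0 < m)
    (hd : 0 < d) (hη : 0 < η) (hgap : ∀ z ∈ frontier D, m ≤ 1 - ‖F z‖^2) :
    ∃ F' : CSp n → CSp N, DifferentiableOn ℂ F' Ω' ∧ (∀ z, Q (F' z) = Q (F z)) ∧
      (∀ z ∈ frontier D, (1 - θ) * (1 - ‖F z‖^2) ≤ 1 - ‖F' z‖^2 ∧ 1 - ‖F' z‖^2 ≤ (1 - β^2/B^2 * θ) * (1 - ‖F z‖^2)) ∧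
      (∀ z ∈ closure D, ρ z ≤ -d → ‖F' z - F z‖ ≤ η) ∧
      (∀ z ∈ closure D, ‖F z‖^2 - η ≤ ‖F' z‖^2) ∧
      ∃ d' > 0, d' < d ∧ ∀ (γ : ℝ → CSp n) (a b : ℝ), a ≤ b → ContinuousOn γ (Icc a b) → (∀ t ∈ Icc a b, γ t ∈ closure D) →
        ρ (γ a) ≤ -d → -d' ≤ ρ (γ b) → ∃ s ∈ Icc a b, β / (2 * B) * Real.sqrt (θ * m) ≤ ‖F' (γ b) - F' (γ s)‖ := by
  set κ : ℝ := Real.sqrt θ / (2 * B) with hκ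
  have hκ0 : 0 < κ := by have := Real.sqrt_pos.2 hθ; positivity
  have hκ2 : κ^2 * (2 * B)^2 = θ := by rw [hκ, div_pow, Real.sq_sqrt hθ.le]; field_simp
  obtain ⟨ε, hε, p1, p2, p3, p4⟩ := small_param hκ0 hβ hm hθ hη
  set r : CSp n → ℝ := fun z => Real.sqrt (1 - ‖F z‖^2) with hr
  have hFc : ContinuousOn F (closure D) := (hF.continuousOn).mono hcl
  have hrc : ContinuousOn r (closure D) := Real.continuous_sqrt.comp_continuousOn (continuousOn_const.sub (hFc.norm.pow 2))
  have hr0 : ∀ z, 0 ≤ r z := fun z => Real.sqrt_nonneg _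
  have hr1 : ∀ z, r z ≤ 1 := fun z => Real.sqrt_le_one.2 (by nlinarith [sq_nonneg ‖F z‖])
  obtain ⟨τ1, hτ1, hl1⟩ := localize h.cptC hFc hB hε
  obtain ⟨τ2, hτ2, hl2⟩ := localize h.cptC hrc hB hε
  obtain ⟨τ3, hτ3, hl3⟩ := localize h.cptC (h.cont.continuousOn (s := closure D)) hB (half_pos hd)
  obtain ⟨τ, hτ, q1, q2, q3, q4, q5⟩ : ∃ τ > 0, τ ≤ τ1 ∧ τ ≤ τ2 ∧ τ ≤ τ3 ∧ τ ≤ η / κ ∧ τ ≤ d/2 :=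
    ⟨min (min τ1 τ2) (min τ3 (min (η/κ) (d/2))), by positivity, by simp, by simp, by simp, by simp, by simp⟩
  obtain ⟨I, col, g, δ, d', hδ, hδτ, hd', hd'τ, hIf, hgd, hgB, hgfar, hgint, hgβ, hcol, hgnear⟩ := hW τ hτ
  obtain ⟨u1, l1⟩ := hl1 τ hτ q1
  obtain ⟨u2, l2⟩ := hl2 τ hτ q2
  obtain ⟨u3, -⟩ := hl3 τ hτ q3
  have hIc : ∀ ζ ∈ I, ζ ∈ closure D := fun ζ hζ => frontier_subset_closure (hIf ζ hζ)
  have L1 : ∀ z ∈ closure D, ∑ ζ ∈ I, ‖g ζ z‖ * ‖F ζ - F z‖ ≤ ε := fun z hz =>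
    l1 I (fun ζ => ‖g ζ z‖) z hz hIc (fun ζ => norm_nonneg _) (hgB z hz) (hgfar z hz)
  have L2 : ∀ z ∈ closure D, ∑ ζ ∈ I, ‖g ζ z‖ * ‖r ζ - r z‖ ≤ ε := fun z hz =>
    l2 I (fun ζ => ‖g ζ z‖) z hz hIc (fun ζ => norm_nonneg _) (hgB z hz) (hgfar z hz)
  set a : CSp n → CSp N := fun ζ => sel (col ζ) (F ζ) with ha
  have han : ∀ ζ, ‖a ζ‖ = 1 := fun ζ => hsn _ _
  have haP : ∀ ζ, P (col ζ) (a ζ) = a ζ := fun ζ => hPs _ _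
  have haP0 : ∀ ζ l, col ζ ≠ l → P l (a ζ) = 0 := fun ζ l hl => hPs0 _ _ _ hl
  set E : CSp n → CSp N := fun z => ∑ ζ ∈ I, g ζ z • a ζ with hE
  set S : CSp n → CSp N := fun z => ∑ ζ ∈ I, (g ζ z * (r ζ : ℂ)) • a ζ with hS
  have hEB : ∀ z ∈ closure D, ‖E z‖ ≤ B := fun z hz => (norm_sum_unit I han _).trans (hgB z hz)
  have hSE : ∀ z ∈ closure D, ‖S z - (r z : ℂ) • E z‖ ≤ ε := by
    intro z hz
    have e1 : S z - (r z : ℂ) • E z = ∑ ζ ∈ I, (g ζ z * ((r ζ - r z : ℝ) : ℂ)) • a ζ := by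
      simp only [hS, hE, Finset.smul_sum, ← Finset.sum_sub_distrib, smul_smul, ← sub_smul]
      refine Finset.sum_congr rfl fun ζ _ => ?_
      congr 1; push_cast; ring
    rw [e1]
    refine (norm_sum_unit I han _).trans (le_trans (le_of_eq ?_) (L2 z hz))
    refine Finset.sum_congr rfl fun ζ _ => ?_
    rw [norm_mul, Complex.norm_real]
  have hSI : ∀ z ∈ closure D, ‖inner ℂ (F z) (S z)‖ ≤ ε := by
    intro z hz
    rw [hS]
    simp only [inner_sum, inner_smul_right]
    refine (norm_sum_le _ _).trans ((Finset.sum_le_sum fun ζ _ => ?_).trans (L1 z hz))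
    have e1 : inner ℂ (F z) (a ζ) = inner ℂ (F z - F ζ) (a ζ) := by
      rw [inner_sub_left, hsi, sub_zero]
    rw [e1, norm_mul, norm_mul, Complex.norm_real, Real.norm_of_nonneg (hr0 ζ), norm_sub_rev (F ζ)]
    have e2 := norm_inner_le_norm (𝕜 := ℂ) (F z - F ζ) (a ζ)
    rw [han, mul_one] at e2
    have e3 := hr1 ζ
    calc ‖g ζ z‖ * r ζ * ‖inner ℂ (F z - F ζ) (a ζ)‖ ≤ ‖g ζ z‖ * 1 * ‖F z - F ζ‖ := by gcongr
      _ = _ := by ring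
  set F' : CSp n → CSp N := fun z => F z + (κ : ℂ) • S z with hF'
  have hexp : ∀ z, ‖F' z‖^2 = ‖F z‖^2 + 2 * (κ * (inner ℂ (F z) (S z)).re) + κ^2 * ‖S z‖^2 := by
    intro z
    have e1 := norm_add_sq (𝕜 := ℂ) (F z) ((κ : ℂ) • S z)
    rw [inner_smul_right, norm_smul, Complex.norm_real, Real.norm_of_nonneg hκ0.le, mul_pow] at e1
    rw [hF']
    simp only
    rw [e1]
    congr 3
    exact Complex.re_ofReal_mul _ _
  have hre : ∀ z ∈ closure D, |κ * (inner ℂ (F z) (S z)).re| ≤ κ * ε := by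
    intro z hz
    rw [abs_mul, abs_of_pos hκ0]
    exact mul_le_mul_of_nonneg_left ((Complex.abs_re_le_norm _).trans (hSI z hz)) hκ0.le
  have hlow : ∀ z ∈ closure D, ∀ ζ ∈ I, ‖z - ζ‖ ≤ δ → 4 * β ≤ ‖g ζ z‖ → 3 * β ≤ ‖P (col ζ) (E z)‖ := fun z hz ζ hζ =>
    (block_low han haP haP0 (fun ζ => g ζ z) hζ (hgβ z hz) hcol).1
  have hupp : ∀ z ∈ closure D, ∀ ζ ∈ I, ‖z - ζ‖ = δ → ‖P (col ζ) (E z)‖ ≤ β := fun z hz ζ hζ =>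
    (block_low han haP haP0 (fun ζ => g ζ z) hζ (hgβ z hz) hcol).2
  refine ⟨F', ?_, ?_, ?_, ?_, ?_, d', hd', by linarith, ?_⟩
  · have hSd : DifferentiableOn ℂ S Ω' := by
      rw [hS]
      refine DifferentiableOn.fun_sum fun ζ hζ => ?_
      exact ((hgd ζ hζ).mul_const _).smul_const _
    exact hF.fun_add (hSd.fun_const_smul (κ : ℂ))
  · intro z
    simp only [hF', hS, map_add, map_smul, map_sum]
    rw [Finset.sum_eq_zero fun ζ _ => by rw [ha]; simp only; rw [hQs, smul_zero]]
    simp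
  · intro z hz
    have hzc : z ∈ closure D := frontier_subset_closure hz
    have hg := hgap z hz
    have hrsq : r z ^2 = 1 - ‖F z‖^2 := Real.sq_sqrt (by linarith)
    have hRE : ‖(r z : ℂ) • E z‖ = r z * ‖E z‖ := by rw [norm_smul, Complex.norm_real, Real.norm_of_nonneg (hr0 z)]
    have hE3 : 3 * β ≤ ‖E z‖ := by
      obtain ⟨ζ, hζ, a1, a2⟩ := hgnear z hzc (by rw [h.front z hz]; linarith)
      exact (hlow z hzc ζ hζ a1.le a2).trans (hPn _ _)
    have b1 := abs_le.1 (hre z hzc)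
    have b2 : ‖S z‖ ≤ r z * B + ε := by
      have := norm_sub_norm_le (S z) ((r z : ℂ) • E z)
      rw [hRE] at this
      have := mul_le_mul_of_nonneg_left (hEB z hzc) (hr0 z)
      linarith [hSE z hzc]
    have b3 : r z * (3 * β) ≤ ‖S z‖ + ε := by
      have := norm_sub_norm_le ((r z : ℂ) • E z) (S z)
      rw [hRE, norm_sub_rev] at this
      have := mul_le_mul_of_nonneg_left hE3 (hr0 z)
      linarith [hSE z hzc]
    have b4 : ‖S z‖^2 ≤ 2 * (1 - ‖F z‖^2) * B^2 + 2 * ε^2 := by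
      rw [← hrsq]
      have : ‖S z‖^2 ≤ (r z * B + ε)^2 := by gcongr
      nlinarith [sq_nonneg (r z * B - ε)]
    have b5 : 9/2 * β^2 * (1 - ‖F z‖^2) - ε^2 ≤ ‖S z‖^2 := by
      rw [← hrsq]
      have : (r z * (3 * β))^2 ≤ (‖S z‖ + ε)^2 := by
        have := hr0 z
        gcongr
      nlinarith [sq_nonneg (‖S z‖ - ε)]
    have b4' := mul_le_mul_of_nonneg_left b4 (sq_nonneg κ)
    have b5' := mul_le_mul_of_nonneg_left b5 (sq_nonneg κ)
    rw [hexp z]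
    exact gap_calc hκ2 hB hθ hg b1 b4 b5 p1 p2
  · intro z hz hzd
    have e1 : F' z - F z = (κ : ℂ) • S z := by simp [hF']
    rw [e1, norm_smul, Complex.norm_real, Real.norm_of_nonneg hκ0.le]
    have e2 : ‖S z‖ ≤ τ := by
      refine (norm_sum_unit I han _).trans (le_trans (Finset.sum_le_sum fun ζ _ => ?_) (hgint z hz (by linarith)))
      rw [norm_mul, Complex.norm_real, Real.norm_of_nonneg (hr0 ζ)]
      exact mul_le_of_le_one_right (norm_nonneg _) (hr1 ζ)
    rw [le_div_iff₀ hκ0] at q4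
    nlinarith
  · intro z hz
    rw [hexp z]
    have b1 := abs_le.1 (hre z hz)
    have : 0 ≤ κ^2 * ‖S z‖^2 := by positivity
    linarith
  · intro γ s0 b hab hγ hγD ha0 hb0
    have hbD := hγD b (right_mem_Icc.2 hab)
    obtain ⟨ζ, hζ, a1, a2⟩ := hgnear (γ b) hbD hb0
    have hζc := hIc ζ hζ
    have hstart : δ ≤ ‖γ s0 - ζ‖ := by
      by_contra hlt
      have e1 := u3 (γ s0) (hγD s0 (left_mem_Icc.2 hab)) ζ hζc (by linarith [not_le.1 hlt])
      rw [h.front ζ (hIf ζ hζ), sub_zero, Real.norm_eq_abs] at e1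
      have := neg_le_of_abs_le e1
      linarith
    obtain ⟨s, hs, hsδ⟩ := intermediate_value_Icc' hab (f := fun t => ‖γ t - ζ‖) ((hγ.sub continuousOn_const).norm) ⟨a1.le, hstart⟩
    simp only at hsδ
    refine ⟨s, hs, ?_⟩
    have hsD := hγD s hs
    have hbs : ‖γ b - γ s‖ ≤ 2 * τ := by
      have := norm_sub_le (γ b - ζ) (γ s - ζ)
      rw [sub_sub_sub_cancel_right] at this
      linarith
    have f1 := u1 _ hbD _ hsD hbs
    have f2 := u2 _ hbD _ hsD hbs
    have f3 := u2 _ hbD ζ hζc (by linarith)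
    rw [Real.norm_eq_abs] at f2 f3
    have f4 : Real.sqrt m ≤ r ζ := Real.sqrt_le_sqrt (hgap ζ (hIf ζ hζ))
    have g1 := hlow _ hbD ζ hζ a1.le a2
    have g2 := hupp _ hsD ζ hζ hsδ
    have hPE : ∀ z, ‖P (col ζ) ((r z : ℂ) • E z)‖ = r z * ‖P (col ζ) (E z)‖ := by
      intro z; rw [map_smul, norm_smul, Complex.norm_real, Real.norm_of_nonneg (hr0 z)]
    have hPS : ∀ z ∈ closure D, ‖P (col ζ) (S z) - P (col ζ) ((r z : ℂ) • E z)‖ ≤ ε := by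
      intro z hz; rw [← map_sub]; exact (hPn _ _).trans (hSE z hz)
    have k1 : r (γ b) * (3 * β) - ε ≤ ‖P (col ζ) (S (γ b))‖ := by
      have := norm_sub_norm_le (P (col ζ) ((r (γ b) : ℂ) • E (γ b))) (P (col ζ) (S (γ b)))
      rw [hPE, norm_sub_rev] at this
      have := mul_le_mul_of_nonneg_left g1 (hr0 (γ b))
      linarith [hPS _ hbD]
    have k2 : ‖P (col ζ) (S (γ s))‖ ≤ r (γ s) * β + ε := by
      have := norm_sub_norm_le (P (col ζ) (S (γ s))) (P (col ζ) ((r (γ s) : ℂ) • E (γ s)))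
      rw [hPE] at this
      have := mul_le_mul_of_nonneg_left g2 (hr0 (γ s))
      linarith [hPS _ hsD]
    have k3 : κ * (‖P (col ζ) (S (γ b))‖ - ‖P (col ζ) (S (γ s))‖) - ε ≤ ‖F' (γ b) - F' (γ s)‖ := by
      have e1 : P (col ζ) (F' (γ b) - F' (γ s)) = P (col ζ) (F (γ b) - F (γ s)) + (κ : ℂ) • (P (col ζ) (S (γ b)) - P (col ζ) (S (γ s))) := by
        simp only [hF', map_sub, map_add, map_smul, smul_sub]; abel
      have e2 := hPn (col ζ) (F' (γ b) - F' (γ s))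
      rw [e1] at e2
      have e3 := norm_sub_norm_le ((κ : ℂ) • (P (col ζ) (S (γ b)) - P (col ζ) (S (γ s)))) (-P (col ζ) (F (γ b) - F (γ s)))
      rw [norm_smul, Complex.norm_real, Real.norm_of_nonneg hκ0.le, norm_neg, sub_neg_eq_add, add_comm ((κ : ℂ) • _)] at e3
      have e4 := mul_le_mul_of_nonneg_left (norm_sub_norm_le (P (col ζ) (S (γ b))) (P (col ζ) (S (γ s)))) hκ0.le
      linarith [hPn (col ζ) (F (γ b) - F (γ s))]
    have k4 : β / (2 * B) * Real.sqrt (θ * m) = κ * β * Real.sqrt m := by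
      rw [Real.sqrt_mul hθ.le, hκ]; ring
    rw [k4]
    refine le_trans ?_ k3
    have f2' := abs_le.1 f2
    have f3' := abs_le.1 f3
    have k5 : 2 * β * Real.sqrt m - 3 * β * ε - 2 * ε ≤ ‖P (col ζ) (S (γ b))‖ - ‖P (col ζ) (S (γ s))‖ := by
      nlinarith
    have k6 := mul_le_mul_of_nonneg_left k5 hκ0.le
    nlinarith

open MeasureTheory

lemma dep_seq {α : Type*} {p : ℕ → α → Prop} {R : ℕ → α → α → Prop} (h0 : ∃ x, p 0 x)
    (hs : ∀ k x, p k x → ∃ y, p (k+1) y ∧ R k x y) :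
    ∃ f : ℕ → α, (∀ k, p k (f k)) ∧ ∀ k, R k (f k) (f (k+1)) := by
  obtain ⟨x0, hx0⟩ := h0
  choose! nx hnx using hs
  let f : ℕ → α := fun k => Nat.rec x0 (fun k x => nx k x) k
  have hf : ∀ k, p k (f k) := by
    intro k
    induction k with
    | zero => exact hx0
    | succ k ih => exact (hnx k _ ih).1
  exact ⟨f, hf, fun k => (hnx k _ (hf k)).2⟩

/-- the approximating sequence -/
structure ApSeq {n N : ℕ} (D : Set (CSp n)) (ρ : CSp n → ℝ) (F : ℕ → CSp n → CSp N) (d : ℕ → ℝ) (Q : CSp N →L[ℂ] CSp n)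
    (ε c c0 : ℝ) : Prop where
  hε : 0 < ε
  hc : 0 < c
  hc0 : 0 < c0
  diff : ∀ k, DifferentiableOn ℂ (F k) D
  cont : ∀ k, ContinuousOn (F k) (closure D)
  q : ∀ k z, Q (F k z) = (ε : ℂ) • z
  gpos : ∀ k, ∀ z ∈ frontier D, 0 < 1 - ‖F k z‖^2
  gdec : ∀ k : ℕ, ∀ z ∈ frontier D, 1 - ‖F (k+1) z‖^2 ≤ (1 - c0 * (1/((k:ℝ)+2))) * (1 - ‖F k z‖^2)
  dpos : ∀ k, 0 < d k
  ddec : ∀ k, d (k+1) ≤ d k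
  dle : ∀ k : ℕ, d k ≤ 1/((k:ℝ)+1)
  near : ∀ k : ℕ, ∀ z ∈ closure D, ρ z ≤ - d k → ‖F (k+1) z - F k z‖ ≤ c/4 * (1/((k:ℝ)+1)) - c/4 * (1/((k:ℝ)+2))
  mono : ∀ k : ℕ, ∀ z ∈ closure D, ‖F k z‖^2 - (c/4 * (1/((k:ℝ)+1)) - c/4 * (1/((k:ℝ)+2))) ≤ ‖F (k+1) z‖^2
  path : ∀ (k : ℕ) (γ : ℝ → CSp n) (a b : ℝ), a ≤ b → ContinuousOn γ (Icc a b) → (∀ t ∈ Icc a b, γ t ∈ closure D) →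
    ρ (γ a) ≤ - d k → - d (k+1) ≤ ρ (γ b) → ∃ s ∈ Icc a b, c/((k:ℝ)+2) ≤ ‖F (k+1) (γ b) - F (k+1) (γ s)‖

lemma Spc.seq {n : ℕ} {D U : Set (CSp n)} {ρ : CSp n → ℝ} (h : Spc D U ρ) :
    ∃ N₀ : ℕ, ∀ N ≥ N₀, ∃ (F : ℕ → CSp n → CSp N) (d : ℕ → ℝ) (Q : CSp N →L[ℂ] CSp n) (ε c c0 : ℝ), ApSeq D ρ F d Q ε c c0 := by
  obtain ⟨Λ, _, Ω', B, β, hΩ', hcl, hB, hβ, hW⟩ := h.weights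
  refine ⟨n + 2 * Fintype.card Λ, fun N hN => ?_⟩
  obtain ⟨P, sel, Q, J, hPn, hsn, hsi, hPs, hPs0, hQs, hQJ⟩ := blocks n N Λ hN
  obtain ⟨M, hM⟩ := h.cptC.exists_bound_of_continuousOn (f := J) J.continuous.continuousOn
  set ε : ℝ := 1 / (2 * (|M| + 1)) with hε
  have hε0 : 0 < ε := by positivity
  set c : ℝ := β / (2 * B) * Real.sqrt (1/2) with hc
  have hc0 : 0 < c := by have : 0 < Real.sqrt (1/2) := Real.sqrt_pos.2 (by norm_num); positivity
  have hηpos : ∀ k : ℕ, 0 < c/4 * (1/((k:ℝ)+1)) - c/4 * (1/((k:ℝ)+2)) := by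
    intro k
    rw [← mul_sub]
    have : 1/((k:ℝ)+2) < 1/((k:ℝ)+1) := by gcongr; norm_num
    have : 0 < 1/((k:ℝ)+1) - 1/((k:ℝ)+2) := by linarith
    positivity
  refine Exists.elim (dep_seq (α := (CSp n → CSp N) × ℝ)
    (p := fun k x => DifferentiableOn ℂ x.1 Ω' ∧ (∀ z, Q (x.1 z) = (ε : ℂ) • z) ∧ 0 < x.2 ∧ x.2 ≤ 1/((k:ℝ)+1) ∧
      ∀ z ∈ frontier D, (1/2) * (1/((k:ℝ)+1)) ≤ 1 - ‖x.1 z‖^2)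
    (R := fun k x y => (∀ z ∈ frontier D, 1 - ‖y.1 z‖^2 ≤ (1 - β^2/B^2 * (1/((k:ℝ)+2))) * (1 - ‖x.1 z‖^2)) ∧ y.2 ≤ x.2 ∧
      (∀ z ∈ closure D, ρ z ≤ - x.2 → ‖y.1 z - x.1 z‖ ≤ c/4 * (1/((k:ℝ)+1)) - c/4 * (1/((k:ℝ)+2))) ∧
      (∀ z ∈ closure D, ‖x.1 z‖^2 - (c/4 * (1/((k:ℝ)+1)) - c/4 * (1/((k:ℝ)+2))) ≤ ‖y.1 z‖^2) ∧
      (∀ (γ : ℝ → CSp n) (a b : ℝ), a ≤ b → ContinuousOn γ (Icc a b) → (∀ t ∈ Icc a b, γ t ∈ closure D) →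
        ρ (γ a) ≤ - x.2 → - y.2 ≤ ρ (γ b) → ∃ s ∈ Icc a b, c/((k:ℝ)+2) ≤ ‖y.1 (γ b) - y.1 (γ s)‖))
    ?_ ?_) ?_
  · refine ⟨(fun z => (ε : ℂ) • J z, 1), ?_, ?_, one_pos, by simp, ?_⟩
    · exact (J.differentiable.fun_const_smul (ε : ℂ)).differentiableOn
    · intro z; simp only [map_smul, hQJ]
    · intro z hz
      have h1 := hM z (frontier_subset_closure hz)
      have h2 : ‖(ε : ℂ) • J z‖ ≤ 1/2 := by
        rw [norm_smul, Complex.norm_real, Real.norm_of_nonneg hε0.le]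
        calc ε * ‖J z‖ ≤ ε * (|M| + 1) := by gcongr; linarith [le_abs_self M]
          _ = 1/2 := by rw [hε]; field_simp
      have h3 : ‖(ε : ℂ) • J z‖^2 ≤ (1/2)^2 := by gcongr
      simp only [Nat.cast_zero]
      linarith
  · rintro k ⟨F, d⟩ ⟨hF, hQ, hd, hdk, hg⟩
    simp only at hF hQ hd hdk hg
    obtain ⟨F', g1, g2, g3, g4, g5, d', hd', hdd', g6⟩ := h.step hW hcl hB hβ hPn hsn hsi hPs hPs0 hQs hF (θ := 1/((k:ℝ)+2))
      (m := (1/2) * (1/((k:ℝ)+1))) (d := d) (η := c/4 * (1/((k:ℝ)+1)) - c/4 * (1/((k:ℝ)+2))) (by positivity) (by positivity) hd (hηpos k) hg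
    refine ⟨(F', min d' (1/(((k+1 : ℕ):ℝ)+1))), ⟨g1, fun z => (g2 z).trans (hQ z), by positivity, min_le_right _ _, fun z hz => ?_⟩,
      fun z hz => (g3 z hz).2, (min_le_left _ _).trans hdd'.le, g4, g5, ?_⟩
    · refine le_trans ?_ (g3 z hz).1
      have h1 : (0:ℝ) ≤ 1 - 1/((k:ℝ)+2) := by
        rw [sub_nonneg, div_le_one (by positivity)]
        linarith [Nat.cast_nonneg (α := ℝ) k]
      refine le_trans (le_of_eq ?_) (mul_le_mul_of_nonneg_left (hg z hz) h1)
      push_cast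
      field_simp
      ring
    · intro γ a b hab hγ hγD ha hb
      obtain ⟨s, hs, hsl⟩ := g6 γ a b hab hγ hγD ha (by
        have := min_le_left d' (1/(((k+1 : ℕ):ℝ)+1))
        simp only at hb
        linarith)
      refine ⟨s, hs, le_trans ?_ hsl⟩
      rw [hc, mul_div_assoc]
      refine mul_le_mul_of_nonneg_left ?_ (by positivity)
      apply Real.le_sqrt_of_sq_le
      rw [div_pow, Real.sq_sqrt (by norm_num)]
      have : 1/((k:ℝ)+2) ≤ 1/((k:ℝ)+1) := by gcongr; norm_num
      calc (1/2 : ℝ) / ((k:ℝ)+2)^2 = 1/((k:ℝ)+2) * (1/2 * (1/((k:ℝ)+2))) := by field_simp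
        _ ≤ _ := by gcongr
  · rintro f ⟨hf1, hf2⟩
    refine ⟨fun k => (f k).1, fun k => (f k).2, Q, ε, c, β^2/B^2, ⟨hε0, hc0, by positivity, fun k => (hf1 k).1.mono (subset_closure.trans hcl),
      fun k => (hf1 k).1.continuousOn.mono hcl, fun k => (hf1 k).2.1, fun k z hz => ?_, fun k => (hf2 k).1, fun k => (hf1 k).2.2.1,
      fun k => (hf2 k).2.1, fun k => (hf1 k).2.2.2.1, fun k => (hf2 k).2.2.1, fun k => (hf2 k).2.2.2.1, fun k => (hf2 k).2.2.2.2⟩⟩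
    refine lt_of_lt_of_le ?_ ((hf1 k).2.2.2.2 z hz)
    positivity

open MeasureTheory

lemma harm_tendsto (a : ℕ) : Tendsto (fun m : ℕ => ∑ i ∈ Finset.range m, 1/(((a + i : ℕ):ℝ)+2)) atTop atTop := by
  have h1 := Real.tendsto_sum_range_one_div_nat_succ_atTop.comp (tendsto_add_atTop_nat (a+1))
  have h2 : Tendsto (fun m : ℕ => (∑ i ∈ Finset.range (a + 1 + m), 1/((i:ℝ)+1)) + (- ∑ i ∈ Finset.range (a+1), 1/((i:ℝ)+1))) atTop atTop := by
    refine tendsto_atTop_add_const_right _ _ ?_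
    refine h1.congr fun m => ?_
    simp only [comp]
    rw [add_comm m]
  refine h2.congr fun m => ?_
  rw [Finset.sum_range_add]
  rw [add_neg_cancel_comm]
  refine Finset.sum_congr rfl fun i _ => ?_
  push_cast
  ring

namespace ApSeq
variable {n N : ℕ} {D U : Set (CSp n)} {ρ : CSp n → ℝ} {F : ℕ → CSp n → CSp N} {d : ℕ → ℝ} {Q : CSp N →L[ℂ] CSp n} {ε c c0 : ℝ}

lemma d_anti (S : ApSeq D ρ F d Q ε c c0) : Antitone d := antitone_nat_of_succ_le S.ddec

lemma tele (S : ApSeq D ρ F d Q ε c c0) {k j : ℕ} (hkj : k ≤ j) {z : CSp n} (hz : z ∈ closure D) (hρ : ρ z ≤ - d k) :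
    ‖F j z - F k z‖ ≤ c/4 * (1/((k:ℝ)+1)) - c/4 * (1/((j:ℝ)+1)) := by
  induction j, hkj using Nat.le_induction with
  | base => simp
  | succ j hj ih =>
    have h1 := S.near j z hz (by linarith [S.d_anti hj])
    have h2 := norm_add_le (F (j+1) z - F j z) (F j z - F k z)
    rw [sub_add_sub_cancel] at h2
    push_cast
    rw [show (j:ℝ) + 1 + 1 = j + 2 by ring]
    linarith

lemma tele2 (S : ApSeq D ρ F d Q ε c c0) {k j : ℕ} (hkj : k ≤ j) {z : CSp n} (hz : z ∈ closure D) :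
    ‖F k z‖^2 - (c/4 * (1/((k:ℝ)+1)) - c/4 * (1/((j:ℝ)+1))) ≤ ‖F j z‖^2 := by
  induction j, hkj using Nat.le_induction with
  | base => simp
  | succ j hj ih =>
    have h1 := S.mono j z hz
    push_cast
    rw [show (j:ℝ) + 1 + 1 = j + 2 by ring]
    linarith

lemma d_lim (S : ApSeq D ρ F d Q ε c c0) {r : ℝ} (hr : 0 < r) : ∃ k, d k ≤ r := by
  obtain ⟨k, hk⟩ := exists_nat_one_div_lt hr
  exact ⟨k, (S.dle k).trans hk.le⟩

lemma e_nonneg (S : ApSeq D ρ F d Q ε c c0) (k : ℕ) : 0 ≤ c/4 * (1/((k:ℝ)+1)) := by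
  have := S.hc
  positivity

lemma e_lim (c : ℝ) : Tendsto (fun k : ℕ => c/4 * (1/((k:ℝ)+1))) atTop (𝓝 0) := by
  have := (tendsto_one_div_add_atTop_nhds_zero_nat (𝕜 := ℝ)).const_mul (c/4)
  rwa [mul_zero] at this

lemma ucs (S : ApSeq D ρ F d Q ε c c0) (k0 : ℕ) : UniformCauchySeqOn F atTop {z | z ∈ closure D ∧ ρ z ≤ - d k0} := by
  rw [Metric.uniformCauchySeqOn_iff]
  intro δ hδ
  obtain ⟨k, hk, hk0⟩ := (((e_lim c).eventually (gt_mem_nhds (half_pos hδ))).and (eventually_ge_atTop k0)).exists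
  have key : ∀ j ≥ k, ∀ z ∈ {z | z ∈ closure D ∧ ρ z ≤ - d k0}, dist (F j z) (F k z) < δ/2 := by
    intro j hj z hz
    rw [dist_eq_norm]
    have := S.tele hj hz.1 (by linarith [S.d_anti hk0, hz.2])
    linarith [S.e_nonneg j]
  refine ⟨k, fun i hi j hj z hz => ?_⟩
  have h1 := key i hi z hz
  have h2 := key j hj z hz
  linarith [dist_triangle_right (F i z) (F j z) (F k z)]

/-- existence and basic properties of the limit map -/
lemma lim (S : ApSeq D ρ F d Q ε c c0) (h : Spc D U ρ) : ∃ G : CSp n → CSp N, (∀ z ∈ D, Tendsto (fun k => F k z) atTop (𝓝 (G z))) ∧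
    DifferentiableOn ℂ G D ∧ (∀ z ∈ D, Q (G z) = (ε : ℂ) • z) ∧
    (∀ k, ∀ z ∈ D, ρ z ≤ - d k → ‖G z - F k z‖ ≤ c/4 * (1/((k:ℝ)+1))) ∧
    (∀ k, ∀ z ∈ D, ‖F k z‖^2 - c/4 * (1/((k:ℝ)+1)) ≤ ‖G z‖^2) := by
  have hneg : ∀ z ∈ D, ρ z < 0 := fun z hz => by rw [h.eq] at hz; exact hz
  have hlim : ∀ z ∈ D, ∃ w, Tendsto (fun k => F k z) atTop (𝓝 w) := by
    intro z hz
    obtain ⟨k, hk⟩ := S.d_lim (neg_pos.2 (hneg z hz))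
    exact cauchySeq_tendsto_of_complete ((S.ucs k).cauchySeq ⟨subset_closure hz, by linarith⟩)
  choose! G hG using hlim
  refine ⟨G, hG, fun z hz => ?_, fun z hz => ?_, fun k z hz hρ => ?_, fun k z hz => ?_⟩
  · obtain ⟨k, hk⟩ := S.d_lim (half_pos (neg_pos.2 (hneg z hz)))
    have ho : IsOpen (D ∩ {w | ρ w < - d k}) := h.open_D.inter (isOpen_lt h.cont continuous_const)
    obtain ⟨r, hr, hball⟩ := Metric.isOpen_iff.1 ho z ⟨hz, by
      have := hneg z hz
      show ρ z < - d k
      linarith⟩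
    refine (holo_lim hr (fun k => (S.diff k).mono fun w hw => (hball hw).1) ((S.ucs k).mono fun w hw => ?_) fun w hw => hG w (hball hw).1).differentiableWithinAt
    exact ⟨subset_closure (hball hw).1, le_of_lt (hball hw).2⟩
  · have h1 := (Q.continuous.tendsto (G z)).comp (hG z hz)
    refine tendsto_nhds_unique h1 ?_
    have : (fun x => Q x) ∘ (fun k => F k z) = fun _ => (ε : ℂ) • z := funext fun k => S.q k z
    exact this ▸ tendsto_const_nhds
  · refine le_of_tendsto ((hG z hz).sub_const (F k z)).norm ?_
    filter_upwards [eventually_ge_atTop k] with j hj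
    linarith [S.tele hj (subset_closure hz) hρ, S.e_nonneg j]
  · refine ge_of_tendsto ((hG z hz).norm.pow 2) ?_
    filter_upwards [eventually_ge_atTop k] with j hj
    linarith [S.tele2 hj (subset_closure hz), S.e_nonneg j]

lemma gap_exp (S : ApSeq D ρ F d Q ε c c0) (k : ℕ) : ∀ z ∈ frontier D,
    1 - ‖F k z‖^2 ≤ Real.exp (-(c0 * ∑ i ∈ Finset.range k, 1/(((0 + i : ℕ):ℝ)+2))) := by
  intro z hz
  induction k with
  | zero => simp
  | succ k ih =>
    refine (S.gdec k z hz).trans ?_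
    have h1 := Real.add_one_le_exp (-(c0 * (1/((k:ℝ)+2))))
    calc _ ≤ Real.exp (-(c0 * (1/((k:ℝ)+2)))) * Real.exp (-(c0 * ∑ i ∈ Finset.range k, 1/(((0 + i : ℕ):ℝ)+2))) := by
          have := S.gpos k z hz
          gcongr
          linarith
      _ = _ := by
          rw [← Real.exp_add, Finset.sum_range_succ, zero_add]
          congr 1
          ring

lemma gap_lim (S : ApSeq D ρ F d Q ε c c0) {δ : ℝ} (hδ : 0 < δ) : ∀ᶠ k in atTop, ∀ z ∈ frontier D, 1 - ‖F k z‖^2 ≤ δ := by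
  have h1 := Real.tendsto_exp_neg_atTop_nhds_zero.comp ((harm_tendsto 0).const_mul_atTop S.hc0)
  filter_upwards [h1.eventually (gt_mem_nhds hδ)] with k hk z hz
  exact (S.gap_exp k z hz).trans hk.le

/-- the limit map is close to the sphere near the boundary -/
lemma proper_bd (S : ApSeq D ρ F d Q ε c c0) (h : Spc D U ρ) {G : CSp n → CSp N}
    (hG : ∀ k, ∀ z ∈ D, ‖F k z‖^2 - c/4 * (1/((k:ℝ)+1)) ≤ ‖G z‖^2) {q : ℝ} (hq : q < 1) :
    ∃ r > 0, ∀ z ∈ D, -r < ρ z → q < ‖G z‖^2 := by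
  obtain ⟨k, hk1, hk2⟩ := (((e_lim c).eventually (gt_mem_nhds (by linarith : 0 < (1-q)/4))).and (S.gap_lim (by linarith : 0 < (1-q)/4))).exists
  set K : Set (CSp n) := closure D ∩ (fun z => ‖F k z‖^2) ⁻¹' Iic (1 - (1-q)/2) with hK
  have hKc : IsCompact K := h.cptC.of_isClosed_subset
    (((S.cont k).norm.pow 2).preimage_isClosed_of_isClosed isClosed_closure isClosed_Iic) inter_subset_left
  have hr : ∃ r > 0, ∀ z ∈ K, ρ z ≤ -r := by
    rcases K.eq_empty_or_nonempty with he | hne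
    · exact ⟨1, one_pos, fun z hz => by rw [he] at hz; exact absurd hz (notMem_empty _)⟩
    · obtain ⟨p, hp, hmax⟩ := hKc.exists_isMaxOn hne h.cont.continuousOn
      refine ⟨-ρ p, ?_, fun z hz => by simpa using hmax hz⟩
      by_contra hn
      have hpf : p ∈ frontier D := by
        rw [h.open_D.frontier_eq]
        refine ⟨hp.1, fun hpD => ?_⟩
        rw [h.eq] at hpD
        have : ρ p < 0 := hpD
        linarith
      have h1 := hk2 p hpf
      have h2 : ‖F k p‖^2 ≤ 1 - (1-q)/2 := hp.2
      linarith
  obtain ⟨r, hr, hrK⟩ := hr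
  refine ⟨r, hr, fun z hz hzr => ?_⟩
  have h1 : z ∉ K := fun hzK => by linarith [hrK z hzK]
  have h2 : 1 - (1-q)/2 < ‖F k z‖^2 := by
    by_contra hn
    exact h1 ⟨subset_closure hz, not_lt.1 hn⟩
  linarith [hG k z hz]

lemma ball (S : ApSeq D ρ F d Q ε c c0) (h : Spc D U ρ) (hn : 0 < n) {G : CSp n → CSp N}
    (hG : ∀ z ∈ D, Tendsto (fun k => F k z) atTop (𝓝 (G z))) (hGd : DifferentiableOn ℂ G D) (hQ : ∀ z ∈ D, Q (G z) = (ε : ℂ) • z) :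
    MapsTo G D (Metric.ball 0 1) := by
  have : Nontrivial (CSp n) := by
    have : Nonempty (Fin n) := ⟨⟨0, hn⟩⟩
    infer_instance
  have hle : ∀ z ∈ D, ‖G z‖ ≤ 1 := by
    intro z hz
    refine le_of_tendsto (hG z hz).norm (Eventually.of_forall fun k => ?_)
    refine Complex.norm_le_of_forall_mem_frontier_norm_le h.bdd ⟨S.diff k, S.cont k⟩ (fun w hw => ?_) (subset_closure hz)
    have := S.gpos k w hw
    nlinarith [norm_nonneg (F k w)]
  intro z hz
  rw [mem_ball_zero_iff]
  refine lt_of_le_of_ne (hle z hz) fun heq => ?_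
  have hmax : IsMaxOn (norm ∘ G) D z := fun w hw => by
    show ‖G w‖ ≤ ‖G z‖
    rw [heq]; exact hle w hw
  have hconst := Complex.eqOn_of_isPreconnected_of_isMaxOn_norm h.conn.isPreconnected h.open_D hGd hz hmax
  obtain ⟨w, hw, hwz⟩ : ∃ w ∈ D, w ≠ z := by
    by_contra hno
    push Not at hno
    have : D = {z} := Subset.antisymm hno (singleton_subset_iff.2 hz)
    have h1 := h.open_D
    rw [this] at h1
    exact not_isOpen_singleton z h1
  have h1 := hQ w hw
  rw [hconst hw, Function.const_apply, hQ z hz] at h1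
  have hε : (ε : ℂ) ≠ 0 := by exact_mod_cast S.hε.ne'
  exact hwz (smul_right_injective _ hε h1).symm

end ApSeq

open MeasureTheory

/-- first hitting time -/
lemma hit {n : ℕ} {D U : Set (CSp n)} {ρ : CSp n → ℝ} (h : Spc D U ρ) {γ : ℝ → CSp n} (hγ : IsDivergentPath D γ) {t0 r : ℝ}
    (ht0 : t0 ∈ Ico (0:ℝ) 1) (hr : 0 < r) (h0 : ρ (γ t0) ≤ -r) :
    ∃ t1 ∈ Ico t0 1, ρ (γ t1) = -r ∧ ∀ t ∈ Icc t0 t1, ρ (γ t) ≤ -r := by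
  obtain ⟨hc, hD, hdiv⟩ := hγ
  set K : Set (CSp n) := closure D ∩ {z | ρ z ≤ -r} with hK
  have hKc : IsCompact K := h.cptC.inter_right (isClosed_le h.cont continuous_const)
  have hKD : K ⊆ D := by
    intro z hz
    rw [h.eq]
    have : ρ z ≤ -r := hz.2
    show ρ z < 0
    linarith
  obtain ⟨s, hs, hsK⟩ := hdiv K hKD hKc
  set b := max t0 s with hb
  have hb1 : b < 1 := max_lt ht0.2 hs.2
  have htb : t0 ≤ b := le_max_left _ _
  have hb0 : 0 ≤ b := ht0.1.trans htb
  have hρb : -r ≤ ρ (γ b) := by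
    by_contra hlt
    exact hsK b ⟨le_max_right _ _, hb1⟩ ⟨subset_closure (hD b ⟨hb0, hb1⟩), (not_le.1 hlt).le⟩
  have hcb : ContinuousOn (fun t => ρ (γ t)) (Icc t0 b) := h.cont.comp_continuousOn
    (hc.mono fun t ht => ⟨ht0.1.trans ht.1, ht.2.trans_lt hb1⟩)
  set Z : Set ℝ := Icc t0 b ∩ (fun t => ρ (γ t)) ⁻¹' {-r} with hZ
  have hZc : IsCompact Z := isCompact_Icc.of_isClosed_subset (hcb.preimage_isClosed_of_isClosed isClosed_Icc isClosed_singleton) inter_subset_left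
  have hZn : Z.Nonempty := by
    obtain ⟨t, ht, hte⟩ := intermediate_value_Icc htb hcb ⟨h0, hρb⟩
    exact ⟨t, ht, hte⟩
  obtain ⟨t1, ht1, hmin⟩ := hZc.exists_isLeast hZn
  refine ⟨t1, ⟨ht1.1.1, ht1.1.2.trans_lt hb1⟩, ht1.2, fun t ht => ?_⟩
  by_contra hlt
  obtain ⟨t2, ht2, he⟩ := intermediate_value_Icc ht.1 (hcb.mono (Icc_subset_Icc_right (ht.2.trans ht1.1.2))) ⟨h0, (not_le.1 hlt).le⟩
  have h3 := hmin ⟨⟨ht2.1, ht2.2.trans (ht.2.trans ht1.1.2)⟩, he⟩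
  have h4 : t = t1 := le_antisymm ht.2 (h3.trans ht2.2)
  rw [h4] at hlt
  exact hlt (le_of_eq ht1.2)

lemma ApSeq.complete {n N : ℕ} {D U : Set (CSp n)} {ρ : CSp n → ℝ} {F : ℕ → CSp n → CSp N} {d : ℕ → ℝ} {Q : CSp N →L[ℂ] CSp n} {ε c c0 : ℝ}
    (S : ApSeq D ρ F d Q ε c c0) (h : Spc D U ρ) {G : CSp n → CSp N}
    (hG : ∀ k, ∀ z ∈ D, ρ z ≤ - d k → ‖G z - F k z‖ ≤ c/4 * (1/((k:ℝ)+1))) : IsCompleteMapOn G D := by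
  intro γ hγ
  have hγ' := hγ
  obtain ⟨hc, hD, -⟩ := hγ'
  have hneg : ∀ z ∈ D, ρ z < 0 := fun z hz => by rw [h.eq] at hz; exact hz
  obtain ⟨k0, hk0⟩ := S.d_lim (neg_pos.2 (hneg _ (hD 0 ⟨le_rfl, one_pos⟩)))
  refine Exists.elim (dep_seq (α := ℝ) (p := fun i t => t ∈ Ico (0:ℝ) 1 ∧ ρ (γ t) = - d (k0 + i))
    (R := fun i t t' => t ≤ t' ∧ ∃ s ∈ Icc t t', c/2 * (1/(((k0 + i : ℕ):ℝ)+2)) ≤ ‖G (γ t') - G (γ s)‖) ?_ ?_) ?_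
  · obtain ⟨t, ht, h1, -⟩ := hit h hγ (t0 := 0) (r := d k0) ⟨le_rfl, one_pos⟩ (S.dpos k0) (by linarith)
    exact ⟨t, ht, by simpa using h1⟩
  · rintro i t ⟨ht, hρt⟩
    obtain ⟨t', ht', h1, h2⟩ := hit h hγ (t0 := t) (r := d (k0 + i + 1)) ht (S.dpos _) (by rw [hρt]; linarith [S.ddec (k0 + i)])
    have hsub : Icc t t' ⊆ Ico (0:ℝ) 1 := fun s hs => ⟨ht.1.trans hs.1, hs.2.trans_lt ht'.2⟩
    refine ⟨t', ⟨⟨ht.1.trans ht'.1, ht'.2⟩, h1⟩, ht'.1, ?_⟩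
    obtain ⟨s, hs, hle⟩ := S.path (k0 + i) γ t t' ht'.1 (hc.mono hsub) (fun s hs => subset_closure (hD s (hsub hs))) hρt.le h1.ge
    refine ⟨s, hs, ?_⟩
    have e1 := hG (k0 + i + 1) (γ t') (hD t' (hsub (right_mem_Icc.2 ht'.1))) h1.le
    have e2 := hG (k0 + i + 1) (γ s) (hD s (hsub hs)) (h2 s hs)
    have e3 : F (k0 + i + 1) (γ t') - F (k0 + i + 1) (γ s) = (G (γ t') - G (γ s)) - (G (γ t') - F (k0 + i + 1) (γ t')) + (G (γ s) - F (k0 + i + 1) (γ s)) := by abel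
    rw [e3] at hle
    have e4 := norm_add_le ((G (γ t') - G (γ s)) - (G (γ t') - F (k0 + i + 1) (γ t'))) (G (γ s) - F (k0 + i + 1) (γ s))
    have e5 := norm_sub_le (G (γ t') - G (γ s)) (G (γ t') - F (k0 + i + 1) (γ t'))
    have e6 : c/4 * (1/(((k0 + i + 1 : ℕ):ℝ)+1)) = c/4 * (1/(((k0 + i : ℕ):ℝ)+2)) := by push_cast; ring
    rw [e6] at e1 e2
    have e7 : c / (((k0 + i : ℕ):ℝ)+2) = c * (1/(((k0 + i : ℕ):ℝ)+2)) := by ring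
    rw [e7] at hle
    linarith
  · rintro t ⟨ht, hR⟩
    have htm : Monotone t := monotone_nat_of_le_succ fun i => (hR i).1
    have hvar : ∀ m : ℕ, ENNReal.ofReal (c/2 * ∑ i ∈ Finset.range m, 1/(((k0 + i : ℕ):ℝ)+2)) ≤ eVariationOn (G ∘ γ) (Ico 0 1 ∩ Icc (t 0) (t m)) := by
      intro m
      induction m with
      | zero => simp
      | succ m ih =>
        rw [← eVariationOn.Icc_add_Icc (G ∘ γ) (htm (Nat.zero_le m)) (hR m).1 (ht m).1, Finset.sum_range_succ, mul_add]
        refine ENNReal.ofReal_add_le.trans (add_le_add ih ?_)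
        obtain ⟨s, hs, hle⟩ := (hR m).2
        refine le_trans ?_ (eVariationOn.edist_le (G ∘ γ) (x := t (m+1)) (y := s) ⟨(ht (m+1)).1, (hR m).1, le_rfl⟩
          ⟨⟨(ht m).1.1.trans hs.1, hs.2.trans_lt (ht (m+1)).1.2⟩, hs⟩)
        rw [edist_dist, dist_eq_norm]
        exact ENNReal.ofReal_le_ofReal hle
    by_contra htop
    have hdiv := (harm_tendsto k0).const_mul_atTop (half_pos S.hc)
    obtain ⟨m, hm⟩ := (hdiv.eventually_gt_atTop (eVariationOn (G ∘ γ) (Ico 0 1)).toReal).exists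
    have h1 := (hvar m).trans (eVariationOn.mono (G ∘ γ) inter_subset_left)
    rw [← ENNReal.ofReal_toReal htop] at h1
    rw [ENNReal.ofReal_le_ofReal_iff ENNReal.toReal_nonneg] at h1
    linarith

/-- Corollary 1.2. Let `D` be a bounded strictly pseudoconvex domain with
`C²` boundary in `ℂⁿ`. For all sufficiently large `N` there exists a complete proper
holomorphic embedding `F : D → 𝔹_N`. -/
theorem complete_proper_embedding_strictly_pseudoconvex
    {n : ℕ} (D : Set (CSp n)) (hD : IsStrictlyPseudoconvexC2Domain D) :
    ∃ N₀ : ℕ, ∀ N : ℕ, N₀ ≤ N →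
      ∃ F : CSp n → EuclideanSpace ℂ (Fin N),
        -- `F` is a holomorphic embedding of `D` ...
        DifferentiableOn ℂ F D ∧
        InjOn F D ∧
        (∀ z ∈ D, Injective (fderiv ℂ F z)) ∧
        -- ... proper into the unit ball `𝔹_N` ...
        MapsTo F D (ball 0 1) ∧
        (∀ K : Set (EuclideanSpace ℂ (Fin N)), K ⊆ ball 0 1 → IsCompact K →
          IsCompact (D ∩ F ⁻¹' K)) ∧
        -- ... and complete.
        IsCompleteMapOn F D := by
  obtain ⟨ho, hcn, hbd, U, ρ, hU, hfU, hs, heq, hdne, hlev⟩ := hD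
  have h : Spc D U ρ := ⟨ho, hcn, hbd, hU, hfU, hs, heq, hdne, hlev⟩
  rcases Nat.eq_zero_or_pos n with hn | hn
  · subst hn
    refine ⟨0, fun N _ => ⟨fun _ => 0, differentiableOn_const _, fun x _ y _ _ => Subsingleton.elim x y,
      fun z _ x y _ => Subsingleton.elim x y, fun z _ => by simp, fun K _ _ => (Set.subsingleton_of_subsingleton).isCompact, ?_⟩⟩
    intro γ hγ
    obtain ⟨t, ht, hK⟩ := hγ.2.2 D le_rfl (Set.subsingleton_of_subsingleton).isCompact
    exact absurd (hγ.2.1 t ht) (hK t ⟨le_rfl, ht.2⟩)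
  · obtain ⟨N₀, hN₀⟩ := h.seq
    refine ⟨N₀, fun N hN => ?_⟩
    obtain ⟨F, d, Q, ε, c, c0, S⟩ := hN₀ N hN
    obtain ⟨G, h1, h2, h3, h4, h5⟩ := S.lim h
    have hε : (ε : ℂ) ≠ 0 := by exact_mod_cast S.hε.ne'
    have hball := S.ball h hn h1 h2 h3
    refine ⟨G, h2, ?_, ?_, hball, ?_, S.complete h h4⟩
    · intro z hz w hw hzw
      have e := h3 z hz
      rw [hzw, h3 w hw] at e
      exact (smul_right_injective _ hε e).symm
    · intro z hz
      have hd : DifferentiableAt ℂ G z := h2.differentiableAt (ho.mem_nhds hz)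
      have e1 : HasFDerivAt (fun w => Q (G w)) (Q.comp (fderiv ℂ G z)) z := Q.hasFDerivAt.comp z hd.hasFDerivAt
      have e2 : HasFDerivAt (fun w : CSp n => (ε : ℂ) • w) ((ε : ℂ) • ContinuousLinearMap.id ℂ (CSp n)) z := (hasFDerivAt_id z).const_smul (ε : ℂ)
      have e3 : HasFDerivAt (fun w : CSp n => (ε : ℂ) • w) (Q.comp (fderiv ℂ G z)) z :=
        e1.congr_of_eventuallyEq (by filter_upwards [ho.mem_nhds hz] with w hw using (h3 w hw).symm)
      have e4 := e3.unique e2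
      intro v w hvw
      have e5 : Q (fderiv ℂ G z v) = (ε : ℂ) • v := congrArg (fun L : CSp n →L[ℂ] CSp n => L v) e4
      have e6 : Q (fderiv ℂ G z w) = (ε : ℂ) • w := congrArg (fun L : CSp n →L[ℂ] CSp n => L w) e4
      rw [hvw, e6] at e5
      exact (smul_right_injective _ hε e5).symm
    · intro K hK hKc
      obtain ⟨q, hq, hKq⟩ : ∃ q < 1, ∀ w ∈ K, ‖w‖^2 ≤ q := by
        rcases K.eq_empty_or_nonempty with he | hne
        · exact ⟨0, one_pos, fun w hw => by rw [he] at hw; exact absurd hw (notMem_empty _)⟩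
        · obtain ⟨p, hp, hmax⟩ := hKc.exists_isMaxOn hne (f := fun w => ‖w‖^2) (by fun_prop)
          refine ⟨‖p‖^2, ?_, fun w hw => hmax hw⟩
          have := mem_ball_zero_iff.1 (hK hp)
          nlinarith [norm_nonneg p]
      obtain ⟨r, hr, hrz⟩ := S.proper_bd h h5 hq
      have hC : IsCompact (closure D ∩ {z | ρ z ≤ -r}) := h.cptC.inter_right (isClosed_le h.cont continuous_const)
      have hCD : closure D ∩ {z | ρ z ≤ -r} ⊆ D := by
        intro z hz
        rw [heq]
        have : ρ z ≤ -r := hz.2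
        show ρ z < 0
        linarith
      have e : D ∩ G ⁻¹' K = (closure D ∩ {z | ρ z ≤ -r}) ∩ G ⁻¹' K := by
        ext z
        constructor
        · rintro ⟨hz, hzK⟩
          refine ⟨⟨subset_closure hz, ?_⟩, hzK⟩
          show ρ z ≤ -r
          by_contra hlt
          linarith [hrz z hz (not_le.1 hlt), hKq _ hzK]
        · rintro ⟨hz, hzK⟩
          exact ⟨hCD hz, hzK⟩
      rw [e]
      exact hC.of_isClosed_subset ((h2.continuousOn.mono hCD).preimage_isClosed_of_isClosed hC.isClosed hKc.isClosed) inter_subset_left
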